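/- arXiv:1801.09140 — 3 statements merged into one kernel-verified Lean document; each statement's English description precedes it below -/
import Mathlib

section
/- Let (v, π) be a configuration with v e ≠ 0 for every e ∈ E, no two of the vectors v e, v e' (e ≠ e') parallel, and let r = dim span{v e : e ∈ E}. Then (v, π) is all-coherent if and only if there does not exist a cellular string (E_1, …, E_l) of (v, π) with l ≥ 2 such that ∑_{i=1}^l (dim span{v e : e ∈ E_i} − 1) ≥ r − 1. -/
open Finset

section CommonDefs

variable {E : Type*} [Fintype E] {V : Type*} [AddCommGroup V] [Module ℝ V]

/-- An ordered set partition of the finite index set `E` with `l` blocks is encoded by a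
surjective block map `b : E → Fin l` (block `E_i = b⁻¹ i`, blocks listed in the order of
`Fin l`).  Such an ordered set partition is a *cellular string* of the configuration `v` if
for each block index `i` there is a linear functional vanishing on the vectors of block `i`,
negative on the vectors of earlier blocks and positive on the vectors of later blocks. -/
def IsCellularString (v : E → V) (l : ℕ) (b : E → Fin l) : Prop :=
  Function.Surjective b ∧
  ∀ i : Fin l, ∃ φ : V →ₗ[ℝ] ℝ, ∀ e : E,
    (b e = i → φ (v e) = 0) ∧ (b e < i → φ (v e) < 0) ∧ (i < b e → 0 < φ (v e))

/-- A cellular string (ordered set partition) is *coherent* for the configuration `(v, π)` if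
some linear functional `ψ` orders the ratios `ψ(v e)/π(v e)` according to the blocks:
equal within a block, strictly increasing between blocks. -/
def IsCoherent (v : E → V) (π : V →ₗ[ℝ] ℝ) (l : ℕ) (b : E → Fin l) : Prop :=
  ∃ ψ : V →ₗ[ℝ] ℝ, ∀ e e' : E,
    (b e = b e' → ψ (v e) / π (v e) = ψ (v e') / π (v e')) ∧
    (b e < b e' → ψ (v e) / π (v e) < ψ (v e') / π (v e'))

/-- The configuration `(v, π)` is *all-coherent* if every cellular string is coherent. -/
def AllCoherent (v : E → V) (π : V →ₗ[ℝ] ℝ) : Prop :=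
  ∀ (l : ℕ) (b : E → Fin l), IsCellularString v l b → IsCoherent v π l b

end CommonDefs

section Strings

variable {E : Type*} {V : Type*} [AddCommGroup V] [Module ℝ V]

/-- A nontrivial cellular string whose blocks have total reduced rank at least `r - 1`. -/
def HasBigString [Fintype E] (w : E → V) (r : ℕ) : Prop :=
  ∃ (l : ℕ) (b : E → Fin l), IsCellularString w l b ∧ 2 ≤ l ∧
    (r : ℤ) - 1 ≤ ∑ i : Fin l,
      ((Module.finrank ℝ (Submodule.span ℝ (w '' {e | b e = i})) : ℤ) - 1)

/-- `τ` prescribes the sign patterns of functionals on `w`, one for each level. -/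
def IsLevelMap {T : Type*} [LinearOrder T] (w : E → V) (τ : E → T) : Prop :=
  ∀ e₀, ∃ φ : V →ₗ[ℝ] ℝ, ∀ e,
    (τ e = τ e₀ → φ (w e) = 0) ∧ (τ e < τ e₀ → φ (w e) < 0) ∧ (τ e₀ < τ e → 0 < φ (w e))

theorem IsLevelMap.exists_orderIso [Fintype E] {T : Type*} [LinearOrder T] {w : E → V} {τ : E → T}
    (h : IsLevelMap w τ) :
    ∃ (l : ℕ) (b : E → Fin l) (o : Fin l ≃o (univ.image τ : Finset T)),
      IsCellularString w l b ∧ ∀ e, (o (b e) : T) = τ e := by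
  classical
  let o := (univ.image τ : Finset T).orderIsoOfFin rfl
  have hb : ∀ e, τ e ∈ (univ.image τ : Finset T) := fun e => mem_image_of_mem _ (mem_univ e)
  let b : E → Fin (univ.image τ : Finset T).card := fun e => o.symm ⟨τ e, hb e⟩
  have hob : ∀ e, (o (b e) : T) = τ e := fun e => by simp [b]
  refine ⟨_, b, o, ⟨fun i => ?_, fun i => ?_⟩, hob⟩
  · obtain ⟨e, -, he⟩ := mem_image.1 (o i).2
    exact ⟨e, o.injective (Subtype.ext ((hob e).trans he))⟩
  · obtain ⟨e₀, -, he₀⟩ := mem_image.1 (o i).2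
    obtain ⟨φ, hφ⟩ := h e₀
    refine ⟨φ, fun e => ⟨fun hi => (hφ e).1 ?_, fun hi => (hφ e).2.1 ?_, fun hi => (hφ e).2.2 ?_⟩⟩
    · rw [he₀, ← hob, hi]
    · rw [he₀, ← hob]; exact o.strictMono hi
    · rw [he₀, ← hob]; exact o.strictMono hi

theorem one_le_finrank_span_image [FiniteDimensional ℝ V] {w : E → V} (hw : ∀ e, w e ≠ 0)
    {s : Set E} {e : E} (he : e ∈ s) :
    1 ≤ Module.finrank ℝ (Submodule.span ℝ (w '' s)) := by
  rw [Nat.one_le_iff_ne_zero, Ne, Submodule.finrank_eq_zero, Submodule.span_eq_bot]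
  intro h
  exact hw e (h _ ⟨e, he, rfl⟩)

theorem IsLevelMap.hasBigString [Fintype E] [FiniteDimensional ℝ V] {T : Type*}
    [LinearOrder T] {w : E → V} {τ : E → T} (h : IsLevelMap w τ) (hw : ∀ e, w e ≠ 0)
    {r : ℕ} (S : Finset T)
    (hS : ∀ t ∈ S, ∃ e, τ e = t) (hS2 : 2 ≤ S.card)
    (hr : (r : ℤ) - 1 ≤ ∑ t ∈ S,
      ((Module.finrank ℝ (Submodule.span ℝ (w '' {e | τ e = t})) : ℤ) - 1)) :
    HasBigString w r := by
  classical
  obtain ⟨l, b, o, hb, hob⟩ := h.exists_orderIso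
  have hSs : S ⊆ univ.image τ := fun t ht => by
    obtain ⟨e, he⟩ := hS t ht
    exact mem_image.2 ⟨e, mem_univ e, he⟩
  have hl : l = (univ.image τ : Finset T).card := by
    have := Fintype.card_congr o.toEquiv
    simpa using this
  refine ⟨l, b, hb, hl ▸ hS2.trans (card_le_card hSs), hr.trans ?_⟩
  calc _ ≤ ∑ t ∈ univ.image τ,
        ((Module.finrank ℝ (Submodule.span ℝ (w '' {e | τ e = t})) : ℤ) - 1) := by
        refine sum_le_sum_of_subset_of_nonneg hSs fun t ht _ => ?_
        obtain ⟨e, -, he⟩ := mem_image.1 ht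
        have := one_le_finrank_span_image hw (s := {e | τ e = t}) he
        omega
    _ = ∑ t : (univ.image τ : Finset T),
        ((Module.finrank ℝ (Submodule.span ℝ (w '' {e | τ e = t})) : ℤ) - 1) :=
        (sum_coe_sort _ _).symm
    _ = ∑ i : Fin l,
        ((Module.finrank ℝ (Submodule.span ℝ (w '' {e | τ e = o i})) : ℤ) - 1) :=
        (o.toEquiv.sum_comp (fun t : (univ.image τ : Finset T) =>
          ((Module.finrank ℝ (Submodule.span ℝ (w '' {e | τ e = t})) : ℤ) - 1))).symm
    _ ≤ _ := by
        refine le_of_eq (sum_congr rfl fun i _ => ?_)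
        have : {e | τ e = o i} = {e | b e = i} := by
          ext e
          simp only [Set.mem_ofPred_eq, ← hob]
          exact ⟨fun h => o.injective (Subtype.ext h), fun h => by rw [h]⟩
        rw [this]

/-- The quotient of two functionals, the denominator being positive, is a level map. -/
theorem isLevelMap_div (w : E → V) (h g : V →ₗ[ℝ] ℝ) (hg : ∀ e, 0 < g (w e)) :
    IsLevelMap w (fun e => h (w e) / g (w e)) := by
  intro e₀
  refine ⟨h - (h (w e₀) / g (w e₀)) • g, fun e => ?_⟩
  have he : (h - (h (w e₀) / g (w e₀)) • g) (w e)
      = (h (w e) / g (w e) - h (w e₀) / g (w e₀)) * g (w e) := by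
    have := (hg e).ne'
    simp only [LinearMap.sub_apply, LinearMap.smul_apply, smul_eq_mul]
    field_simp
  rw [he]
  refine ⟨fun h' => ?_, fun h' => ?_, fun h' => ?_⟩
  · simp only at h'
    rw [h', sub_self, zero_mul]
  · exact mul_neg_of_neg_of_pos (by simp only at h'; linarith) (hg e)
  · exact mul_pos (by simp only at h'; linarith) (hg e)

/-- On a finite set, a functional perturbed by a small multiple of another. -/
theorem exists_pos_forall_abs_mul_lt [Finite E] (p q : E → ℝ) :
    ∃ ε : ℝ, 0 < ε ∧ ∀ e, p e ≠ 0 → ε * |q e| < |p e| := by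
  classical
  have : ∀ e, ∃ ε : ℝ, 0 < ε ∧ (p e ≠ 0 → ∀ δ, 0 < δ → δ ≤ ε → δ * |q e| < |p e|) := by
    intro e
    by_cases hp : p e = 0
    · exact ⟨1, one_pos, fun h => absurd hp h⟩
    · have h1 : 0 < |p e| := abs_pos.2 hp
      have h2 : 0 < |q e| + 1 := by positivity
      refine ⟨|p e| / (|q e| + 1), by positivity, fun _ δ hδ hle => ?_⟩
      rw [le_div_iff₀ h2] at hle
      nlinarith
  choose ε hε h using this
  rcases isEmpty_or_nonempty E with hE | hE
  · exact ⟨1, one_pos, fun e => hE.elim e⟩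
  · have := Fintype.ofFinite E
    refine ⟨univ.inf' univ_nonempty ε, ?_, fun e hp => h e hp _ ?_ (inf'_le _ (mem_univ e))⟩
    · rw [lt_inf'_iff]; exact fun e _ => hε e
    · rw [lt_inf'_iff]; exact fun e _ => hε e

end Strings

section Forward

variable {E : Type*} {V : Type*} [AddCommGroup V] [Module ℝ V]

/-- For every nonzero `x` in the span of `s` there is a sign pattern on `s`, realised by a
functional, which forces positivity at `x`. -/
theorem exists_functional_sign_forces_pos (s : Set V) {x : V} (hx : x ∈ Submodule.span ℝ s)
    (hx0 : x ≠ 0) :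
    ∃ g : V →ₗ[ℝ] ℝ, ∀ ψ : V →ₗ[ℝ] ℝ,
      (∀ u ∈ s, (g u = 0 → ψ u = 0) ∧ (0 < g u → 0 < ψ u) ∧ (g u < 0 → ψ u < 0)) → 0 < ψ x := by
  classical
  obtain ⟨t, hts, hspan, hli⟩ := exists_linearIndependent ℝ s
  rw [← hspan, Submodule.mem_span_set] at hx
  obtain ⟨c, hc, rfl⟩ := hx
  obtain ⟨u₀, hu₀⟩ : c.support.Nonempty := by
    rw [nonempty_iff_ne_empty]
    intro h
    rw [Finsupp.support_eq_empty] at h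
    simp [h] at hx0
  have hli' : LinearIndepOn ℝ id t := hli
  let B := Module.Basis.extend hli'
  have ht : t ⊆ hli'.extend (Set.subset_univ t) := hli'.subset_extend _
  have hB : ∀ u (hu : u ∈ t), B ⟨u, ht hu⟩ = u := fun u hu => by simp [B]
  have hcoord : ∀ u (hu : u ∈ t), B.coord ⟨u₀, ht (hc hu₀)⟩ u = if u = u₀ then 1 else 0 := by
    intro u hu
    conv_lhs => rw [← hB u hu]
    rw [Module.Basis.coord_apply, B.repr_self_apply]
    simp [Subtype.ext_iff]
  refine ⟨c u₀ • B.coord ⟨u₀, ht (hc hu₀)⟩, fun ψ hψ => ?_⟩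
  have hc0 : c u₀ ≠ 0 := Finsupp.mem_support_iff.1 hu₀
  rw [Finsupp.sum, map_sum, sum_eq_single_of_mem u₀ hu₀]
  · have := hψ u₀ (hts (hc hu₀))
    rw [LinearMap.smul_apply, hcoord u₀ (hc hu₀)] at this
    simp only [if_true, smul_eq_mul, mul_one] at this
    rw [map_smul, smul_eq_mul]
    rcases lt_or_gt_of_ne hc0 with h | h
    · exact mul_pos_of_neg_of_neg h (this.2.2 h)
    · exact mul_pos h (this.2.1 h)
  · intro u hu hne
    have := hψ u (hts (hc hu))
    rw [LinearMap.smul_apply, hcoord u (hc hu)] at this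
    rw [map_smul, this.1 (by simp [hne]), smul_zero]

/-- Refine a cellular string by a functional inside each block. -/
theorem IsCellularString.isLevelMap_toLex [Fintype E] {w : E → V} {π : V →ₗ[ℝ] ℝ}
    (hπ : ∀ e, π (w e) = 1)
    {l : ℕ} {b : E → Fin l} (hb : IsCellularString w l b) (g : Fin l → V →ₗ[ℝ] ℝ) :
    IsLevelMap w (fun e => toLex (b e, g (b e) (w e))) := by
  intro e₀
  obtain ⟨φ, hφ⟩ := hb.2 (b e₀)
  set f := g (b e₀)
  obtain ⟨ε, hε, h⟩ := exists_pos_forall_abs_mul_lt (fun e => φ (w e))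
    (fun e => f (w e) - f (w e₀))
  refine ⟨φ + ε • (f - f (w e₀) • π), fun e => ?_⟩
  have he : (φ + ε • (f - f (w e₀) • π)) (w e) = φ (w e) + ε * (f (w e) - f (w e₀)) := by
    simp [hπ]
  rw [he]
  simp only [Prod.Lex.toLex_lt_toLex, EmbeddingLike.apply_eq_iff_eq, Prod.mk.injEq]
  have hneg : b e < b e₀ → φ (w e) + ε * (f (w e) - f (w e₀)) < 0 := fun hlt => by
    have h1 := (hφ e).2.1 hlt
    have h2 := h e h1.ne
    rw [abs_of_neg h1] at h2
    nlinarith [le_abs_self (f (w e) - f (w e₀))]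
  have hpos : b e₀ < b e → 0 < φ (w e) + ε * (f (w e) - f (w e₀)) := fun hlt => by
    have h1 := (hφ e).2.2 hlt
    have h2 := h e h1.ne'
    rw [abs_of_pos h1] at h2
    nlinarith [neg_abs_le (f (w e) - f (w e₀))]
  refine ⟨fun ⟨h1, h2⟩ => ?_, fun h => ?_, fun h => ?_⟩
  · rw [(hφ e).1 h1]
    rw [h1] at h2
    change f (w e) = f (w e₀) at h2
    simp [h2]
  · rcases h with h | ⟨h1, h2⟩
    · exact hneg h
    · rw [(hφ e).1 h1]
      rw [h1] at h2
      change f (w e) < f (w e₀) at h2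
      nlinarith
  · rcases h with h | ⟨h1, h2⟩
    · exact hpos h
    · rw [(hφ e).1 h1.symm]
      rw [← h1] at h2
      change f (w e₀) < f (w e) at h2
      nlinarith

theorem AllCoherent.not_hasBigString [Fintype E] [FiniteDimensional ℝ V] {w : E → V}
    {π : V →ₗ[ℝ] ℝ} (hπ : ∀ e, π (w e) = 1) (hall : AllCoherent w π) :
    ¬ HasBigString w (Module.finrank ℝ (Submodule.span ℝ (Set.range w))) := by
  rintro ⟨l, b, hb, hl, hsum⟩
  obtain ⟨ψ, hψ⟩ := hall l b hb
  simp only [hπ, div_one] at hψ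
  set W := Submodule.span ℝ (Set.range w)
  have hwW : ∀ e, w e ∈ W := fun e => Submodule.subset_span ⟨e, rfl⟩
  let D : Fin l → Set V := fun i => {u | ∃ e e', b e = i ∧ b e' = i ∧ u = w e - w e'}
  let L : Fin l → Submodule ℝ V := fun i => Submodule.span ℝ (D i)
  let K := W ⊓ LinearMap.ker π ⊓ LinearMap.ker ψ
  have hLK : ∀ i, L i ≤ K := fun i => by
    refine Submodule.span_le.2 ?_
    rintro _ ⟨e, e', he, he', rfl⟩
    refine ⟨⟨W.sub_mem (hwW e) (hwW e'), ?_⟩, ?_⟩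
    · simp [hπ]
    · simpa [sub_eq_zero] using (hψ e e').1 (he.trans he'.symm)
  have hrank : ∀ i, Module.finrank ℝ (Submodule.span ℝ (w '' {e | b e = i}))
      ≤ Module.finrank ℝ (L i) + 1 := fun i => by
    obtain ⟨e₀, he₀⟩ := hb.1 i
    have : Submodule.span ℝ (w '' {e | b e = i}) ≤ L i ⊔ Submodule.span ℝ {w e₀} := by
      refine Submodule.span_le.2 ?_
      rintro _ ⟨e, he, rfl⟩
      rw [SetLike.mem_coe, ← sub_add_cancel (w e) (w e₀)]
      exact Submodule.add_mem_sup (Submodule.subset_span ⟨e, e₀, he, he₀, rfl⟩)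
        (Submodule.mem_span_singleton_self _)
    refine (Submodule.finrank_mono this).trans
      ((Submodule.finrank_add_le_finrank_add_finrank _ _).trans ?_)
    gcongr
    rw [← coe_singleton]
    exact finrank_span_finset_le_card (R := ℝ) ({w e₀} : Finset V)
  have hK : Module.finrank ℝ K + 2 ≤ Module.finrank ℝ W := by
    obtain ⟨e, he⟩ := hb.1 ⟨0, by omega⟩
    obtain ⟨e', he'⟩ := hb.1 ⟨1, by omega⟩
    have h1 : W ⊓ LinearMap.ker π < W := by
      refine lt_of_le_of_ne inf_le_left fun h => ?_
      have h2 : w e ∈ W ⊓ LinearMap.ker π := by rw [h]; exact hwW e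
      have h3 : π (w e) = 0 := h2.2
      simp [hπ] at h3
    have h2 : K < W ⊓ LinearMap.ker π := by
      refine lt_of_le_of_ne inf_le_left fun h => ?_
      have h3 : w e' - w e ∈ W ⊓ LinearMap.ker π :=
        ⟨W.sub_mem (hwW e') (hwW e), by simp [hπ]⟩
      have h4 : ψ (w e' - w e) = 0 := (show w e' - w e ∈ K by rw [h]; exact h3).2
      have h5 := (hψ e e').2 (by rw [he, he']; simp [Fin.lt_def])
      rw [map_sub] at h4
      linarith
    have := Submodule.finrank_lt_finrank_of_lt h1
    have := Submodule.finrank_lt_finrank_of_lt h2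
    omega
  let F : (∀ i, L i) →ₗ[ℝ] K :=
    LinearMap.lsum ℝ (fun i => L i) ℝ (fun i => Submodule.inclusion (hLK i))
  have hlt : Module.finrank ℝ K < Module.finrank ℝ (∀ i, L i) := by
    rw [Module.finrank_pi_fintype]
    have : ∑ i : Fin l, ((Module.finrank ℝ (Submodule.span ℝ (w '' {e | b e = i})) : ℤ) - 1)
        ≤ ∑ i, (Module.finrank ℝ (L i) : ℤ) :=
      sum_le_sum fun i _ => by have := hrank i; omega
    have h3 := hsum.trans this
    rw [← Nat.cast_sum] at h3
    omega
  obtain ⟨x, hxF, hx0⟩ := (Submodule.ne_bot_iff _).1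
    (LinearMap.ker_ne_bot_of_finrank_lt hlt (f := F))
  have hxsum : ∑ i, (x i : V) = 0 := by
    have := congrArg Subtype.val (LinearMap.mem_ker.1 hxF)
    simpa [F, LinearMap.lsum_apply] using this
  have : ∀ i, ∃ g : V →ₗ[ℝ] ℝ, (x i : V) ≠ 0 → ∀ ψ : V →ₗ[ℝ] ℝ,
      (∀ u ∈ D i, (g u = 0 → ψ u = 0) ∧ (0 < g u → 0 < ψ u) ∧ (g u < 0 → ψ u < 0)) →
        0 < ψ (x i) := fun i => by
    by_cases h : (x i : V) = 0
    · exact ⟨0, fun h' => absurd h h'⟩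
    · obtain ⟨g, hg⟩ := exists_functional_sign_forces_pos (D i) (x i).2 h
      exact ⟨g, fun _ => hg⟩
  choose g hg using this
  obtain ⟨l', b', o, hb', hob⟩ := (hb.isLevelMap_toLex hπ g).exists_orderIso
  obtain ⟨ψ', hψ'⟩ := hall l' b' hb'
  simp only [hπ, div_one] at hψ'
  have hlt' : ∀ e e', b e = b e' → g (b e) (w e) < g (b e) (w e') → ψ' (w e) < ψ' (w e') := by
    intro e e' h1 h2
    refine (hψ' e e').2 (o.lt_iff_lt.1 ?_)
    rw [← Subtype.coe_lt_coe, hob, hob, Prod.Lex.toLex_lt_toLex]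
    exact Or.inr ⟨h1, h1 ▸ h2⟩
  have hpos : ∀ i, (x i : V) ≠ 0 → 0 < ψ' (x i) := fun i hi => by
    refine hg i hi ψ' ?_
    rintro _ ⟨e, e', rfl, he', rfl⟩
    simp only [map_sub, sub_eq_zero, sub_pos, sub_neg]
    refine ⟨fun h => (hψ' e e').1 (o.injective (Subtype.ext ?_)), fun h => hlt' e' e he' ?_,
      hlt' e e' he'.symm⟩
    · rw [hob, hob, he', h]
    · rw [he']; exact h
  have hex : ∃ i, (x i : V) ≠ 0 := by
    by_contra! h
    exact hx0 (funext fun i => Subtype.ext (h i))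
  obtain ⟨i₀, hi₀⟩ := hex
  have h0 : ∑ i, ψ' (x i : V) = 0 := by rw [← map_sum, hxsum, map_zero]
  have : 0 < ∑ i, ψ' (x i : V) := by
    refine sum_pos' (fun i _ => ?_) ⟨i₀, mem_univ _, hpos i₀ hi₀⟩
    by_cases h : (x i : V) = 0
    · rw [h, map_zero]
    · exact (hpos i h).le
  linarith

end Forward

section Simplex

variable {E : Type*} {V : Type*}

/-- Moving from a nonnegative vector in a direction with a negative entry, some entry vanishes
just before the vector stops being nonnegative. -/
theorem exists_add_mul_nonneg_and_eq_zero [Finite E] (p q : E → ℝ) (hp : ∀ e, 0 ≤ p e)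
    (hpq : ∀ e, p e = 0 → 0 ≤ q e) (hq : ∃ e, q e < 0) :
    ∃ t : ℝ, 0 < t ∧ (∀ e, 0 ≤ p e + t * q e) ∧ ∃ e, 0 < p e ∧ q e < 0 ∧ p e + t * q e = 0 := by
  classical
  have := Fintype.ofFinite E
  obtain ⟨e₁, he₁⟩ := hq
  have hne : (univ.filter fun e => q e < 0).Nonempty := ⟨e₁, by simp [he₁]⟩
  obtain ⟨e₀, he₀, hmin⟩ := exists_min_image _ (fun e => p e / (-q e)) hne
  simp only [mem_filter, mem_univ, true_and] at he₀ hmin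
  have hpos : 0 < p e₀ := lt_of_le_of_ne (hp e₀) fun h => by have := hpq e₀ h.symm; linarith
  have ht : 0 < p e₀ / (-q e₀) := div_pos hpos (by linarith)
  refine ⟨p e₀ / (-q e₀), ht, fun e => ?_, e₀, hpos, he₀, ?_⟩
  · rcases lt_or_ge (q e) 0 with h | h
    · have h1 := hmin e h
      rw [le_div_iff₀ (by linarith)] at h1
      linarith
    · have := mul_nonneg ht.le h
      linarith [hp e]
  · have := he₀.ne
    field_simp
    ring

section Facet

variable [AddCommGroup V] [Module ℝ V]

/-- Every vector of the configuration is off some facet. -/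
theorem exists_facet_functional [Fintype E] {w : E → V} {π : V →ₗ[ℝ] ℝ} (hπ : ∀ e, π (w e) = 1)
    (a : E) :
    ∃ h : V →ₗ[ℝ] ℝ, (∀ e, 0 ≤ h (w e)) ∧ 0 < h (w a) ∧
      ∀ e, w e ∈ Submodule.span ℝ (w '' {e | h (w e) = 0}) ⊔ Submodule.span ℝ {w a} := by
  classical
  let P : Finset E → Prop := fun Z => ∃ h : V →ₗ[ℝ] ℝ, (∀ e, 0 ≤ h (w e)) ∧ 0 < h (w a) ∧
    Z = univ.filter fun e => h (w e) = 0
  have hne : (univ.filter P).Nonempty := by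
    refine ⟨univ.filter fun e => π (w e) = 0, ?_⟩
    simp only [mem_filter, mem_univ, true_and]
    exact ⟨π, fun e => by simp [hπ], by simp [hπ], rfl⟩
  obtain ⟨Z, hZ, hmax⟩ := exists_max_image _ card hne
  simp only [mem_filter, mem_univ, true_and] at hZ hmax
  obtain ⟨h, h0, ha, rfl⟩ := hZ
  refine ⟨h, h0, ha, ?_⟩
  by_contra! hcon
  obtain ⟨e₁, he₁⟩ := hcon
  obtain ⟨η, hη1, hη2⟩ : ∃ η : V →ₗ[ℝ] ℝ, η (w e₁) < 0 ∧
      Submodule.span ℝ (w '' {e | h (w e) = 0}) ⊔ Submodule.span ℝ {w a} ≤ LinearMap.ker η := by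
    obtain ⟨η, hη1, hη2⟩ := Submodule.exists_le_ker_of_notMem he₁
    rcases lt_or_gt_of_ne hη1 with h | h
    · exact ⟨η, h, hη2⟩
    · exact ⟨-η, by simpa using h, fun x hx => by simpa using hη2 hx⟩
  have hηz : ∀ e, h (w e) = 0 → η (w e) = 0 := fun e he =>
    hη2 (Submodule.mem_sup_left (Submodule.subset_span ⟨e, he, rfl⟩))
  have hηa : η (w a) = 0 := hη2 (Submodule.mem_sup_right (Submodule.mem_span_singleton_self _))
  obtain ⟨t, ht, hnn, e₂, he₂, -, hz⟩ := exists_add_mul_nonneg_and_eq_zero (fun e => h (w e))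
    (fun e => η (w e)) h0 (fun e he => (hηz e he).ge) ⟨e₁, hη1⟩
  have := hmax (univ.filter fun e => (h + t • η) (w e) = 0)
    ⟨h + t • η, hnn, by simpa [hηa] using ha, rfl⟩
  refine this.not_gt (card_lt_card (ssubset_iff_of_subset ?_ |>.2 ⟨e₂, ?_, ?_⟩))
  · intro e he
    simp only [mem_filter, mem_univ, true_and] at he ⊢
    simp [he, hηz e he]
  · simpa using hz
  · simpa using he₂.ne'

/-- Two distinct points of the configuration span a plane. -/
theorem two_le_finrank_span_image [FiniteDimensional ℝ V] {w : E → V} {π : V →ₗ[ℝ] ℝ}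
    (hπ : ∀ e, π (w e) = 1) (hw : Function.Injective w) {s : Set E} {e f : E} (he : e ∈ s)
    (hf : f ∈ s) (hef : e ≠ f) : 2 ≤ Module.finrank ℝ (Submodule.span ℝ (w '' s)) := by
  have hlt : Submodule.span ℝ {w e} < Submodule.span ℝ (w '' s) := by
    refine lt_of_le_of_ne (Submodule.span_mono (by simpa using ⟨e, he, rfl⟩)) fun h => ?_
    have : w f ∈ Submodule.span ℝ {w e} := h ▸ Submodule.subset_span ⟨f, hf, rfl⟩
    obtain ⟨c, hc⟩ := Submodule.mem_span_singleton.1 this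
    have h1 := congrArg π hc
    rw [map_smul, hπ, hπ, smul_eq_mul, mul_one] at h1
    rw [h1, one_smul] at hc
    exact hef (hw hc)
  have h1 := Submodule.finrank_lt_finrank_of_lt hlt
  rw [finrank_span_singleton fun h => by simpa [h] using hπ e] at h1
  exact h1

theorem unique_max_of_not_hasBigString [Fintype E] [FiniteDimensional ℝ V] {w : E → V}
    {π : V →ₗ[ℝ] ℝ}
    (hπ : ∀ e, π (w e) = 1) (hw : Function.Injective w)
    (hbig : ¬ HasBigString w (Module.finrank ℝ (Submodule.span ℝ (Set.range w))))
    {a : E} {h : V →ₗ[ℝ] ℝ} (ha : 0 < h (w a))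
    (hspan : ∀ e, w e ∈ Submodule.span ℝ (w '' {e | h (w e) = 0}) ⊔ Submodule.span ℝ {w a})
    {g : V →ₗ[ℝ] ℝ} (hg : ∀ e, 0 < g (w e)) {e₁ e₂ : E}
    (h₁ : ∀ e, h (w e) / g (w e) ≤ h (w e₁) / g (w e₁))
    (h₂ : ∀ e, h (w e) / g (w e) ≤ h (w e₂) / g (w e₂)) : e₁ = e₂ := by
  classical
  have hw0 : ∀ e, w e ≠ 0 := fun e h => by simpa [h] using hπ e
  by_contra hne
  have hpos : 0 < h (w e₁) / g (w e₁) := (div_pos ha (hg a)).trans_le (h₁ a)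
  have hle : Module.finrank ℝ (Submodule.span ℝ (Set.range w))
      ≤ Module.finrank ℝ (Submodule.span ℝ (w '' {e | h (w e) = 0})) + 1 := by
    have : Submodule.span ℝ (Set.range w)
        ≤ Submodule.span ℝ (w '' {e | h (w e) = 0}) ⊔ Submodule.span ℝ {w a} := by
      rw [Submodule.span_le]
      rintro _ ⟨e, rfl⟩
      exact hspan e
    refine (Submodule.finrank_mono this).trans
      ((Submodule.finrank_add_le_finrank_add_finrank _ _).trans ?_)
    rw [finrank_span_singleton (hw0 a)]
  have h2 := two_le_finrank_span_image hπ hw (s := {e | h (w e) / g (w e) = h (w e₁) / g (w e₁)})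
    (e := e₁) (f := e₂) rfl ((h₁ e₂).antisymm (h₂ e₁)) hne
  have hZ : ∃ e, h (w e) = 0 := by
    by_contra! hcon
    have : {e | h (w e) = 0} = (∅ : Set E) := Set.eq_empty_of_forall_notMem hcon
    rw [this, Set.image_empty, Submodule.span_empty, finrank_bot] at hle
    have h3 := Submodule.finrank_mono (Submodule.span_mono (R := ℝ) (Set.image_subset_range w
      {e | h (w e) / g (w e) = h (w e₁) / g (w e₁)}))
    omega
  have hset : {e | h (w e) / g (w e) = 0} = {e | h (w e) = 0} := by
    ext e
    simp [(hg e).ne']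
  refine hbig ((isLevelMap_div w h g hg).hasBigString hw0 {0, h (w e₁) / g (w e₁)} ?_ ?_ ?_)
  · simp only [mem_insert, mem_singleton, forall_eq_or_imp, forall_eq]
    obtain ⟨e, he⟩ := hZ
    exact ⟨⟨e, by simp [he]⟩, e₁, rfl⟩
  · rw [card_pair hpos.ne]
  · rw [sum_pair hpos.ne, hset]
    omega

end Facet

/-- The vectors indexed by `A` are the vertices of a simplex containing the configuration, with
barycentric coordinate functionals `ξ`. -/
structure IsSimplexFrame [AddCommGroup V] [Module ℝ V] (w : E → V) (A : Finset E)
    (ξ : E → V →ₗ[ℝ] ℝ) : Prop where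
  self : ∀ a ∈ A, ξ a (w a) = 1
  ne : ∀ a ∈ A, ∀ a' ∈ A, a' ≠ a → ξ a (w a') = 0
  nonneg : ∀ a ∈ A, ∀ e, 0 ≤ ξ a (w e)
  repr : ∀ e, w e = ∑ a ∈ A, ξ a (w e) • w a

section Normed

variable [NormedAddCommGroup V] [NormedSpace ℝ V] [FiniteDimensional ℝ V]

theorem exists_pyramid_functional [Fintype E] {w : E → V} {π : V →ₗ[ℝ] ℝ}
    (hπ : ∀ e, π (w e) = 1) (hw : Function.Injective w)
    (hbig : ¬ HasBigString w (Module.finrank ℝ (Submodule.span ℝ (Set.range w)))) (a : E) :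
    ∃ (h : V →ₗ[ℝ] ℝ) (e₁ : E), (∀ e, 0 ≤ h (w e)) ∧ 0 < h (w a) ∧
      ∀ e, e ≠ e₁ → h (w e) < h (w e₁) ∧
        (h (w e₁) - h (w e))⁻¹ • (h (w e₁) • w e - h (w e) • w e₁)
          ∈ convexHull ℝ (Set.range w) := by
  obtain ⟨h, h0, ha, hspan⟩ := exists_facet_functional hπ a
  have huniq := fun g hg e₁ e₂ => unique_max_of_not_hasBigString hπ hw hbig ha hspan (g := g) hg
    (e₁ := e₁) (e₂ := e₂)
  obtain ⟨e₁, -, he₁⟩ := exists_max_image univ (fun e => h (w e)) ⟨a, mem_univ a⟩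
  have hpos : 0 < h (w e₁) := ha.trans_le (he₁ a (mem_univ a))
  have hlt : ∀ e, e ≠ e₁ → h (w e) < h (w e₁) := fun e he => by
    refine lt_of_le_of_ne (he₁ e (mem_univ e)) fun heq => he ?_
    refine huniq π (by simp [hπ]) e e₁ (fun e' => ?_) fun e' => ?_
    · simpa [hπ, heq] using he₁ e' (mem_univ e')
    · simpa [hπ] using he₁ e' (mem_univ e')
  refine ⟨h, e₁, h0, ha, fun e he => ⟨hlt e he, ?_⟩⟩
  have hcross : ∀ g : V →ₗ[ℝ] ℝ, (∀ e, 0 < g (w e)) →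
      ∀ e, 0 ≤ h (w e₁) * g (w e) - h (w e) * g (w e₁) := by
    intro g hg
    by_contra! hcon
    obtain ⟨t, ht, hnn, e₂, he₂, -, hz⟩ := exists_add_mul_nonneg_and_eq_zero
      (fun e => h (w e₁) - h (w e)) (fun e => h (w e₁) * g (w e) - h (w e) * g (w e₁))
      (fun e => sub_nonneg.2 (he₁ e (mem_univ e))) (fun e he => by
        by_cases hee : e = e₁
        · simp [hee]
        · have := hlt e hee
          linarith) hcon
    have hgt : ∀ e, 0 < (π + t • g) (w e) := fun e => by
      have := mul_pos ht (hg e)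
      simp only [LinearMap.add_apply, LinearMap.smul_apply, smul_eq_mul, hπ]
      linarith
    have : e₁ = e₂ := huniq (π + t • g) hgt e₁ e₂ (fun e => by
      rw [div_le_div_iff₀ (hgt e) (hgt e₁)]
      simp only [LinearMap.add_apply, LinearMap.smul_apply, smul_eq_mul, hπ]
      linarith [hnn e]) (fun e => by
      rw [div_le_div_iff₀ (hgt e) (hgt e₂)]
      simp only [LinearMap.add_apply, LinearMap.smul_apply, smul_eq_mul, hπ]
      have h3 := hnn e
      have h4 : h (w e₁) * (1 + t * g (w e₂)) = h (w e₂) * (1 + t * g (w e₁)) := by linarith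
      have h5 : h (w e) * (1 + t * g (w e₁)) ≤ h (w e₁) * (1 + t * g (w e)) := by linarith
      have h6 := hgt e₁
      have h7 := hgt e₂
      simp only [LinearMap.add_apply, LinearMap.smul_apply, smul_eq_mul, hπ] at h6 h7
      refine le_of_mul_le_mul_left ?_ h6
      calc _ = (h (w e) * (1 + t * g (w e₁))) * (1 + t * g (w e₂)) := by ring
        _ ≤ (h (w e₁) * (1 + t * g (w e))) * (1 + t * g (w e₂)) := by gcongr
        _ = (h (w e₁) * (1 + t * g (w e₂))) * (1 + t * g (w e)) := by ring
        _ = _ := by rw [h4]; ring)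
    rw [this] at he₂
    simp at he₂
  by_contra hq
  obtain ⟨f, u, hf1, hf2⟩ := geometric_hahn_banach_point_closed (convex_convexHull ℝ (Set.range w))
    ((Set.finite_range w).isCompact_convexHull ℝ).isClosed hq
  have h1 := hcross (f.toLinearMap - u • π) (fun e => by
    have := hf2 (w e) (subset_convexHull ℝ _ ⟨e, rfl⟩)
    simpa [hπ] using this) e
  have h2 : 0 < h (w e₁) - h (w e) := sub_pos.2 (hlt e he)
  simp only [map_smul, map_sub, smul_eq_mul] at hf1
  rw [inv_mul_lt_iff₀ h2] at hf1
  simp only [LinearMap.sub_apply, LinearMap.smul_apply, smul_eq_mul, hπ,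
    ContinuousLinearMap.coe_coe] at h1
  nlinarith

theorem exists_isSimplexFrame [Fintype E] {w : E → V} {π : V →ₗ[ℝ] ℝ}
    (hπ : ∀ e, π (w e) = 1) (hw : Function.Injective w)
    (hbig : ¬ HasBigString w (Module.finrank ℝ (Submodule.span ℝ (Set.range w)))) :
    ∃ (A : Finset E) (ξ : E → V →ₗ[ℝ] ℝ), IsSimplexFrame w A ξ := by
  classical
  choose h e₁ h0 ha hlt using exists_pyramid_functional hπ hw hbig
  set H := convexHull ℝ (Set.range w)
  have hwH : ∀ e, w e ∈ H := fun e => subset_convexHull ℝ _ ⟨e, rfl⟩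
  let A : Finset E := univ.filter fun a => w a ∈ H.extremePoints ℝ
  have hA : ∀ a, a ∈ A ↔ w a ∈ H.extremePoints ℝ := fun a => by simp [A]
  have hapex : ∀ b, ∀ a ∈ A, a ≠ e₁ b → h b (w a) = 0 := by
    intro b a haA hne
    by_contra hcon
    obtain ⟨h1, h2⟩ := hlt b a hne
    have h3 : 0 < h b (w a) := lt_of_le_of_ne (h0 b a) (Ne.symm hcon)
    have h4 : 0 < h b (w (e₁ b)) := h3.trans h1
    have := ((mem_extremePoints.1 ((hA a).1 haA)).2 _ h2 _ (hwH (e₁ b))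
      ⟨(h b (w (e₁ b)) - h b (w a)) / h b (w (e₁ b)), h b (w a) / h b (w (e₁ b)),
        div_pos (sub_pos.2 h1) h4, div_pos h3 h4, by field_simp; ring, by
          have h5 : h b (w (e₁ b)) - h b (w a) ≠ 0 := (sub_pos.2 h1).ne'
          rw [smul_smul, smul_sub, smul_smul, smul_smul, sub_add, ← sub_smul]
          have h6 : (h b (w (e₁ b)) - h b (w a)) / h b (w (e₁ b)) *
            (h b (w (e₁ b)) - h b (w a))⁻¹ * h b (w (e₁ b)) = 1 := by field_simp
          have h7 : (h b (w (e₁ b)) - h b (w a)) / h b (w (e₁ b)) *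
            (h b (w (e₁ b)) - h b (w a))⁻¹ * h b (w a) - h b (w a) / h b (w (e₁ b)) = 0 := by
              field_simp; ring
          rw [h6, h7, one_smul, zero_smul, sub_zero]⟩).2
    exact hne (hw this).symm
  have hself : ∀ a ∈ A, a = e₁ a := fun a haA => by
    by_contra hne
    exact (ha a).ne' (hapex a a haA hne)
  have hne : ∀ a ∈ A, ∀ a' ∈ A, a' ≠ a → h a (w a') = 0 := fun a haA a' ha'A hn =>
    hapex a a' ha'A (by rwa [← hself a haA])
  have hhull : ∀ e, w e ∈ convexHull ℝ ((A.image w : Finset V) : Set V) := by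
    intro e
    have h1 := closure_convexHull_extremePoints
      ((Set.finite_range w).isCompact_convexHull ℝ) (convex_convexHull ℝ (Set.range w))
    have h2 : H.extremePoints ℝ = ((A.image w : Finset V) : Set V) := by
      ext x
      simp only [coe_image, Set.mem_image, mem_coe, hA]
      constructor
      · intro hx
        obtain ⟨e, rfl⟩ := extremePoints_convexHull_subset hx
        exact ⟨e, hx, rfl⟩
      · rintro ⟨e, he, rfl⟩
        exact he
    rw [h2, ((A.image w).finite_toSet.isCompact_convexHull ℝ).isClosed.closure_eq] at h1
    rw [h1]
    exact hwH e
  have hrepr : ∀ e, ∃ c : E → ℝ, w e = ∑ a ∈ A, c a • w a := fun e => by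
    obtain ⟨c, -, -, hc⟩ := Finset.mem_convexHull'.1 (hhull e)
    rw [sum_image fun _ _ _ _ h => hw h] at hc
    exact ⟨fun a => c (w a), hc.symm⟩
  refine ⟨A, fun a => (h a (w a))⁻¹ • h a, ⟨fun a _ => ?_, fun a ha' a' ha'' hn => ?_,
    fun a _ e => ?_, fun e => ?_⟩⟩
  · simp [(ha a).ne']
  · simp [hne a ha' a' ha'' hn]
  · simpa using mul_nonneg (inv_nonneg.2 (h0 a a)) (h0 a e)
  · obtain ⟨c, hc⟩ := hrepr e
    conv_lhs => rw [hc]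
    refine sum_congr rfl fun a haA => ?_
    congr 1
    rw [hc, map_sum, sum_eq_single_of_mem a haA]
    · simp only [LinearMap.smul_apply, map_smul, smul_eq_mul]
      have := (ha a).ne'
      field_simp
    · intro a' ha' hn
      simp [hne a haA a' ha' hn]

end Normed

end Simplex

namespace IsSimplexFrame

variable {E : Type*} {V : Type*} [AddCommGroup V] [Module ℝ V] {w : E → V} {A : Finset E}
  {ξ : E → V →ₗ[ℝ] ℝ} {π : V →ₗ[ℝ] ℝ}

theorem sum_eq_one (hF : IsSimplexFrame w A ξ) (hπ : ∀ e, π (w e) = 1) (e : E) :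
    ∑ a ∈ A, ξ a (w e) = 1 := by
  have := congrArg π (hF.repr e)
  simpa [hπ] using this.symm

theorem apply_eq_sum (hF : IsSimplexFrame w A ξ) (φ : V →ₗ[ℝ] ℝ) (e : E) :
    φ (w e) = ∑ a ∈ A, ξ a (w e) * φ (w a) := by
  have := congrArg φ (hF.repr e)
  simpa using this

theorem eq_of_forall (hF : IsSimplexFrame w A ξ) {e f : E}
    (h : ∀ a ∈ A, ξ a (w e) = ξ a (w f)) : w e = w f := by
  rw [hF.repr e, hF.repr f]
  exact sum_congr rfl fun a ha => by rw [h a ha]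

theorem card_le_finrank_span [FiniteDimensional ℝ V] (hF : IsSimplexFrame w A ξ) {s : Finset E}
    (hs : s ⊆ A) {t : Set E} (hst : ↑s ⊆ t) :
    s.card ≤ Module.finrank ℝ (Submodule.span ℝ (w '' t)) := by
  have hli : LinearIndependent ℝ fun a : s => w a := by
    rw [Fintype.linearIndependent_iff]
    intro g hg a
    have := congrArg (ξ a) hg
    rw [map_sum, sum_eq_single_of_mem a (mem_univ a)] at this
    · simpa [hF.self a (hs a.2)] using this
    · intro a' _ hn
      rw [map_smul, hF.ne a (hs a.2) a' (hs a'.2) (fun h => hn (Subtype.ext h)), smul_zero]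
  have h1 := finrank_span_eq_card hli
  rw [Fintype.card_coe] at h1
  rw [← h1]
  refine Submodule.finrank_mono (Submodule.span_mono ?_)
  rintro _ ⟨a, rfl⟩
  exact ⟨a, hst a.2, rfl⟩

theorem finrank_le_card (hF : IsSimplexFrame w A ξ) :
    Module.finrank ℝ (Submodule.span ℝ (Set.range w)) ≤ A.card := by
  classical
  have : Submodule.span ℝ (Set.range w) = Submodule.span ℝ ((A.image w : Finset V) : Set V) := by
    refine le_antisymm (Submodule.span_le.2 ?_) (Submodule.span_mono (by simp))
    rintro _ ⟨e, rfl⟩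
    rw [SetLike.mem_coe, hF.repr e]
    refine Submodule.sum_mem _ fun a ha => Submodule.smul_mem _ _ (Submodule.subset_span ?_)
    exact mem_coe.2 (mem_image_of_mem w ha)
  rw [this]
  exact (finrank_span_finset_le_card _).trans card_image_le

/-- Without big strings, the line through two non-vertices contains a vertex, in the projective
sense. -/
theorem exists_mem_span_pair [Fintype E] [FiniteDimensional ℝ V] (hF : IsSimplexFrame w A ξ)
    (hπ : ∀ e, π (w e) = 1) (hw : Function.Injective w)
    (hbig : ¬ HasBigString w (Module.finrank ℝ (Submodule.span ℝ (Set.range w))))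
    {e f : E} (hef : e ≠ f) : ∃ c ∈ A, w c ∈ Submodule.span ℝ {w e, w f} := by
  classical
  by_contra! hcon
  have hw0 : ∀ e, w e ≠ 0 := fun e h => by simpa [h] using hπ e
  obtain ⟨φ₀, hφ₀⟩ := Module.exists_dual_forall_apply_ne_zero (K := ℝ)
    (fun a : A => (Submodule.span ℝ {w e, w f}).mkQ (w a)) fun a => by
      rw [Submodule.mkQ_apply, Ne, Submodule.Quotient.mk_eq_zero]
      exact hcon a a.2
  let φ : V →ₗ[ℝ] ℝ := φ₀ ∘ₗ (Submodule.span ℝ {w e, w f}).mkQ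
  have hφA : ∀ a ∈ A, φ (w a) ≠ 0 := fun a ha => hφ₀ ⟨a, ha⟩
  have hφs : ∀ x ∈ Submodule.span ℝ {w e, w f}, φ x = 0 := fun x hx => by
    have : (Submodule.span ℝ {w e, w f}).mkQ x = 0 := by
      rwa [Submodule.mkQ_apply, Submodule.Quotient.mk_eq_zero]
    simp only [φ, LinearMap.comp_apply, this, map_zero]
  have hφe : φ (w e) = 0 := hφs _ (Submodule.subset_span (by simp))
  have hφf : φ (w f) = 0 := hφs _ (Submodule.subset_span (by simp))
  let g : V →ₗ[ℝ] ℝ := ∑ a ∈ A, |φ (w a)| • ξ a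
  have hgval : ∀ e, g (w e) = ∑ a ∈ A, ξ a (w e) * |φ (w a)| := fun e => by
    simp [g, mul_comm]
  have hex : ∀ e, ∃ a ∈ A, 0 < ξ a (w e) := fun e => by
    refine exists_lt_of_sum_lt (f := fun _ => (0 : ℝ)) ?_
    rw [hF.sum_eq_one hπ]
    simp
  have hg : ∀ e, 0 < g (w e) := fun e => by
    rw [hgval]
    obtain ⟨a, ha, hpos⟩ := hex e
    exact sum_pos' (fun a ha => mul_nonneg (hF.nonneg a ha e) (abs_nonneg _))
      ⟨a, ha, mul_pos hpos (abs_pos.2 (hφA a ha))⟩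
  have hgA : ∀ a ∈ A, g (w a) = |φ (w a)| := fun a ha => by
    rw [hgval, sum_eq_single_of_mem a ha, hF.self a ha, one_mul]
    intro b hb hn
    rw [hF.ne b hb a ha hn.symm, zero_mul]
  let N := A.filter fun a => φ (w a) < 0
  let P := A.filter fun a => ¬ φ (w a) < 0
  have hNP : N.card + P.card = A.card := card_filter_add_card_filter_not _
  have hsum := hF.apply_eq_sum φ e
  rw [hφe] at hsum
  obtain ⟨a₀, ha₀, hpos₀⟩ := hex e
  have hN : ∃ a ∈ A, φ (w a) < 0 := by
    by_contra! h
    refine hsum.not_lt (sum_pos' (fun a ha => mul_nonneg (hF.nonneg a ha e) (h a ha))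
      ⟨a₀, ha₀, mul_pos hpos₀ (lt_of_le_of_ne (h a₀ ha₀) (hφA a₀ ha₀).symm)⟩)
  have hP : ∃ a ∈ A, 0 < φ (w a) := by
    by_contra! h
    refine hsum.not_gt (sum_neg' (fun a ha => mul_nonpos_of_nonneg_of_nonpos (hF.nonneg a ha e)
      (h a ha)) ⟨a₀, ha₀, mul_neg_of_pos_of_neg hpos₀ (lt_of_le_of_ne (h a₀ ha₀) (hφA a₀ ha₀))⟩)
  have hlevN : ∀ a ∈ A, φ (w a) < 0 → φ (w a) / g (w a) = -1 := fun a ha h => by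
    rw [hgA a ha, abs_of_neg h, div_neg, div_self h.ne]
  have hlevP : ∀ a ∈ A, 0 < φ (w a) → φ (w a) / g (w a) = 1 := fun a ha h => by
    rw [hgA a ha, abs_of_pos h, div_self h.ne']
  refine hbig ((isLevelMap_div w φ g hg).hasBigString hw0 {-1, 0, 1} ?_ ?_ ?_)
  · simp only [mem_insert, mem_singleton, forall_eq_or_imp, forall_eq]
    obtain ⟨a, ha, h⟩ := hN
    obtain ⟨a', ha', h'⟩ := hP
    exact ⟨⟨a, hlevN a ha h⟩, ⟨e, by simp [hφe]⟩, a', hlevP a' ha' h'⟩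
  · rw [card_insert_of_notMem (by norm_num), card_pair (by norm_num)]
    norm_num
  · rw [sum_insert (by norm_num), sum_pair (by norm_num)]
    have h1 : N.card ≤ _ := hF.card_le_finrank_span (s := N) (filter_subset _ _)
      (t := {e | φ (w e) / g (w e) = -1}) fun a ha => by
        obtain ⟨ha, h⟩ := mem_filter.1 (mem_coe.1 ha)
        exact hlevN a ha h
    have h2 : P.card ≤ _ := hF.card_le_finrank_span (s := P) (filter_subset _ _)
      (t := {e | φ (w e) / g (w e) = 1}) fun a ha => by
        obtain ⟨ha, h⟩ := mem_filter.1 (mem_coe.1 ha)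
        exact hlevP a ha (lt_of_le_of_ne (not_lt.1 h) (hφA a ha).symm)
    have h3 := two_le_finrank_span_image hπ hw (s := {e | φ (w e) / g (w e) = 0})
      (e := e) (f := f) (by simp [hφe]) (by simp [hφf]) hef
    have h4 := hF.finrank_le_card
    omega

end IsSimplexFrame

/-- `X e` are the barycentric coordinates of distinct points of a simplex with vertices `A`. -/
structure IsBarycentric {E : Type*} (A : Finset E) (X : E → E → ℝ) : Prop where
  nonneg : ∀ e, ∀ a ∈ A, 0 ≤ X e a
  sum_eq_one : ∀ e, ∑ a ∈ A, X e a = 1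
  inj : ∀ e f, (∀ a ∈ A, X e a = X f a) → e = f
  self : ∀ a ∈ A, X a a = 1
  ne : ∀ a ∈ A, ∀ c ∈ A, a ≠ c → X a c = 0

/-- The coordinates of `e` and `f` other than the `c`-th are proportional. -/
def PropOff {E : Type*} (A : Finset E) (X : E → E → ℝ) (e f c : E) : Prop :=
  ∀ a ∈ A, ∀ a' ∈ A, a ≠ c → a' ≠ c → X e a * X f a' = X e a' * X f a

namespace IsBarycentric

variable {E : Type*} {A : Finset E} {X : E → E → ℝ}

theorem exists_pos_off (hX : IsBarycentric A X) {e : E} (he : e ∉ A) {c : E} (hc : c ∈ A) :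
    ∃ a ∈ A, a ≠ c ∧ 0 < X e a := by
  by_contra! h
  have h0 : ∀ a ∈ A, a ≠ c → X e a = 0 := fun a ha hn => (h a ha hn).antisymm (hX.nonneg e a ha)
  have h1 : X e c = 1 := by
    rw [← hX.sum_eq_one e]
    exact (sum_eq_single_of_mem c hc h0).symm
  refine he ((hX.inj e c fun a ha => ?_) ▸ hc)
  by_cases hn : a = c
  · rw [hn, h1, hX.self c hc]
  · rw [h0 a ha hn, hX.ne c hc a ha (Ne.symm hn)]

theorem eq_of_proportional (hX : IsBarycentric A X) {e f : E} {t : ℝ}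
    (h : ∀ a ∈ A, X f a = t * X e a) : f = e := by
  have h1 : t = 1 := by
    have := hX.sum_eq_one f
    rw [sum_congr rfl h, ← mul_sum, hX.sum_eq_one, mul_one] at this
    exact this
  exact hX.inj f e fun a ha => by rw [h a ha, h1, one_mul]

end IsBarycentric

namespace PropOff

variable {E : Type*} {A : Finset E} {X : E → E → ℝ} {e f g c : E}

theorem refl (e c : E) : PropOff A X e e c := fun _ _ _ _ _ _ => mul_comm _ _

theorem symm (h : PropOff A X e f c) : PropOff A X f e c := fun a ha a' ha' hn hn' => by
  have := h a ha a' ha' hn hn'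
  linarith

theorem trans (hX : IsBarycentric A X) (hf : f ∉ A) (hc : c ∈ A) (h : PropOff A X e f c)
    (h' : PropOff A X f g c) : PropOff A X e g c := by
  intro a ha a' ha' hn hn'
  obtain ⟨k, hk, hkc, hpos⟩ := hX.exists_pos_off hf hc
  have h1 := h a ha k hk hn hkc
  have h2 := h' a ha a' ha' hn hn'
  have h3 := h k hk a' ha' hkc hn'
  refine mul_left_cancel₀ hpos.ne' ?_
  linear_combination (X g a') * h1 + X e k * h2 + X g a * h3

theorem exists_factor (hX : IsBarycentric A X) (he : e ∉ A) (hf : f ∉ A) (hc : c ∈ A)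
    (h : PropOff A X e f c) : ∃ t : ℝ, 0 < t ∧ ∀ a ∈ A, a ≠ c → X f a = t * X e a := by
  obtain ⟨k, hk, hkc, hpos⟩ := hX.exists_pos_off he hc
  obtain ⟨k', hk', hkc', hpos'⟩ := hX.exists_pos_off hf hc
  have key : ∀ a ∈ A, a ≠ c → X f a = X f k / X e k * X e a := fun a ha hn => by
    have := h a ha k hk hn hkc
    field_simp
    linarith
  refine ⟨X f k / X e k, lt_of_le_of_ne (div_nonneg (hX.nonneg f k hk) hpos.le) fun h0 => ?_, key⟩
  have := key k' hk' hkc'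
  rw [← h0, zero_mul] at this
  exact hpos'.ne' this

end PropOff

namespace IsBarycentric

variable {E : Type*} {A : Finset E} {X : E → E → ℝ}

theorem sum_triple (hX : IsBarycentric A X) {e a₁ a₂ a₃ : E} (h₁ : a₁ ∈ A)
    (h₂ : a₂ ∈ A) (h₃ : a₃ ∈ A) (h₁₂ : a₁ ≠ a₂) (h₁₃ : a₁ ≠ a₃) (h₂₃ : a₂ ≠ a₃)
    (h : ∀ c ∈ A, c ≠ a₁ → c ≠ a₂ → c ≠ a₃ → X e c = 0) :
    X e a₁ + X e a₂ + X e a₃ = 1 := by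
  classical
  rw [← hX.sum_eq_one e, ← sum_subset (s₁ := {a₁, a₂, a₃})]
  · rw [sum_insert (by simp [h₁₂, h₁₃]), sum_pair h₂₃, add_assoc]
  · intro c
    simp only [mem_insert, mem_singleton]
    rintro (rfl | rfl | rfl) <;> assumption
  · intro c hc hn
    simp only [mem_insert, mem_singleton, not_or] at hn
    exact h c hc hn.1 hn.2.1 hn.2.2

/-- Three non-vertices, pairwise aligned with three different vertices. -/
theorem triangle (hX : IsBarycentric A X) {e f g a₁ a₂ a₃ : E} (he : e ∉ A) (hf : f ∉ A)
    (hg : g ∉ A) (h₁ : a₁ ∈ A) (h₂ : a₂ ∈ A) (h₃ : a₃ ∈ A) (h₁₂ : a₁ ≠ a₂) (h₁₃ : a₁ ≠ a₃)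
    (h₂₃ : a₂ ≠ a₃) (hef : PropOff A X e f a₁) (heg : PropOff A X e g a₂)
    (hfg : PropOff A X f g a₃) (hef' : e ≠ f) (hn : ¬ PropOff A X e g a₁) :
    (∀ c ∈ A, c ≠ a₁ → c ≠ a₂ → c ≠ a₃ → X e c = 0) ∧ 0 < X e a₁ ∧ 0 < X e a₂ ∧ 0 < X e a₃ ∧
    ∃ p q s t : ℝ, 0 < p ∧ 0 < q ∧ 0 < s ∧ 0 < t ∧ s * t = 1 ∧ s ≠ 1 ∧
      (∀ c ∈ A, c ≠ a₁ → X f c = p * X e c) ∧ X f a₁ = p * s * X e a₁ ∧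
      (∀ c ∈ A, c ≠ a₂ → X g c = q * X e c) ∧ X g a₂ = q * t * X e a₂ := by
  obtain ⟨p, hp, hpf⟩ := hef.exists_factor hX he hf h₁
  obtain ⟨q, hq, hqg⟩ := heg.exists_factor hX he hg h₂
  have hfa : X f a₁ ≠ p * X e a₁ := fun h => hef' (hX.eq_of_proportional (fun c hc => by
    by_cases hcn : c = a₁
    · rw [hcn, h]
    · exact hpf c hc hcn)).symm
  have hz : ∀ c ∈ A, c ≠ a₁ → c ≠ a₂ → c ≠ a₃ → X e c = 0 := fun c hc hc1 hc2 hc3 => by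
    have h := hfg c hc a₁ h₁ hc3 h₁₃
    rw [hpf c hc hc1, hqg c hc hc2, hqg a₁ h₁ h₁₂] at h
    by_contra h0
    refine hfa (mul_left_cancel₀ (mul_ne_zero hq.ne' h0) ?_)
    linarith
  have hga : X g a₂ ≠ q * X e a₂ := fun h => hn (by
    have : g = e := hX.eq_of_proportional (fun c hc => by
      by_cases hcn : c = a₂
      · rw [hcn, h]
      · exact hqg c hc hcn)
    rw [this]
    exact PropOff.refl e a₁)
  have hprod : X f a₁ * X g a₂ = p * X e a₂ * (q * X e a₁) := by
    rw [hfg a₁ h₁ a₂ h₂ h₁₃ h₂₃, hpf a₂ h₂ h₁₂.symm, hqg a₁ h₁ h₁₂]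
  have hfz : ∀ c ∈ A, c ≠ a₁ → c ≠ a₂ → c ≠ a₃ → X f c = 0 := fun c hc hc1 hc2 hc3 => by
    rw [hpf c hc hc1, hz c hc hc1 hc2 hc3, mul_zero]
  have hgz : ∀ c ∈ A, c ≠ a₁ → c ≠ a₂ → c ≠ a₃ → X g c = 0 := fun c hc hc1 hc2 hc3 => by
    rw [hqg c hc hc2, hz c hc hc1 hc2 hc3, mul_zero]
  have hp3 : 0 < X e a₃ := by
    refine lt_of_le_of_ne (hX.nonneg e a₃ h₃) fun h0 => hn ?_
    have he3 : ∀ c ∈ A, c ≠ a₁ → c ≠ a₂ → X e c = 0 := fun c hc hc1 hc2 => by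
      by_cases hc3 : c = a₃
      · rw [hc3, h0]
      · exact hz c hc hc1 hc2 hc3
    have hg3 : ∀ c ∈ A, c ≠ a₁ → c ≠ a₂ → X g c = 0 := fun c hc hc1 hc2 => by
      rw [hqg c hc hc2, he3 c hc hc1 hc2, mul_zero]
    intro c hc c' hc' hn hn'
    by_cases h : c = a₂
    · by_cases h' : c' = a₂
      · rw [h, h']
      · rw [hg3 c' hc' hn' h', he3 c' hc' hn' h']; ring
    · rw [hg3 c hc hn h, he3 c hc hn h]; ring
  have hp1 : 0 < X e a₁ := by
    refine lt_of_le_of_ne (hX.nonneg e a₁ h₁) fun h0 => ?_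
    rw [← h0] at hprod hfa
    have hg2 : X g a₂ = 0 := by
      rw [mul_zero] at hfa
      have : X f a₁ * X g a₂ = 0 := by rw [hprod]; ring
      exact (mul_eq_zero.1 this).resolve_left hfa
    obtain ⟨k, hk, hk3, hpos⟩ := hX.exists_pos_off hg h₃
    by_cases hk1 : k = a₁
    · rw [hk1, hqg a₁ h₁ h₁₂, ← h0] at hpos
      simp at hpos
    · by_cases hk2 : k = a₂
      · rw [hk2, hg2] at hpos; exact lt_irrefl _ hpos
      · exact hpos.ne' (hgz k hk hk1 hk2 hk3)
  have hp2 : 0 < X e a₂ := by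
    refine lt_of_le_of_ne (hX.nonneg e a₂ h₂) fun h0 => ?_
    rw [← h0] at hprod hga
    have hf1 : X f a₁ = 0 := by
      rw [mul_zero] at hga
      have : X f a₁ * X g a₂ = 0 := by rw [hprod]; ring
      exact (mul_eq_zero.1 this).resolve_right hga
    obtain ⟨k, hk, hk3, hpos⟩ := hX.exists_pos_off hf h₃
    by_cases hk1 : k = a₁
    · rw [hk1, hf1] at hpos; exact lt_irrefl _ hpos
    · by_cases hk2 : k = a₂
      · rw [hk2, hpf a₂ h₂ h₁₂.symm, ← h0] at hpos
        simp at hpos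
      · exact hpos.ne' (hfz k hk hk1 hk2 hk3)
  have hst : X f a₁ / (p * X e a₁) * (X g a₂ / (q * X e a₂)) = 1 := by
    field_simp
    linarith
  have hs0 : 0 ≤ X f a₁ / (p * X e a₁) := div_nonneg (hX.nonneg f a₁ h₁) (by positivity)
  have ht0 : 0 ≤ X g a₂ / (q * X e a₂) := div_nonneg (hX.nonneg g a₂ h₂) (by positivity)
  refine ⟨hz, hp1, hp2, hp3, p, q, X f a₁ / (p * X e a₁), X g a₂ / (q * X e a₂), hp, hq,
    lt_of_le_of_ne hs0 fun h => ?_, lt_of_le_of_ne ht0 fun h => ?_, hst, fun h => hfa ?_, hpf, ?_,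
    hqg, ?_⟩
  · rw [← h] at hst; simp at hst
  · rw [← h] at hst; simp at hst
  · rw [div_eq_one_iff_eq (by positivity)] at h
    exact h
  · field_simp
  · field_simp

/-- Cyclic configuration of three points inside a triangle. -/
def IsCyclicTriple (A : Finset E) (X : E → E → ℝ) (e f g a₁ a₂ a₃ : E) : Prop :=
  ∃ p q s : ℝ, (0 < p ∧ p < 1) ∧ (0 < q ∧ q < 1) ∧ (0 < s ∧ s < 1) ∧ ∀ c ∈ A,
    X f c = p * X e c + (1 - p) * X a₁ c ∧ X g c = q * X f c + (1 - q) * X a₂ c ∧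
    X e c = s * X g c + (1 - s) * X a₃ c

theorem isCyclicTriple_aux (hX : IsBarycentric A X) {e f g a₁ a₂ a₃ : E}
    (h₁ : a₁ ∈ A) (h₂ : a₂ ∈ A) (h₃ : a₃ ∈ A) (h₁₂ : a₁ ≠ a₂) (h₁₃ : a₁ ≠ a₃)
    (h₂₃ : a₂ ≠ a₃) (hz : ∀ c ∈ A, c ≠ a₁ → c ≠ a₂ → c ≠ a₃ → X e c = 0)
    (h1 : 0 < X e a₁) (h2 : 0 < X e a₂) (h3 : 0 < X e a₃) {p q s t : ℝ} (hp : 0 < p)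
    (hq : 0 < q) (ht : 0 < t) (hst : s * t = 1) (hs : 1 < s)
    (hpf : ∀ c ∈ A, c ≠ a₁ → X f c = p * X e c) (hf1 : X f a₁ = p * s * X e a₁)
    (hqg : ∀ c ∈ A, c ≠ a₂ → X g c = q * X e c) (hg2 : X g a₂ = q * t * X e a₂) :
    IsCyclicTriple A X e f g a₁ a₃ a₂ := by
  have hfz : ∀ c ∈ A, c ≠ a₁ → c ≠ a₂ → c ≠ a₃ → X f c = 0 := fun c hc hc1 hc2 hc3 => by
    rw [hpf c hc hc1, hz c hc hc1 hc2 hc3, mul_zero]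
  have hgz : ∀ c ∈ A, c ≠ a₁ → c ≠ a₂ → c ≠ a₃ → X g c = 0 := fun c hc hc1 hc2 hc3 => by
    rw [hqg c hc hc2, hz c hc hc1 hc2 hc3, mul_zero]
  have se := hX.sum_triple h₁ h₂ h₃ h₁₂ h₁₃ h₂₃ hz
  have sf := hX.sum_triple h₁ h₂ h₃ h₁₂ h₁₃ h₂₃ hfz
  have sg := hX.sum_triple h₁ h₂ h₃ h₁₂ h₁₃ h₂₃ hgz
  have hf2 := hpf a₂ h₂ h₁₂.symm
  have hf3 := hpf a₃ h₃ h₁₃.symm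
  have hg1 := hqg a₁ h₁ h₁₂
  have hg3 := hqg a₃ h₃ h₂₃.symm
  rw [hf1, hf2, hf3] at sf
  rw [hg1, hg2, hg3] at sg
  have ht1 : t < 1 := by nlinarith
  have a11 := hX.self a₁ h₁
  have a22 := hX.self a₂ h₂
  have a33 := hX.self a₃ h₃
  have a12 := hX.ne a₁ h₁ a₂ h₂ h₁₂
  have a21 := hX.ne a₂ h₂ a₁ h₁ h₁₂.symm
  have a13 := hX.ne a₁ h₁ a₃ h₃ h₁₃
  have a31 := hX.ne a₃ h₃ a₁ h₁ h₁₃.symm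
  have a23 := hX.ne a₂ h₂ a₃ h₃ h₂₃
  have a32 := hX.ne a₃ h₃ a₂ h₂ h₂₃.symm
  -- weights of the triple
  have e1 : 1 - p = p * (s - 1) * X e a₁ := by linear_combination p * se - sf
  have e2 : q - 1 = q * (1 - t) * X e a₂ := by linear_combination sg - q * se
  have e3 : 1 - q * t / p = q * (1 - t) * X e a₃ := by
    field_simp
    linear_combination (-p) * sg + q * t * sf + (p * q * X e a₁) * (-hst)
  have hqt : 0 < q * t / p := by positivity
  have hp1 : p < 1 := by
    have : 0 < p * (s - 1) * X e a₁ := mul_pos (mul_pos hp (by linarith)) h1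
    linarith
  have hq1 : 1 < q := by
    have : 0 < q * (1 - t) * X e a₂ := mul_pos (mul_pos hq (by linarith)) h2
    linarith
  have hr1 : q * t / p < 1 := by
    have : 0 < q * (1 - t) * X e a₃ := mul_pos (mul_pos hq (by linarith)) h3
    linarith
  refine ⟨p, q * t / p, q⁻¹, ⟨hp, hp1⟩, ⟨hqt, hr1⟩, ⟨by positivity, inv_lt_one_of_one_lt₀ hq1⟩,
    fun c hc => ?_⟩
  by_cases hc1 : c = a₁
  · subst hc1
    rw [a11, a21, a31, hf1, hg1, e1]
    refine ⟨by ring, ?_, by field_simp; ring⟩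
    have : q * t / p * (p * s * X e c) = q * (s * t) * X e c := by field_simp
    rw [this, hst]
    ring
  · by_cases hc2 : c = a₂
    · subst hc2
      rw [a12, a22, a32, hf2, hg2]
      refine ⟨by ring, by field_simp; ring, ?_⟩
      field_simp
      linarith
    · by_cases hc3 : c = a₃
      · subst hc3
        rw [a13, a23, a33, hf3, hg3]
        refine ⟨by ring, ?_, by field_simp; ring⟩
        rw [e3]
        field_simp
        ring
      · rw [hz c hc hc1 hc2 hc3, hfz c hc hc1 hc2 hc3, hgz c hc hc1 hc2 hc3,
          hX.ne a₁ h₁ c hc (Ne.symm hc1), hX.ne a₂ h₂ c hc (Ne.symm hc2),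
          hX.ne a₃ h₃ c hc (Ne.symm hc3)]
        simp

/-- Non-vertices pairwise aligned with a vertex either all lie on a line through a vertex or form a
cyclic triple. -/
theorem classification (hX : IsBarycentric A X)
    (hQ : ∀ e ∉ A, ∀ f ∉ A, e ≠ f → ∃ c ∈ A, PropOff A X e f c) :
    (∀ e, e ∈ A) ∨ (∃ a ∈ A, ∀ e ∉ A, ∀ f ∉ A, PropOff A X e f a) ∨
    ∃ e f g a₁ a₂ a₃, a₁ ∈ A ∧ a₂ ∈ A ∧ a₃ ∈ A ∧ (∀ h ∉ A, h = e ∨ h = f ∨ h = g) ∧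
      IsCyclicTriple A X e f g a₁ a₂ a₃ := by
  by_cases hall : ∀ e, e ∈ A
  · exact Or.inl hall
  refine Or.inr ?_
  push Not at hall
  obtain ⟨e, he⟩ := hall
  by_cases hL : ∃ a ∈ A, ∀ f ∉ A, PropOff A X e f a
  · obtain ⟨a, ha, h⟩ := hL
    exact Or.inl ⟨a, ha, fun f hf g hg => (h f hf).symm.trans hX he ha (h g hg)⟩
  refine Or.inr ?_
  push Not at hL
  obtain ⟨a₀, ha₀⟩ : A.Nonempty := by
    rw [nonempty_iff_ne_empty]
    intro h
    have := hX.sum_eq_one e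
    simp [h] at this
  obtain ⟨f, hf, hfn⟩ := hL a₀ ha₀
  have hef : e ≠ f := fun h => hfn (h ▸ PropOff.refl e a₀)
  obtain ⟨a₁, h₁, R₁⟩ := hQ e he f hf hef
  obtain ⟨g, hg, hgn⟩ := hL a₁ h₁
  have heg : e ≠ g := fun h => hgn (h ▸ PropOff.refl e a₁)
  have hfg : f ≠ g := fun h => hgn (h ▸ R₁)
  obtain ⟨a₂, h₂, R₂⟩ := hQ e he g hg heg
  obtain ⟨a₃, h₃, R₃⟩ := hQ f hf g hg hfg
  have h₁₂ : a₁ ≠ a₂ := fun h => hgn (h ▸ R₂)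
  have h₁₃ : a₁ ≠ a₃ := fun h => hgn (R₁.trans hX hf h₁ (h ▸ R₃))
  have h₂₃ : a₂ ≠ a₃ := by
    rintro rfl
    have R₄ : PropOff A X e f a₂ := R₂.trans hX hg h₂ R₃.symm
    obtain ⟨p, hp, hpf⟩ := R₁.exists_factor hX he hf h₁
    obtain ⟨p', hp', hpf'⟩ := R₄.exists_factor hX he hf h₂
    obtain ⟨q, hq, hqg⟩ := R₂.exists_factor hX he hg h₂
    have hz : ∀ c ∈ A, c ≠ a₁ → c ≠ a₂ → X e c = 0 := fun c hc hc1 hc2 => by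
      by_contra h0
      have : p = p' := mul_right_cancel₀ h0 ((hpf c hc hc1).symm.trans (hpf' c hc hc2))
      refine hef (hX.eq_of_proportional (t := p) fun d hd => ?_).symm
      by_cases hd1 : d = a₁
      · rw [this]
        exact hpf' d hd (hd1 ▸ h₁₂)
      · exact hpf d hd hd1
    refine hgn fun c hc c' hc' hn hn' => ?_
    by_cases h : c = a₂
    · by_cases h' : c' = a₂
      · rw [h, h']
      · rw [hqg c' hc' h', hz c' hc' hn' h']; ring
    · rw [hqg c hc h, hz c hc hn h]; ring
  obtain ⟨hz, hp1, hp2, hp3, p, q, s, t, hp, hq, hs, ht, hst, hs1, hpf, hf1, hqg, hg2⟩ :=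
    hX.triangle he hf hg h₁ h₂ h₃ h₁₂ h₁₃ h₂₃ R₁ R₂ R₃ hef hgn
  have hf2 := hpf a₂ h₂ h₁₂.symm
  have hf3 := hpf a₃ h₃ h₁₃.symm
  have hg1 := hqg a₁ h₁ h₁₂
  have hg3 := hqg a₃ h₃ h₂₃.symm
  have hthree : ∀ h ∉ A, h = e ∨ h = f ∨ h = g := by
    intro h hh
    by_contra! hcon
    obtain ⟨hhe, hhf, hhg⟩ := hcon
    obtain ⟨c₁, hc₁, S₁⟩ := hQ e he h hh hhe.symm
    obtain ⟨c₂, hc₂, S₂⟩ := hQ f hf h hh hhf.symm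
    obtain ⟨c₃, hc₃, S₃⟩ := hQ g hg h hh hhg.symm
    have hps : 0 < p * s * X e a₁ := by positivity
    have hqt : 0 < q * t * X e a₂ := by positivity
    have hhz : ∀ c ∈ A, c ≠ a₁ → c ≠ a₂ → c ≠ a₃ → X h c = 0 := by
      intro c hc hc1 hc2 hc3
      by_contra h0
      have hec := hz c hc hc1 hc2 hc3
      have hfc : X f c = 0 := by rw [hpf c hc hc1, hec, mul_zero]
      have k1 : c = c₁ := by
        by_contra hn
        have : ∀ k ∈ A, 0 < X e k → k = c₁ := fun k hk hpos => by
          by_contra hkn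
          have := S₁ c hc k hk hn hkn
          rw [hec, zero_mul, eq_comm] at this
          exact (mul_ne_zero hpos.ne' h0) this
        exact h₁₂ ((this a₁ h₁ hp1).trans (this a₂ h₂ hp2).symm)
      have k2 : c = c₂ := by
        by_contra hn
        have : ∀ k ∈ A, 0 < X f k → k = c₂ := fun k hk hpos => by
          by_contra hkn
          have := S₂ c hc k hk hn hkn
          rw [hfc, zero_mul, eq_comm] at this
          exact (mul_ne_zero hpos.ne' h0) this
        exact h₂₃ ((this a₂ h₂ (hf2 ▸ mul_pos hp hp2)).trans
          (this a₃ h₃ (hf3 ▸ mul_pos hp hp3)).symm)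
      subst k1 k2
      have m := S₁.trans hX hh hc₁ S₂.symm a₁ h₁ a₂ h₂ (Ne.symm hc1) (Ne.symm hc2)
      rw [hf1, hf2] at m
      refine hs1 (mul_left_cancel₀ (mul_pos (mul_pos hp hp1) hp2).ne' ?_)
      linarith
    have sh := hX.sum_triple h₁ h₂ h₃ h₁₂ h₁₃ h₂₃ hhz
    have split : ∀ c, (a₂ ≠ c ∧ a₃ ≠ c) ∨ (a₁ ≠ c ∧ a₃ ≠ c) ∨ (a₁ ≠ c ∧ a₂ ≠ c) := fun c => by
      by_cases k1 : a₁ = c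
      · subst k1; exact Or.inl ⟨h₁₂.symm, h₁₃.symm⟩
      · by_cases k2 : a₂ = c
        · subst k2; exact Or.inr (Or.inl ⟨k1, h₂₃.symm⟩)
        · exact Or.inr (Or.inr ⟨k1, k2⟩)
    -- ratios of the coordinates of `h` to those of `e`
    obtain ⟨x, hx⟩ : ∃ x, X h a₁ = x * X e a₁ := ⟨X h a₁ / X e a₁, by field_simp⟩
    obtain ⟨y, hy⟩ : ∃ y, X h a₂ = y * X e a₂ := ⟨X h a₂ / X e a₂, by field_simp⟩
    obtain ⟨z, hz'⟩ : ∃ z, X h a₃ = z * X e a₃ := ⟨X h a₃ / X e a₃, by field_simp⟩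
    have T₁ : y = z ∨ x = z ∨ x = y := by
      rcases split c₁ with ⟨k, k'⟩ | ⟨k, k'⟩ | ⟨k, k'⟩
      · have := S₁ _ h₂ _ h₃ k k'
        rw [hy, hz'] at this
        exact Or.inl (mul_left_cancel₀ (mul_pos hp2 hp3).ne' (by linarith))
      · have := S₁ _ h₁ _ h₃ k k'
        rw [hx, hz'] at this
        exact Or.inr (Or.inl (mul_left_cancel₀ (mul_pos hp1 hp3).ne' (by linarith)))
      · have := S₁ _ h₁ _ h₂ k k'
        rw [hx, hy] at this
        exact Or.inr (Or.inr (mul_left_cancel₀ (mul_pos hp1 hp2).ne' (by linarith)))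
    have T₂ : y = z ∨ x = s * z ∨ x = s * y := by
      rcases split c₂ with ⟨k, k'⟩ | ⟨k, k'⟩ | ⟨k, k'⟩
      · have := S₂ _ h₂ _ h₃ k k'
        rw [hy, hz', hf2, hf3] at this
        exact Or.inl (mul_left_cancel₀ (mul_pos hp (mul_pos hp2 hp3)).ne' (by linarith))
      · have := S₂ _ h₁ _ h₃ k k'
        rw [hx, hz', hf1, hf3] at this
        exact Or.inr (Or.inl (mul_left_cancel₀ (mul_pos hp (mul_pos hp1 hp3)).ne' (by linarith)))
      · have := S₂ _ h₁ _ h₂ k k'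
        rw [hx, hy, hf1, hf2] at this
        exact Or.inr (Or.inr (mul_left_cancel₀ (mul_pos hp (mul_pos hp1 hp2)).ne' (by linarith)))
    have T₃ : y = t * z ∨ x = z ∨ y = t * x := by
      rcases split c₃ with ⟨k, k'⟩ | ⟨k, k'⟩ | ⟨k, k'⟩
      · have := S₃ _ h₂ _ h₃ k k'
        rw [hy, hz', hg2, hg3] at this
        exact Or.inl (mul_left_cancel₀ (mul_pos hq (mul_pos hp2 hp3)).ne' (by linarith))
      · have := S₃ _ h₁ _ h₃ k k'
        rw [hx, hz', hg1, hg3] at this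
        exact Or.inr (Or.inl (mul_left_cancel₀ (mul_pos hq (mul_pos hp1 hp3)).ne' (by linarith)))
      · have := S₃ _ h₁ _ h₂ k k'
        rw [hx, hy, hg1, hg2] at this
        exact Or.inr (Or.inr (mul_left_cancel₀ (mul_pos hq (mul_pos hp1 hp2)).ne' (by linarith)))
    have hxy : ¬ (x = 0 ∧ y = 0) := by
      rintro ⟨rfl, rfl⟩
      obtain ⟨k, hk, hkn, hpos⟩ := hX.exists_pos_off hh h₃
      by_cases k1 : k = a₁
      · rw [k1, hx] at hpos; simp at hpos
      · by_cases k2 : k = a₂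
        · rw [k2, hy] at hpos; simp at hpos
        · exact hpos.ne' (hhz k hk k1 k2 hkn)
    have hxz : ¬ (x = 0 ∧ z = 0) := by
      rintro ⟨rfl, rfl⟩
      obtain ⟨k, hk, hkn, hpos⟩ := hX.exists_pos_off hh h₂
      by_cases k1 : k = a₁
      · rw [k1, hx] at hpos; simp at hpos
      · by_cases k2 : k = a₃
        · rw [k2, hz'] at hpos; simp at hpos
        · exact hpos.ne' (hhz k hk k1 hkn k2)
    have hyz : ¬ (y = 0 ∧ z = 0) := by
      rintro ⟨rfl, rfl⟩
      obtain ⟨k, hk, hkn, hpos⟩ := hX.exists_pos_off hh h₁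
      by_cases k1 : k = a₂
      · rw [k1, hy] at hpos; simp at hpos
      · by_cases k2 : k = a₃
        · rw [k2, hz'] at hpos; simp at hpos
        · exact hpos.ne' (hhz k hk hkn k1 k2)
    have ne_e : ¬ (x = y ∧ y = z) := by
      rintro ⟨rfl, rfl⟩
      refine hhe (hX.eq_of_proportional (t := x) fun c hc => ?_)
      by_cases k1 : c = a₁
      · rw [k1, hx]
      · by_cases k2 : c = a₂
        · rw [k2, hy]
        · by_cases k3 : c = a₃
          · rw [k3, hz']
          · rw [hhz c hc k1 k2 k3, hz c hc k1 k2 k3, mul_zero]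
    have ne_f : ¬ (x = s * y ∧ y = z) := by
      rintro ⟨rfl, rfl⟩
      refine hhf (hX.eq_of_proportional (t := y / p) fun c hc => ?_)
      by_cases k1 : c = a₁
      · rw [k1, hx, hf1]; field_simp
      · rw [hpf c hc k1]
        by_cases k2 : c = a₂
        · rw [k2, hy]; field_simp
        · by_cases k3 : c = a₃
          · rw [k3, hz']; field_simp
          · rw [hhz c hc k1 k2 k3, hz c hc k1 k2 k3]; simp
    have ne_g : ¬ (y = t * x ∧ x = z) := by
      rintro ⟨rfl, rfl⟩
      refine hhg (hX.eq_of_proportional (t := x / q) fun c hc => ?_)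
      by_cases k1 : c = a₂
      · rw [k1, hy, hg2]; field_simp
      · rw [hqg c hc k1]
        by_cases k2 : c = a₁
        · rw [k2, hx]; field_simp
        · by_cases k3 : c = a₃
          · rw [k3, hz']; field_simp
          · rw [hhz c hc k2 k1 k3, hz c hc k2 k1 k3]; simp
    have ht1 : t ≠ 1 := by rintro rfl; rw [mul_one] at hst; exact hs1 hst
    have hs0 := hs.ne'
    have ht0 := ht.ne'
    have hst' : s ≠ t := by
      rintro rfl
      exact hs1 (by nlinarith)
    have hsz : ∀ u : ℝ, u = s * u → u = 0 := fun u hu => by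
      have : (s - 1) * u = 0 := by linarith
      exact (mul_eq_zero.1 this).resolve_left (sub_ne_zero.2 hs1)
    have htz : ∀ u : ℝ, u = t * u → u = 0 := fun u hu => by
      have : (t - 1) * u = 0 := by linarith
      exact (mul_eq_zero.1 this).resolve_left (sub_ne_zero.2 ht1)
    have hstu : ∀ u : ℝ, s * u = t * u → u = 0 := fun u hu => by
      have : (s - t) * u = 0 := by linarith
      exact (mul_eq_zero.1 this).resolve_left (sub_ne_zero.2 hst')
    have hts : ∀ u : ℝ, t * (s * u) = u := fun u => by rw [← mul_assoc, mul_comm t, hst, one_mul]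
    have hst2 : ∀ u : ℝ, s * (t * u) = u := fun u => by rw [← mul_assoc, hst, one_mul]
    clear * - T₁ T₂ T₃ hxy hxz hyz ne_e ne_f ne_g hsz htz hstu hts hst2
    grind
  rcases lt_or_gt_of_ne hs1 with hlt | hgt
  · refine ⟨e, g, f, a₂, a₃, a₁, h₂, h₃, h₁, fun h hh => by have := hthree h hh; tauto, ?_⟩
    exact hX.isCyclicTriple_aux h₂ h₁ h₃ h₁₂.symm h₂₃ h₁₃ (fun c hc k1 k2 k3 => hz c hc k2 k1 k3)
      hp2 hp1 hp3 hq hp hs (by linarith) (by nlinarith) hqg hg2 hpf hf1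
  · exact ⟨e, f, g, a₁, a₃, a₂, h₁, h₃, h₂, hthree, hX.isCyclicTriple_aux h₁ h₂ h₃ h₁₂ h₁₃ h₂₃ hz
      hp1 hp2 hp3 hp hq ht hst hgt hpf hf1 hqg hg2⟩

end IsBarycentric

section Heights

variable {l : ℕ}

/-- Consistent partial heights extend to a strictly monotone height function. -/
theorem exists_strictMono_extension {ι : Type*} (β : ι → Fin l) (u : ι → ℝ)
    (h : ∀ i j, (β i = β j → u i = u j) ∧ (β i < β j → u i < u j)) :
    ∃ val : Fin l → ℝ, StrictMono val ∧ ∀ i, val (β i) = u i := by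
  classical
  have key : ∀ T : Finset (Fin l), ∃ v : Fin l → ℝ,
      (∀ x ∈ T, ∀ y ∈ T, x < y → v x < v y) ∧
      (∀ x ∈ T, ∀ i, (x < β i → v x < u i) ∧ (β i < x → u i < v x) ∧ (x = β i → v x = u i)) := by
    intro T
    induction T using Finset.induction_on with
    | empty => exact ⟨fun _ => 0, by simp, by simp⟩
    | insert k T hk ih =>
      obtain ⟨v, hv, hvu⟩ := ih
      obtain ⟨x, hx1, hx2, hx3, hx4⟩ : ∃ x : ℝ, (∀ y ∈ T, y < k → v y < x) ∧
          (∀ y ∈ T, k < y → x < v y) ∧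
          (∀ i, (k < β i → x < u i) ∧ (β i < k → u i < x)) ∧ (∀ i, k = β i → x = u i) := by
        by_cases hi : ∃ i, β i = k
        · obtain ⟨i, rfl⟩ := hi
          exact ⟨u i, fun y hy hyk => (hvu y hy i).1 hyk, fun y hy hyk => (hvu y hy i).2.1 hyk,
            fun j => ⟨(h i j).2, (h j i).2⟩, fun j => (h i j).1⟩
        · push Not at hi
          have hfin : ∀ P : Fin l → Prop, Set.Finite {r : ℝ | ∃ i, P (β i) ∧ u i = r} :=
              fun P => by
            have : {r : ℝ | ∃ i, P (β i) ∧ u i = r} ⊆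
                Set.range (fun c : Fin l => if hc : ∃ i, β i = c then u hc.choose else 0) := by
              rintro _ ⟨i, -, rfl⟩
              have hc : ∃ j, β j = β i := ⟨i, rfl⟩
              refine ⟨β i, ?_⟩
              simp only [hc, dif_pos]
              exact (h _ _).1 hc.choose_spec
            exact (Set.finite_range _).subset this
          obtain ⟨x, hx1, hx2⟩ := Order.exists_between_finsets (α := ℝ)
            ((T.filter (· < k)).image v ∪ (hfin (· < k)).toFinset)
            ((T.filter (k < ·)).image v ∪ (hfin (k < ·)).toFinset) (by
              simp only [mem_union, mem_image, mem_filter, Set.Finite.mem_toFinset,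
                Set.mem_ofPred_eq]
              rintro _ (⟨y, ⟨hy, hyk⟩, rfl⟩ | ⟨i, hik, rfl⟩) _
                (⟨z, ⟨hz, hzk⟩, rfl⟩ | ⟨j, hjk, rfl⟩)
              · exact hv y hy z hz (hyk.trans hzk)
              · exact (hvu y hy j).1 (hyk.trans hjk)
              · exact (hvu z hz i).2.1 (hik.trans hzk)
              · exact (h i j).2 (hik.trans hjk))
          simp only [mem_union, mem_image, mem_filter, Set.Finite.mem_toFinset,
            Set.mem_ofPred_eq] at hx1 hx2
          exact ⟨x, fun y hy hyk => hx1 _ (Or.inl ⟨y, ⟨hy, hyk⟩, rfl⟩),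
            fun y hy hyk => hx2 _ (Or.inl ⟨y, ⟨hy, hyk⟩, rfl⟩),
            fun i => ⟨fun hi => hx2 _ (Or.inr ⟨i, hi, rfl⟩), fun hi => hx1 _ (Or.inr ⟨i, hi, rfl⟩)⟩,
            fun i hki => absurd hki.symm (hi i)⟩
      have hne : ∀ y ∈ T, y ≠ k := fun y hy h => hk (h ▸ hy)
      refine ⟨Function.update v k x, ?_, ?_⟩
      · simp only [mem_insert]
        rintro y (rfl | hy) z (rfl | hz) hyz
        · exact absurd hyz (lt_irrefl _)
        · rw [Function.update_self, Function.update_of_ne (hne z hz)]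
          exact hx2 z hz hyz
        · rw [Function.update_self, Function.update_of_ne (hne y hy)]
          exact hx1 y hy hyz
        · rw [Function.update_of_ne (hne y hy), Function.update_of_ne (hne z hz)]
          exact hv y hy z hz hyz
      · simp only [mem_insert]
        rintro y (rfl | hy) i
        · rw [Function.update_self]
          exact ⟨(hx3 i).1, (hx3 i).2, hx4 i⟩
        · rw [Function.update_of_ne (hne y hy)]
          exact hvu y hy i
  obtain ⟨v, hv, hvu⟩ := key univ
  exact ⟨v, fun x y => hv x (mem_univ x) y (mem_univ y), fun i =>
    (hvu (β i) (mem_univ _) i).2.2 rfl⟩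

theorem exists_strictMono_extension_of_chain {n : ℕ} {β : Fin n → Fin l} {u : Fin n → ℝ}
    (hβ : StrictMono β) (hu : StrictMono u) :
    ∃ val : Fin l → ℝ, StrictMono val ∧ ∀ i, val (β i) = u i :=
  exists_strictMono_extension β u fun _ _ =>
    ⟨fun h => by rw [hβ.injective h], fun h => hu (hβ.lt_iff_lt.1 h)⟩

/-- Stretching the heights above `k` adjusts a weighted sum of heights. -/
theorem exists_strictMono_sum_eq {ι : Type*} (B : Finset ι) (y : ι → ℝ) (β : ι → Fin l)
    (hy : ∀ a ∈ B, 0 ≤ y a) {v₀ : Fin l → ℝ} (hv₀ : StrictMono v₀) (k : Fin l) {T : ℝ}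
    (h : (∃ a ∈ B, 0 < y a ∧ k < β a) ∧ ∑ a ∈ B, y a * v₀ (min (β a) k) < T ∨
      ∑ a ∈ B, y a * v₀ (β a) = T) :
    ∃ v : Fin l → ℝ, StrictMono v ∧ (∀ i ≤ k, v i = v₀ i) ∧ ∑ a ∈ B, y a * v (β a) = T := by
  rcases h with ⟨⟨a₀, ha₀, hy₀, hk₀⟩, hT⟩ | hT
  swap
  · exact ⟨v₀, hv₀, fun _ _ => rfl, hT⟩
  set M := ∑ a ∈ B, y a * ((((β a : ℕ) - (k : ℕ) : ℕ)) : ℝ) with hM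
  have hMpos : 0 < M := by
    refine sum_pos' (fun a ha => mul_nonneg (hy a ha) (Nat.cast_nonneg _)) ⟨a₀, ha₀, ?_⟩
    refine mul_pos hy₀ (Nat.cast_pos.2 ?_)
    have : (k : ℕ) < β a₀ := hk₀
    omega
  set δ := (T - ∑ a ∈ B, y a * v₀ (min (β a) k)) / M
  have hδ : 0 < δ := div_pos (by linarith) hMpos
  refine ⟨fun i => v₀ (min i k) + δ * ((((i : ℕ) - (k : ℕ) : ℕ)) : ℝ), fun i j hij => ?_,
    fun i hi => ?_, ?_⟩
  · have hij' : (i : ℕ) < j := hij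
    rcases le_or_gt j k with hjk | hjk
    · have hjk' : (j : ℕ) ≤ k := hjk
      simp only [min_eq_left hjk, min_eq_left (hij.le.trans hjk)]
      rw [Nat.sub_eq_zero_of_le hjk', Nat.sub_eq_zero_of_le (by omega)]
      simpa using hv₀ hij
    · have hjk' : (k : ℕ) < j := hjk
      have h1 : v₀ (min i k) ≤ v₀ (min j k) := hv₀.monotone (min_le_min_right _ hij.le)
      have h2 : (((i : ℕ) - (k : ℕ) : ℕ) : ℝ) < (((j : ℕ) - (k : ℕ) : ℕ) : ℝ) :=
        Nat.cast_lt.2 (by omega)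
      have := mul_lt_mul_of_pos_left h2 hδ
      simp only
      linarith
  · have hi' : (i : ℕ) ≤ k := hi
    simp only [min_eq_left hi]
    rw [Nat.sub_eq_zero_of_le hi']
    simp
  · have : ∀ a ∈ B, y a * (v₀ (min (β a) k) + δ * ((((β a : ℕ) - (k : ℕ) : ℕ)) : ℝ))
        = y a * v₀ (min (β a) k) + δ * (y a * ((((β a : ℕ) - (k : ℕ) : ℕ)) : ℝ)) :=
      fun a _ => by ring
    rw [sum_congr rfl this, sum_add_distrib, ← mul_sum, ← hM, div_mul_cancel₀ _ hMpos.ne']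
    ring

/-- Block positions compatible with `y` lying strictly between `x` and `z`. -/
def IsBetweenBlocks (x y z : Fin l) : Prop :=
  (x < y → y < z) ∧ (y < x → z < y) ∧ (x = y → z = y)

theorem IsBetweenBlocks.rev {x y z : Fin l} (h : IsBetweenBlocks x y z) :
    IsBetweenBlocks x.rev y.rev z.rev := by
  simp only [IsBetweenBlocks, Fin.rev_lt_rev, Fin.rev_inj]
  exact ⟨h.2.1, h.1, h.2.2⟩

/-- Heights realising a cyclic triple of convex relations. -/
def HasCyclicHeights (p q s : ℝ) (e f g a₁ a₂ a₃ : Fin l) : Prop :=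
  ∃ val : Fin l → ℝ, StrictMono val ∧ val f = p * val e + (1 - p) * val a₁ ∧
    val g = q * val f + (1 - q) * val a₂ ∧ val e = s * val g + (1 - s) * val a₃

theorem HasCyclicHeights.rotate {p q s : ℝ} {e f g a₁ a₂ a₃ : Fin l}
    (h : HasCyclicHeights q s p f g e a₂ a₃ a₁) : HasCyclicHeights p q s e f g a₁ a₂ a₃ := by
  obtain ⟨val, hv, h1, h2, h3⟩ := h
  exact ⟨val, hv, h3, h1, h2⟩

theorem HasCyclicHeights.of_rev {p q s : ℝ} {e f g a₁ a₂ a₃ : Fin l}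
    (h : HasCyclicHeights p q s e.rev f.rev g.rev a₁.rev a₂.rev a₃.rev) :
    HasCyclicHeights p q s e f g a₁ a₂ a₃ := by
  obtain ⟨val, hv, h1, h2, h3⟩ := h
  refine ⟨fun i => -val i.rev, fun i j hij => neg_lt_neg (hv (Fin.rev_lt_rev.2 hij)), ?_, ?_, ?_⟩
  · dsimp only; rw [h1]; ring
  · dsimp only; rw [h2]; ring
  · dsimp only; rw [h3]; ring

theorem hasCyclicHeights_of_lt_lt {p q s : ℝ} (hp0 : 0 < p) (hp1 : p < 1) (hq0 : 0 < q)
    (hq1 : q < 1) (hs0 : 0 < s) (hs1 : s < 1) {e f g a₁ a₂ a₃ : Fin l}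
    (h₁ : IsBetweenBlocks e f a₁) (h₂ : IsBetweenBlocks f g a₂) (h₃ : IsBetweenBlocks g e a₃)
    (hef : e < f) (hfg : f < g) : HasCyclicHeights p q s e f g a₁ a₂ a₃ := by
  have k1 := h₁.1 hef
  have k2 := h₂.1 hfg
  have k3 := h₃.2.1 (hef.trans hfg)
  have hp : 0 < 1 - p := by linarith
  have hq : 0 < 1 - q := by linarith
  have hs : 0 < 1 - s := by linarith
  obtain ⟨c, hc, hcp⟩ : ∃ c : ℝ, 0 < c ∧ (1 - p) * c = p := ⟨p / (1 - p), by positivity, by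
    field_simp⟩
  have finish : ∀ (val : Fin l → ℝ) (κ : ℝ), StrictMono val → val e = 0 → val f = 1 →
      val g = 1 + (1 - q) * κ → val a₁ = 1 + c → val a₂ = 1 + κ →
      val a₃ = -(s / (1 - s) * (1 + (1 - q) * κ)) → HasCyclicHeights p q s e f g a₁ a₂ a₃ := by
    intro val κ hv ve vf vg v1 v2 v3
    refine ⟨val, hv, ?_, ?_, ?_⟩
    · rw [ve, vf, v1]; linarith
    · rw [vf, vg, v2]; ring
    · rw [ve, vg, v3]; field_simp; ring
  have neg : ∀ κ : ℝ, 0 < κ → -(s / (1 - s) * (1 + (1 - q) * κ)) < 0 := fun κ hκ => by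
    have : 0 < s / (1 - s) * (1 + (1 - q) * κ) := by positivity
    linarith
  -- chains of six blocks, then of five
  have six : ∀ (x₄ x₅ x₆ : Fin l) (r₄ r₅ r₆ κ : ℝ), 0 < κ → f < x₄ → x₄ < x₅ → x₅ < x₆ →
      1 < r₄ → r₄ < r₅ → r₅ < r₆ → ∃ val : Fin l → ℝ, StrictMono val ∧
      val a₃ = -(s / (1 - s) * (1 + (1 - q) * κ)) ∧ val e = 0 ∧ val f = 1 ∧ val x₄ = r₄ ∧
      val x₅ = r₅ ∧ val x₆ = r₆ := by
    intro x₄ x₅ x₆ r₄ r₅ r₆ κ hκ i4 i5 i6 j4 j5 j6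
    obtain ⟨val, hv, h⟩ := exists_strictMono_extension_of_chain
      (β := ![a₃, e, f, x₄, x₅, x₆])
      (u := ![-(s / (1 - s) * (1 + (1 - q) * κ)), 0, 1, r₄, r₅, r₆])
      (Fin.strictMono_iff_lt_succ.2 (by simp [Fin.forall_fin_succ, *]))
      (Fin.strictMono_iff_lt_succ.2 (by
        have := neg κ hκ
        simp only [Fin.forall_fin_succ]
        simpa [j4, j5, j6] using this))
    exact ⟨val, hv, h 0, h 1, h 2, h 3, h 4, h 5⟩
  have five : ∀ κ : ℝ, 0 < κ → ∃ val : Fin l → ℝ, StrictMono val ∧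
      val a₃ = -(s / (1 - s) * (1 + (1 - q) * κ)) ∧ val e = 0 ∧ val f = 1 ∧
      val g = 1 + (1 - q) * κ ∧ val a₂ = 1 + κ := by
    intro κ hκ
    obtain ⟨val, hv, h⟩ := exists_strictMono_extension_of_chain
      (β := ![a₃, e, f, g, a₂])
      (u := ![-(s / (1 - s) * (1 + (1 - q) * κ)), 0, 1, 1 + (1 - q) * κ, 1 + κ])
      (Fin.strictMono_iff_lt_succ.2 (by simp [Fin.forall_fin_succ, *]))
      (Fin.strictMono_iff_lt_succ.2 (by
        have := neg κ hκ
        have h2 : 0 < (1 - q) * κ := by positivity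
        have h3 : (1 - q) * κ < κ := by nlinarith
        simp only [Fin.forall_fin_succ]
        simpa [h2, h3] using this))
    exact ⟨val, hv, h 0, h 1, h 2, h 3, h 4⟩
  rcases lt_trichotomy a₁ g with hlt | heq | hgt
  · have hκ : 0 < 2 * c / (1 - q) := by positivity
    have hk : (1 - q) * (2 * c / (1 - q)) = 2 * c := by field_simp
    obtain ⟨val, hv, v3, ve, vf, v1, vg, v2⟩ := six a₁ g a₂ (1 + c)
      (1 + (1 - q) * (2 * c / (1 - q))) (1 + 2 * c / (1 - q)) _ hκ k1 hlt k2 (by linarith)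
      (by linarith) (by nlinarith)
    exact finish val _ hv ve vf vg v1 v2 v3
  · obtain ⟨val, hv, v3, ve, vf, vg, v2⟩ := five (c / (1 - q)) (by positivity)
    refine finish val _ hv ve vf vg ?_ v2 v3
    rw [heq, vg]
    field_simp
  rcases lt_trichotomy a₁ a₂ with hlt' | heq' | hgt'
  · have hκ : 0 < (1 - q / 2) * c / (1 - q) := by
      have : 0 < 1 - q / 2 := by linarith
      positivity
    have hk : (1 - q) * ((1 - q / 2) * c / (1 - q)) = (1 - q / 2) * c := by field_simp
    obtain ⟨val, hv, v3, ve, vf, vg, v1, v2⟩ := six g a₁ a₂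
      (1 + (1 - q) * ((1 - q / 2) * c / (1 - q))) (1 + c) (1 + (1 - q / 2) * c / (1 - q)) _ hκ
      hfg hgt hlt' (by nlinarith) (by nlinarith) (by
        rw [add_lt_add_iff_left, lt_div_iff₀ hq]
        nlinarith)
    exact finish val _ hv ve vf vg v1 v2 v3
  · obtain ⟨val, hv, v3, ve, vf, vg, v2⟩ := five c hc
    refine finish val _ hv ve vf vg ?_ v2 v3
    rw [heq', v2]
  · obtain ⟨val, hv, v3, ve, vf, vg, v2, v1⟩ := six g a₂ a₁
      (1 + (1 - q) * (c / 2)) (1 + c / 2) (1 + c) _ (half_pos hc)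
      hfg k2 hgt' (by nlinarith) (by nlinarith) (by linarith)
    exact finish val _ hv ve vf vg v1 v2 v3

theorem hasCyclicHeights_of_eq_lt {p q s : ℝ} (hq0 : 0 < q)
    (hq1 : q < 1) (hs0 : 0 < s) (hs1 : s < 1) {e f g a₁ a₂ a₃ : Fin l}
    (h₁ : IsBetweenBlocks e f a₁) (h₂ : IsBetweenBlocks f g a₂) (h₃ : IsBetweenBlocks g e a₃)
    (hef : e = f) (hfg : f < g) : HasCyclicHeights p q s e f g a₁ a₂ a₃ := by
  have k1 := h₁.2.2 hef
  have k2 := h₂.1 hfg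
  have k3 := h₃.2.1 (hef ▸ hfg)
  subst hef
  have hq : 0 < 1 - q := by linarith
  have hs : 0 < 1 - s := by linarith
  obtain ⟨val, hv, h⟩ := exists_strictMono_extension_of_chain
    (β := ![a₃, e, g, a₂]) (u := ![-(s / (1 - s)), 0, 1, 1 / (1 - q)])
    (Fin.strictMono_iff_lt_succ.2 (by simp [Fin.forall_fin_succ, *]))
    (Fin.strictMono_iff_lt_succ.2 (by
      have h1 : 0 < s / (1 - s) := by positivity
      have h2 : 1 < (1 - q)⁻¹ := (one_lt_inv₀ hq).2 (by linarith)
      simp only [Fin.forall_fin_succ]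
      simpa [h2] using h1))
  have v3 : val a₃ = -(s / (1 - s)) := h 0
  have ve : val e = 0 := h 1
  have vg : val g = 1 := h 2
  have v2 : val a₂ = 1 / (1 - q) := h 3
  refine ⟨val, hv, ?_, ?_, ?_⟩
  · rw [k1, ve]; ring
  · rw [vg, ve, v2]; field_simp; ring
  · rw [ve, vg, v3]; field_simp; ring

theorem hasCyclicHeights {p q s : ℝ} (hp0 : 0 < p) (hp1 : p < 1) (hq0 : 0 < q)
    (hq1 : q < 1) (hs0 : 0 < s) (hs1 : s < 1) {e f g a₁ a₂ a₃ : Fin l}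
    (h₁ : IsBetweenBlocks e f a₁) (h₂ : IsBetweenBlocks f g a₂) (h₃ : IsBetweenBlocks g e a₃) :
    HasCyclicHeights p q s e f g a₁ a₂ a₃ := by
  have up : ∀ {e f g a₁ a₂ a₃ : Fin l}, IsBetweenBlocks e f a₁ → IsBetweenBlocks f g a₂ →
      IsBetweenBlocks g e a₃ → (e < f ∧ f < g) ∨ (f < g ∧ g < e) ∨ (g < e ∧ e < f) ∨
        (e = f ∧ f < g) ∨ (f = g ∧ g < e) ∨ (g = e ∧ e < f) →
      HasCyclicHeights p q s e f g a₁ a₂ a₃ := by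
    rintro e f g a₁ a₂ a₃ h₁ h₂ h₃ (⟨h, h'⟩ | ⟨h, h'⟩ | ⟨h, h'⟩ | ⟨h, h'⟩ | ⟨h, h'⟩ | ⟨h, h'⟩)
    · exact hasCyclicHeights_of_lt_lt hp0 hp1 hq0 hq1 hs0 hs1 h₁ h₂ h₃ h h'
    · exact (hasCyclicHeights_of_lt_lt hq0 hq1 hs0 hs1 hp0 hp1 h₂ h₃ h₁ h h').rotate
    · exact (hasCyclicHeights_of_lt_lt hs0 hs1 hp0 hp1 hq0 hq1 h₃ h₁ h₂ h h').rotate.rotate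
    · exact hasCyclicHeights_of_eq_lt hq0 hq1 hs0 hs1 h₁ h₂ h₃ h h'
    · exact (hasCyclicHeights_of_eq_lt hs0 hs1 hp0 hp1 h₂ h₃ h₁ h h').rotate
    · exact (hasCyclicHeights_of_eq_lt hp0 hp1 hq0 hq1 h₃ h₁ h₂ h h').rotate.rotate
  by_cases hup : (e < f ∧ f < g) ∨ (f < g ∧ g < e) ∨ (g < e ∧ e < f) ∨
        (e = f ∧ f < g) ∨ (f = g ∧ g < e) ∨ (g = e ∧ e < f)
  · exact up h₁ h₂ h₃ hup
  by_cases hdown : (f < e ∧ g < f) ∨ (g < f ∧ e < g) ∨ (e < g ∧ f < e) ∨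
        (e = f ∧ g < f) ∨ (f = g ∧ e < g) ∨ (g = e ∧ f < e)
  · refine (up h₁.rev h₂.rev h₃.rev ?_).of_rev
    simpa only [Fin.rev_lt_rev, Fin.rev_inj] using hdown
  have hef : e = f := by omega
  have hfg : f = g := by omega
  refine ⟨fun i => (i : ℝ), fun i j hij => Nat.cast_lt.2 hij, ?_, ?_, ?_⟩
  · rw [h₁.2.2 hef, hef]; ring
  · rw [h₂.2.2 hfg, hfg]; ring
  · rw [h₃.2.2 (hef.trans hfg).symm, hef, hfg]; ring

end Heights

section Heights

variable {E : Type*} {A : Finset E} {X : E → E → ℝ} {l : ℕ} {b : E → Fin l}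

/-- For each block `k` an affine function of the coordinates has the signs prescribed by the
block map. -/
def HasBlockSigns (A : Finset E) (X : E → E → ℝ) (b : E → Fin l) (p : Fin l → E → ℝ) : Prop :=
  ∀ k e, ((b e = k → p k e = 0) ∧ (b e < k → p k e < 0) ∧ (k < b e → 0 < p k e)) ∧
    p k e = ∑ a ∈ A, X e a * p k a

/-- Some strictly monotone heights of the blocks are affine in the coordinates. -/
def HasHeights (A : Finset E) (X : E → E → ℝ) (b : E → Fin l) : Prop :=
  ∃ val : Fin l → ℝ, StrictMono val ∧ ∀ e ∉ A, val (b e) = ∑ a ∈ A, X e a * val (b a)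

theorem HasBlockSigns.rev {p : Fin l → E → ℝ} (h : HasBlockSigns A X b p) :
    HasBlockSigns A X (fun e => (b e).rev) fun k e => -p k.rev e := by
  intro k e
  obtain ⟨⟨h1, h2, h3⟩, h4⟩ := h k.rev e
  refine ⟨⟨fun hk => ?_, fun hk => ?_, fun hk => ?_⟩, ?_⟩
  · simp only [h1 (Fin.rev_eq_iff.1 hk), neg_zero]
  · exact neg_neg_iff_pos.2 (h3 (Fin.rev_lt_iff.1 hk))
  · exact neg_pos.2 (h2 (Fin.lt_rev_iff.1 hk))
  · simp only [h4, mul_neg, sum_neg_distrib]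

theorem HasHeights.of_rev (h : HasHeights A X fun e => (b e).rev) : HasHeights A X b := by
  obtain ⟨val, hv, h⟩ := h
  refine ⟨fun i => -val i.rev, fun i j hij => neg_lt_neg (hv (Fin.rev_lt_rev.2 hij)),
    fun e he => ?_⟩
  dsimp only
  rw [h e he]
  simp

/-- Heights above block `k` can be stretched so that a point `y` whose position relative to
block `k` is known gets a prescribed height. -/
theorem exists_strictMono_sum_eq_of_signs {B : Finset E} {y p : E → ℝ} (hy : ∀ a ∈ B, 0 ≤ y a)
    (hy1 : ∑ a ∈ B, y a = 1) {k : Fin l}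
    (hp : ∀ e, (b e = k → p e = 0) ∧ (b e < k → p e < 0) ∧ (k < b e → 0 < p e))
    {v₀ : Fin l → ℝ} (hv₀ : StrictMono v₀) {T : ℝ}
    (h : ∑ a ∈ B, y a * p a = 0 ∧ T = v₀ k ∨ 0 < ∑ a ∈ B, y a * p a ∧ v₀ k < T) :
    ∃ v : Fin l → ℝ, StrictMono v ∧ (∀ i ≤ k, v i = v₀ i) ∧ ∑ a ∈ B, y a * v (b a) = T := by
  have hpos : ∀ a, 0 < p a → k < b a := fun a ha => by
    by_contra! hle
    rcases hle.eq_or_lt with h | h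
    · exact ha.ne' ((hp a).1 h)
    · exact ha.not_gt ((hp a).2.1 h)
  have hneg : ∀ a, p a < 0 → b a < k := fun a ha => by
    by_contra! hle
    rcases hle.eq_or_lt with h | h
    · exact ha.ne ((hp a).1 h.symm)
    · exact ha.not_gt ((hp a).2.2 h)
  have hle : ∀ a ∈ B, y a * v₀ (min (b a) k) ≤ y a * v₀ k := fun a ha =>
    mul_le_mul_of_nonneg_left (hv₀.monotone (min_le_right _ _)) (hy a ha)
  have hsum : ∑ a ∈ B, y a * v₀ k = v₀ k := by rw [← sum_mul, hy1, one_mul]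
  refine exists_strictMono_sum_eq B y b hy hv₀ k ?_
  rcases h with ⟨hY, rfl⟩ | ⟨hY, hT⟩
  · by_cases hex : ∃ a ∈ B, 0 < y a ∧ k < b a
    · refine Or.inl ⟨hex, ?_⟩
      obtain ⟨a, ha, hya, hka⟩ := hex
      obtain ⟨a', ha', hneg'⟩ : ∃ a' ∈ B, y a' * p a' < 0 := by
        by_contra! hcon
        exact (sum_pos' hcon ⟨a, ha, mul_pos hya ((hp a).2.2 hka)⟩).ne' hY
      have hya' : 0 < y a' := (hy a' ha').lt_of_ne fun h => by simp [← h] at hneg'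
      have hb : b a' < k := hneg a' (neg_of_mul_neg_right hneg' hya'.le)
      conv_rhs => rw [← hsum]
      refine sum_lt_sum hle ⟨a', ha', mul_lt_mul_of_pos_left (hv₀ ?_) hya'⟩
      exact (min_le_left _ _).trans_lt hb
    · push Not at hex
      refine Or.inr ?_
      have hnp : ∀ a ∈ B, y a * p a ≤ 0 := fun a ha => by
        rcases (hy a ha).eq_or_lt with h | h
        · simp [← h]
        · refine mul_nonpos_of_nonneg_of_nonpos h.le (not_lt.1 fun hlt => ?_)
          exact (hex a ha h).not_gt (hpos a hlt)
      have h0 := (sum_eq_zero_iff_of_nonpos hnp).1 hY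
      conv_rhs => rw [← hsum]
      refine sum_congr rfl fun a ha => ?_
      rcases mul_eq_zero.1 (h0 a ha) with h | h
      · simp [h]
      · congr 2
        rcases lt_trichotomy (b a) k with hlt | heq | hgt
        · exact absurd h ((hp a).2.1 hlt).ne
        · exact heq
        · exact absurd h ((hp a).2.2 hgt).ne'
  · refine Or.inl ⟨?_, (sum_le_sum hle).trans_lt (hsum.trans_lt hT)⟩
    by_contra! hcon
    refine hY.not_ge (sum_nonpos fun a ha => ?_)
    rcases (hy a ha).eq_or_lt with h | h
    · simp [← h]
    · refine mul_nonpos_of_nonneg_of_nonpos h.le (not_lt.1 fun hlt => ?_)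
      exact (hcon a ha h).not_gt (hpos a hlt)

namespace IsBarycentric

theorem hasHeights_of_isCyclicTriple (hX : IsBarycentric A X) {p : Fin l → E → ℝ}
    (hp : HasBlockSigns A X b p) {e f g a₁ a₂ a₃ : E} (h₁ : a₁ ∈ A) (h₂ : a₂ ∈ A) (h₃ : a₃ ∈ A)
    (hall : ∀ h ∉ A, h = e ∨ h = f ∨ h = g) (hc : IsCyclicTriple A X e f g a₁ a₂ a₃) :
    HasHeights A X b := by
  obtain ⟨P, Q, S, ⟨hP0, hP1⟩, ⟨hQ0, hQ1⟩, ⟨hS0, hS1⟩, hcoord⟩ := hc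
  have comb : ∀ {t : ℝ} {x y z : E}, (∀ c ∈ A, X y c = t * X x c + (1 - t) * X z c) →
      ∀ h : E → ℝ, ∑ a ∈ A, X y a * h a =
        t * ∑ a ∈ A, X x a * h a + (1 - t) * ∑ a ∈ A, X z a * h a := by
    intro t x y z hxyz h
    rw [mul_sum, mul_sum, ← sum_add_distrib]
    exact sum_congr rfl fun a ha => by rw [hxyz a ha]; ring
  have between : ∀ {t : ℝ} {x y z : E}, 0 < t → t < 1 →
      (∀ c ∈ A, X y c = t * X x c + (1 - t) * X z c) → IsBetweenBlocks (b x) (b y) (b z) := by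
    intro t x y z ht0 ht1 hxyz
    have h0 := comb hxyz (p (b y))
    rw [← (hp (b y) x).2, ← (hp (b y) y).2, ← (hp (b y) z).2, ((hp (b y) y).1).1 rfl] at h0
    obtain ⟨hx1, hx2, hx3⟩ := (hp (b y) x).1
    obtain ⟨hz1, hz2, hz3⟩ := (hp (b y) z).1
    have ht : 0 < 1 - t := by linarith
    refine ⟨fun h => ?_, fun h => ?_, fun h => ?_⟩
    · by_contra! hle
      have := mul_neg_of_pos_of_neg ht0 (hx2 h)
      rcases hle.eq_or_lt with hz | hz
      · rw [hz1 hz] at h0; linarith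
      · have := mul_neg_of_pos_of_neg ht (hz2 hz); linarith
    · by_contra! hle
      have := mul_pos ht0 (hx3 h)
      rcases hle.eq_or_lt with hz | hz
      · rw [hz1 hz.symm] at h0; linarith
      · have := mul_pos ht (hz3 hz); linarith
    · rw [hx1 h] at h0
      rcases lt_trichotomy (b z) (b y) with hz | hz | hz
      · have := mul_neg_of_pos_of_neg ht (hz2 hz); linarith
      · exact hz
      · have := mul_pos ht (hz3 hz); linarith
  have c1 := fun c hc => (hcoord c hc).1
  have c2 := fun c hc => (hcoord c hc).2.1
  have c3 := fun c hc => (hcoord c hc).2.2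
  obtain ⟨val, hv, v1, v2, v3⟩ := hasCyclicHeights hP0 hP1 hQ0 hQ1 hS0 hS1
    (between hP0 hP1 c1) (between hQ0 hQ1 c2) (between hS0 hS1 c3)
  have vert : ∀ a ∈ A, ∑ c ∈ A, X a c * val (b c) = val (b a) := fun a ha => by
    rw [sum_eq_single_of_mem a ha fun c hc hn => by rw [hX.ne a ha c hc hn.symm, zero_mul],
      hX.self a ha, one_mul]
  have u1 := comb c1 fun a => val (b a)
  have u2 := comb c2 fun a => val (b a)
  have u3 := comb c3 fun a => val (b a)
  rw [vert _ h₁] at u1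
  rw [vert _ h₂] at u2
  rw [vert _ h₃] at u3
  have hPQS : P * Q * S < 1 := by
    have h1 : P * Q < 1 := mul_lt_one_of_nonneg_of_lt_one_left hP0.le hP1 hQ1.le
    exact mul_lt_one_of_nonneg_of_lt_one_left (by positivity) h1 hS1.le
  have he : val (b e) = ∑ a ∈ A, X e a * val (b a) := by
    have : (1 - P * Q * S) * (val (b e) - ∑ a ∈ A, X e a * val (b a)) = 0 := by
      linear_combination v3 - u3 + S * (v2 - u2) + S * Q * (v1 - u1)
    rcases mul_eq_zero.1 this with h | h <;> linarith
  have hf : val (b f) = ∑ a ∈ A, X f a * val (b a) := by rw [v1, u1, he]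
  have hg : val (b g) = ∑ a ∈ A, X g a * val (b a) := by rw [v2, u2, hf]
  refine ⟨val, hv, fun h hh => ?_⟩
  rcases hall h hh with rfl | rfl | rfl
  exacts [he, hf, hg]

theorem hasHeights_of_propOff [Fintype E] (hX : IsBarycentric A X) {p : Fin l → E → ℝ}
    (hp : HasBlockSigns A X b p) {a₀ : E} (ha₀ : a₀ ∈ A)
    (hoff : ∀ e ∉ A, ∀ f ∉ A, PropOff A X e f a₀) : HasHeights A X b := by
  classical
  by_cases hne : ∃ e, e ∉ A
  swap
  · push Not at hne
    exact ⟨fun i => (i : ℝ), fun i j hij => Nat.cast_lt.2 hij, fun e he => absurd (hne e) he⟩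
  obtain ⟨e₀, he₀⟩ := hne
  have hsumB : ∀ e, ∑ a ∈ A.erase a₀, X e a = 1 - X e a₀ := fun e => by
    rw [eq_sub_iff_add_eq, sum_erase_add _ _ ha₀, hX.sum_eq_one]
  have htpos : ∀ e ∉ A, 0 < 1 - X e a₀ := fun e he => by
    obtain ⟨a, ha, hna, hpos⟩ := hX.exists_pos_off he ha₀
    rw [← hsumB]
    exact sum_pos' (fun a ha => hX.nonneg e a (mem_of_mem_erase ha))
      ⟨a, mem_erase.2 ⟨hna, ha⟩, hpos⟩
  obtain ⟨y, hy⟩ : ∃ y : E → ℝ, ∀ a, y a = X e₀ a / (1 - X e₀ a₀) := ⟨_, fun _ => rfl⟩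
  have hy0 : ∀ a ∈ A.erase a₀, 0 ≤ y a := fun a ha => by
    rw [hy]
    exact div_nonneg (hX.nonneg _ _ (mem_of_mem_erase ha)) (htpos e₀ he₀).le
  have hy1 : ∑ a ∈ A.erase a₀, y a = 1 := by
    simp only [hy]
    rw [← sum_div, hsumB, div_self (htpos e₀ he₀).ne']
  have hXy : ∀ e ∉ A, ∀ a ∈ A.erase a₀, X e a = (1 - X e a₀) * y a := fun e he a ha => by
    obtain ⟨hn, ha⟩ := mem_erase.1 ha
    have h1 : X e a * (1 - X e₀ a₀) = (1 - X e a₀) * X e₀ a := by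
      rw [← hsumB, ← hsumB, mul_sum, sum_mul]
      exact sum_congr rfl fun a' ha' =>
        hoff e he e₀ he₀ a ha a' (mem_of_mem_erase ha') hn (ne_of_mem_erase ha')
    rw [hy, mul_div_assoc', ← h1, mul_div_cancel_right₀ _ (htpos e₀ he₀).ne']
  have hcomb : ∀ e ∉ A, ∀ h : E → ℝ, ∑ a ∈ A, X e a * h a =
      X e a₀ * h a₀ + (1 - X e a₀) * ∑ a ∈ A.erase a₀, y a * h a := fun e he h => by
    rw [← add_sum_erase _ _ ha₀, mul_sum]
    congr 1
    exact sum_congr rfl fun a ha => by rw [hXy e he a ha]; ring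
  have main : ∀ {b : E → Fin l} {p : Fin l → E → ℝ}, HasBlockSigns A X b p →
      ∀ d ∉ A, (∀ e ∉ A, X d a₀ ≤ X e a₀) → b a₀ ≤ b d → HasHeights A X b := by
    intro b p hp d hd hmax hle
    have hpS : ∀ k, ∀ e ∉ A, p k e =
        X e a₀ * p k a₀ + (1 - X e a₀) * ∑ a ∈ A.erase a₀, y a * p k a := fun k e he => by
      rw [(hp k e).2, hcomb e he]
    have hsd := fun k e => (hp k e).1
    have hd0 := hpS (b d) d hd
    rw [(hsd (b d) d).1 rfl] at hd0
    have htd := htpos d hd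
    rcases hle.eq_or_lt with heq | hlt
    · have hY : ∑ a ∈ A.erase a₀, y a * p (b d) a = 0 := by
        rw [(hsd (b d) a₀).1 heq, mul_zero, zero_add] at hd0
        exact (mul_eq_zero.1 hd0.symm).resolve_left htd.ne'
      have hbe : ∀ e ∉ A, b e = b d := fun e he => by
        have h0 := hpS (b d) e he
        rw [(hsd (b d) a₀).1 heq, hY, mul_zero, mul_zero, add_zero] at h0
        rcases lt_trichotomy (b e) (b d) with h | h | h
        · exact absurd h0 ((hsd (b d) e).2.1 h).ne
        · exact h
        · exact absurd h0 ((hsd (b d) e).2.2 h).ne'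
      obtain ⟨v, hv, hvk, hvT⟩ := exists_strictMono_sum_eq_of_signs (v₀ := fun i => (i : ℝ))
        hy0 hy1 (hsd (b d)) (fun i j hij => Nat.cast_lt.2 hij) (Or.inl ⟨hY, rfl⟩)
      refine ⟨v, hv, fun e he => ?_⟩
      rw [hcomb e he fun a => v (b a), hvT, hbe e he, heq, hvk _ le_rfl]
      ring
    · have hlow : ∀ e ∉ A, b a₀ < b e := fun e he => by
        by_contra! hcon
        have ha : 0 ≤ p (b e) a₀ := by
          rcases hcon.eq_or_lt with h | h
          · exact ((hsd (b e) a₀).1 h.symm).ge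
          · exact ((hsd (b e) a₀).2.2 h).le
        have hpd := (hsd (b e) d).2.2 (hcon.trans_lt hlt)
        have h1 := hpS (b e) d hd
        have h2 := hpS (b e) e he
        rw [(hsd (b e) e).1 rfl] at h2
        have h3 := mul_pos (htpos e he) hpd
        have h4 := mul_nonneg (sub_nonneg.2 (hmax e he)) ha
        have h5 : (1 - X e a₀) * p (b e) d + (X e a₀ - X d a₀) * p (b e) a₀ = 0 := by
          linear_combination (1 - X e a₀) * h1 - (1 - X d a₀) * h2
        linarith
      have hYnn : ∀ e ∉ A, 0 ≤ ∑ a ∈ A.erase a₀, y a * p (b e) a := fun e he => by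
        have h2 := hpS (b e) e he
        rw [(hsd (b e) e).1 rfl] at h2
        by_contra! hneg
        have h3 := mul_neg_of_pos_of_neg (htpos e he) hneg
        have h4 := mul_nonpos_of_nonneg_of_nonpos (hX.nonneg e a₀ ha₀)
          ((hsd (b e) a₀).2.1 (hlow e he)).le
        linarith
      have hord : ∀ e ∉ A, ∀ f ∉ A, (b e = b f → X e a₀ = X f a₀) ∧
          (b e < b f → X f a₀ < X e a₀) := fun e he f hf => by
        have h1 := hpS (b e) f hf
        have h2 := hpS (b e) e he
        rw [(hsd (b e) e).1 rfl] at h2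
        have hneg : p (b e) a₀ - ∑ a ∈ A.erase a₀, y a * p (b e) a < 0 := by
          linarith [hYnn e he, (hsd (b e) a₀).2.1 (hlow e he)]
        have h3 : p (b e) f = (X f a₀ - X e a₀) *
            (p (b e) a₀ - ∑ a ∈ A.erase a₀, y a * p (b e) a) := by
          linear_combination h1 - h2
        refine ⟨fun h => ?_, fun h => ?_⟩
        · rw [(hsd (b e) f).1 h.symm] at h3
          have := (mul_eq_zero.1 h3.symm).resolve_right hneg.ne
          linarith
        · have := (hsd (b e) f).2.2 h
          rw [h3] at this
          have := neg_of_mul_pos_left this hneg.le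
          linarith
      have hself := hX.self a₀ ha₀
      obtain ⟨v₀, hv₀, hext⟩ := exists_strictMono_extension
        (fun i : {e // e = a₀ ∨ e ∉ A} => b i) (fun i => 1 - X i a₀) (by
          rintro ⟨e, rfl | he⟩ ⟨f, rfl | hf⟩
          · simp
          · exact ⟨fun h => absurd h (hlow f hf).ne, fun _ => by
              simpa [hself] using htpos f hf⟩
          · exact ⟨fun h => absurd h (hlow e he).ne', fun h => absurd h (hlow e he).not_gt⟩
          · exact ⟨fun h => by simp [(hord e he f hf).1 h],
              fun h => by simpa using (hord e he f hf).2 h⟩)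
      have hva : v₀ (b a₀) = 0 := by
        simpa [hself] using hext ⟨a₀, Or.inl rfl⟩
      have hve : ∀ e ∉ A, v₀ (b e) = 1 - X e a₀ := fun e he => hext ⟨e, Or.inr he⟩
      have hpa := (hsd (b d) a₀).2.1 hlt
      obtain ⟨v, hv, hvk, hvT⟩ := exists_strictMono_sum_eq_of_signs (T := 1)
        hy0 hy1 (hsd (b d)) hv₀ (by
          rw [hve d hd]
          rcases (hYnn d hd).eq_or_lt with h | h
          · rw [← h, mul_zero, add_zero] at hd0
            have := (mul_eq_zero.1 hd0.symm).resolve_right hpa.ne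
            exact Or.inl ⟨h.symm, by linarith⟩
          · refine Or.inr ⟨h, ?_⟩
            have h1 := mul_pos htd h
            have h2 : X d a₀ * p (b d) a₀ < 0 := by linarith
            have := pos_of_mul_neg_left h2 hpa.le
            linarith)
      refine ⟨v, hv, fun e he => ?_⟩
      have hed : b e ≤ b d := by
        by_contra! h
        exact ((hord d hd e he).2 h).not_ge (hmax e he)
      rw [hcomb e he fun a => v (b a), hvT, hvk _ hed, hve e he, hvk _ hlt.le, hva]
      ring
  obtain ⟨d, hd, hmax⟩ := (univ.filter (· ∉ A)).exists_min_image (fun e => X e a₀)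
    ⟨e₀, by simpa using he₀⟩
  simp only [mem_filter, mem_univ, true_and] at hd hmax
  rcases le_total (b a₀) (b d) with h | h
  · exact main hp d hd hmax h
  · exact (main hp.rev d hd hmax (Fin.rev_le_rev.2 h)).of_rev

theorem hasHeights [Fintype E] (hX : IsBarycentric A X)
    (hQ : ∀ e ∉ A, ∀ f ∉ A, e ≠ f → ∃ c ∈ A, PropOff A X e f c) {p : Fin l → E → ℝ}
    (hp : HasBlockSigns A X b p) : HasHeights A X b := by
  rcases hX.classification hQ with h | ⟨a, ha, h⟩ | ⟨e, f, g, a₁, a₂, a₃, h₁, h₂, h₃, hall, hc⟩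
  · exact ⟨fun i => (i : ℝ), fun i j hij => Nat.cast_lt.2 hij, fun e he => absurd (h e) he⟩
  · exact hX.hasHeights_of_propOff hp ha h
  · exact hX.hasHeights_of_isCyclicTriple hp h₁ h₂ h₃ hall hc

end IsBarycentric

end Heights

section Coherence

namespace IsSimplexFrame

variable {E : Type*} {V : Type*} [AddCommGroup V] [Module ℝ V] {w : E → V} {A : Finset E}
  {ξ : E → V →ₗ[ℝ] ℝ} {π : V →ₗ[ℝ] ℝ}

theorem isBarycentric (hF : IsSimplexFrame w A ξ) (hπ : ∀ e, π (w e) = 1)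
    (hw : Function.Injective w) : IsBarycentric A fun e a => ξ a (w e) where
  nonneg e a ha := hF.nonneg a ha e
  sum_eq_one := hF.sum_eq_one hπ
  inj _ _ h := hw (hF.eq_of_forall h)
  self := hF.self
  ne a ha c hc hn := hF.ne c hc a ha hn

theorem propOff_of_mem_span_pair (hF : IsSimplexFrame w A ξ) {e f c : E} (hc : c ∈ A)
    (h : w c ∈ Submodule.span ℝ {w e, w f}) : PropOff A (fun e a => ξ a (w e)) e f c := by
  obtain ⟨p, q, hpq⟩ := Submodule.mem_span_pair.1 h
  have h0 : ∀ a ∈ A, a ≠ c → p * ξ a (w e) + q * ξ a (w f) = 0 := fun a ha hn => by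
    have := congrArg (ξ a) hpq
    simpa [hF.ne a ha c hc hn.symm] using this
  intro a ha a' ha' hn hn'
  have h1 := h0 a ha hn
  have h2 := h0 a' ha' hn'
  dsimp only
  by_cases hp : p = 0
  · have hq : q ≠ 0 := by
      rintro rfl
      have := congrArg (ξ c) hpq
      simp [hp, hF.self c hc] at this
    simp only [hp, zero_mul, zero_add, mul_eq_zero, hq, false_or] at h1 h2
    rw [h1, h2, mul_zero, mul_zero]
  · refine mul_left_cancel₀ hp ?_
    linear_combination ξ a' (w f) * h1 - ξ a (w f) * h2

theorem allCoherent [Fintype E] [FiniteDimensional ℝ V] (hF : IsSimplexFrame w A ξ)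
    (hπ : ∀ e, π (w e) = 1) (hw : Function.Injective w)
    (hbig : ¬ HasBigString w (Module.finrank ℝ (Submodule.span ℝ (Set.range w)))) :
    AllCoherent w π := by
  rintro l b ⟨-, hb⟩
  choose φ hφ using hb
  have hX := hF.isBarycentric hπ hw
  obtain ⟨val, hv, hval⟩ := hX.hasHeights
    (fun e _ f _ hef => by
      obtain ⟨c, hc, hmem⟩ := hF.exists_mem_span_pair hπ hw hbig hef
      exact ⟨c, hc, hF.propOff_of_mem_span_pair hc hmem⟩)
    (b := b) (p := fun k e => φ k (w e)) fun k e => ⟨hφ k e, hF.apply_eq_sum (φ k) e⟩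
  have hψ : ∀ e, (∑ a ∈ A, val (b a) • ξ a) (w e) = val (b e) := fun e => by
    have hsum : (∑ a ∈ A, val (b a) • ξ a) (w e) = ∑ a ∈ A, ξ a (w e) * val (b a) := by
      simp [mul_comm]
    rw [hsum]
    by_cases he : e ∈ A
    · rw [sum_eq_single_of_mem e he fun a ha hn => by rw [hF.ne a ha e he hn.symm, zero_mul],
        hF.self e he, one_mul]
    · exact (hval e he).symm
  refine ⟨∑ a ∈ A, val (b a) • ξ a, fun e e' => ?_⟩
  rw [hψ, hψ, hπ, hπ, div_one, div_one]
  exact ⟨fun h => by rw [h], fun h => hv h⟩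

end IsSimplexFrame

theorem allCoherent_iff_of_forall_eq_one {E : Type*} [Fintype E] {V : Type*}
    [NormedAddCommGroup V] [NormedSpace ℝ V] [FiniteDimensional ℝ V] {w : E → V} {π : V →ₗ[ℝ] ℝ}
    (hπ : ∀ e, π (w e) = 1) (hw : Function.Injective w) :
    AllCoherent w π ↔
      ¬ HasBigString w (Module.finrank ℝ (Submodule.span ℝ (Set.range w))) := by
  refine ⟨fun h => h.not_hasBigString hπ, fun hbig => ?_⟩
  obtain ⟨A, ξ, hF⟩ := exists_isSimplexFrame hπ hw hbig
  exact hF.allCoherent hπ hw hbig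

section Rescale

variable {E : Type*} {V : Type*} [AddCommGroup V] [Module ℝ V] {c : E → ℝ}

theorem isCellularString_smul_iff (v : E → V) (hc : ∀ e, 0 < c e) {l : ℕ} {b : E → Fin l} :
    IsCellularString (fun e => c e • v e) l b ↔ IsCellularString v l b := by
  simp only [IsCellularString, map_smul, smul_eq_mul, mul_eq_zero, (hc _).ne', false_or,
    ← neg_pos, ← mul_neg, mul_pos_iff_of_pos_left (hc _)]

theorem isCoherent_smul_iff (v : E → V) (π : V →ₗ[ℝ] ℝ) (hc : ∀ e, 0 < c e) {l : ℕ}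
    {b : E → Fin l} : IsCoherent (fun e => c e • v e) π l b ↔ IsCoherent v π l b := by
  simp only [IsCoherent, map_smul, smul_eq_mul, mul_div_mul_left _ _ (hc _).ne']

theorem span_image_smul (v : E → V) (hc : ∀ e, 0 < c e) (s : Set E) :
    Submodule.span ℝ ((fun e => c e • v e) '' s) = Submodule.span ℝ (v '' s) := by
  refine le_antisymm (Submodule.span_le.2 ?_) (Submodule.span_le.2 ?_)
  · rintro _ ⟨e, he, rfl⟩
    exact Submodule.smul_mem _ _ (Submodule.subset_span ⟨e, he, rfl⟩)
  · rintro _ ⟨e, he, rfl⟩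
    rw [SetLike.mem_coe, ← inv_smul_smul₀ (hc e).ne' (v e)]
    exact Submodule.smul_mem _ _ (Submodule.subset_span ⟨e, he, rfl⟩)

theorem hasBigString_smul_iff [Fintype E] (v : E → V) (hc : ∀ e, 0 < c e) (r : ℕ) :
    HasBigString (fun e => c e • v e) r ↔ HasBigString v r := by
  have h := fun s => congrArg (fun p : Submodule ℝ V => Module.finrank ℝ p)
    (span_image_smul v hc s)
  simp only [HasBigString, isCellularString_smul_iff v hc, h]

end Rescale

end Coherence

/-- For a configuration `(v, π)` with nonzero, pairwise non-parallel
vectors and `r = dim span {v e}`, all-coherence holds iff there is no cellular string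
`(E_1, …, E_l)` with `l ≥ 2` and `∑ (dim span E_i − 1) ≥ r − 1`. -/
theorem statement0 {E : Type*} [Fintype E] {d : ℕ}
    (v : E → Fin d → ℝ) (π : (Fin d → ℝ) →ₗ[ℝ] ℝ)
    (hπ : ∀ e, 0 < π (v e))
    (hv : ∀ e, v e ≠ 0)
    (hpar : ∀ e e', e ≠ e' → ∀ c : ℝ, v e' ≠ c • v e)
    (r : ℕ) (hr : r = Module.finrank ℝ (Submodule.span ℝ (Set.range v))) :
    AllCoherent v π ↔
      ¬ ∃ (l : ℕ) (b : E → Fin l), IsCellularString v l b ∧ 2 ≤ l ∧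
        (r : ℤ) - 1 ≤ ∑ i : Fin l,
          ((Module.finrank ℝ (Submodule.span ℝ (v '' {e | b e = i})) : ℤ) - 1) := by
  have hc : ∀ e, 0 < (π (v e))⁻¹ := fun e => inv_pos.2 (hπ e)
  have h := allCoherent_iff_of_forall_eq_one (w := fun e => (π (v e))⁻¹ • v e) (π := π)
    (fun e => by rw [map_smul, smul_eq_mul, inv_mul_cancel₀ (hπ e).ne'])
    (fun e e' hee => by
      by_contra hne
      refine hpar e e' hne (π (v e') * (π (v e))⁻¹) ?_
      rw [mul_smul]
      exact (inv_smul_eq_iff₀ (hπ e').ne').1 hee.symm)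
  rw [← Set.image_univ, span_image_smul v hc, Set.image_univ, ← hr, hasBigString_smul_iff v hc]
    at h
  simpa only [AllCoherent, HasBigString, isCellularString_smul_iff v hc,
    isCoherent_smul_iff v π hc] using h
end

section
/- Let (v, π) and (v', π') be two configurations on the same finite index set E, with v : E → ℝ^d and v' : E → ℝ^{d'}, each having no zero vectors and no two parallel vectors. If v and v' have exactly the same set of signed circuits, then (v, π) is all-coherent if and only if (v', π') is all-coherent. -/
open Finset

/-- A sign vector `x : E → SignType` is a *signed circuit* of the vector family `v` if it is
the sign vector of a linear dependence with (nonempty) support minimal among supports of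
nontrivial linear dependences. -/
def IsSignedCircuit {E : Type*} [Fintype E] {V : Type*} [AddCommGroup V] [Module ℝ V]
    (v : E → V) (x : E → SignType) : Prop :=
  ∃ c : E → ℝ, ∑ e, c e • v e = 0 ∧ (∀ e, SignType.sign (c e) = x e) ∧
    {e | c e ≠ 0}.Nonempty ∧
    ∀ c' : E → ℝ, ∑ e, c' e • v e = 0 → {e | c' e ≠ 0}.Nonempty →
      ¬ {e | c' e ≠ 0} ⊂ {e | c e ≠ 0}

/-- Every sign vector of an element of `A` is the sign vector of an element of `B`. -/
def SignLE {ι : Type*} (A B : Submodule ℝ (ι → ℝ)) : Prop :=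
  ∀ x ∈ A, ∃ y ∈ B, ∀ i, SignType.sign (y i) = SignType.sign (x i)

theorem eq_zero_iff_of_sign_eq {a b : ℝ} (h : SignType.sign a = SignType.sign b) :
    a = 0 ↔ b = 0 := by
  rw [← sign_eq_zero_iff, h, sign_eq_zero_iff]

theorem pos_iff_of_sign_eq {a b : ℝ} (h : SignType.sign a = SignType.sign b) :
    0 < a ↔ 0 < b := by
  rw [← sign_eq_one_iff, h, sign_eq_one_iff]

theorem neg_iff_of_sign_eq {a b : ℝ} (h : SignType.sign a = SignType.sign b) :
    a < 0 ↔ b < 0 := by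
  rw [← sign_eq_neg_one_iff, h, sign_eq_neg_one_iff]

theorem sign_add_eq_of_conformal {a b a' b' : ℝ} (ha : 0 ≤ a * (a + b)) (hb : 0 ≤ b * (a + b))
    (hab : a + b = 0 → a = 0 ∧ b = 0)
    (ha' : SignType.sign a' = SignType.sign a) (hb' : SignType.sign b' = SignType.sign b) :
    SignType.sign (a' + b') = SignType.sign (a + b) := by
  have pa := pos_iff_of_sign_eq ha'
  have na := neg_iff_of_sign_eq ha'
  have pb := pos_iff_of_sign_eq hb'
  have nb := neg_iff_of_sign_eq hb'
  rcases lt_trichotomy (a + b) 0 with h | h | h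
  · have h1 : a ≤ 0 := nonpos_of_mul_nonneg_left ha h
    have h2 : b ≤ 0 := nonpos_of_mul_nonneg_left hb h
    rw [sign_neg h]
    grind [sign_neg]
  · obtain ⟨rfl, rfl⟩ := hab h
    rw [(eq_zero_iff_of_sign_eq ha').2 rfl, (eq_zero_iff_of_sign_eq hb').2 rfl]
  · have h1 : 0 ≤ a := nonneg_of_mul_nonneg_left ha h
    have h2 : 0 ≤ b := nonneg_of_mul_nonneg_left hb h
    rw [sign_pos h]
    grind [sign_pos]

/-- Moving from `x` against `z` until the first coordinate vanishes. -/
theorem exists_conformal_sub {ι : Type*} [Fintype ι] {x z : ι → ℝ}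
    (hz : ∀ i, x i = 0 → z i = 0) (hpos : ∃ i, 0 < z i * x i) :
    ∃ t : ℝ, 0 < t ∧ (∀ i, 0 ≤ (x i - t * z i) * x i) ∧
      {i | x i - t * z i ≠ 0} ⊂ {i | x i ≠ 0} := by
  obtain ⟨j, hj⟩ := hpos
  obtain ⟨m, -, hm⟩ := Finset.exists_max_image Finset.univ (fun i => z i / x i) ⟨j, by simp⟩
  have hratio : 0 < z m / x m := by
    refine lt_of_lt_of_le ?_ (hm j (by simp))
    rw [div_eq_mul_inv]
    rcases pos_and_pos_or_neg_and_neg_of_mul_pos hj with ⟨h, k⟩ | ⟨h, k⟩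
    · exact mul_pos h (inv_pos.2 k)
    · exact mul_pos_of_neg_of_neg h (inv_lt_zero.2 k)
  have hxm : x m ≠ 0 := fun h => by simp [h] at hratio
  have hzm : z m ≠ 0 := fun h => by simp [h] at hratio
  refine ⟨(z m / x m)⁻¹, inv_pos.2 hratio, fun i => ?_, ?_, fun hsub => ?_⟩
  · by_cases hx : x i = 0
    · simp [hx]
    · have h1 : (z m / x m)⁻¹ * (z i / x i) ≤ 1 := by
        rw [inv_mul_le_iff₀ hratio, mul_one]
        exact hm i (by simp)
      have h2 : (x i - (z m / x m)⁻¹ * z i) * x i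
          = (1 - (z m / x m)⁻¹ * (z i / x i)) * (x i * x i) := by
        field_simp
      rw [h2]
      exact mul_nonneg (sub_nonneg.2 h1) (mul_self_nonneg _)
  · intro i hi hx
    exact hi (by simp [hx, hz i hx])
  · exact hsub (show m ∈ {i | x i ≠ 0} from hxm) (by field_simp; ring)

/-- A vector which is not support-minimal in a subspace is a conformal sum of two vectors of
the subspace of strictly smaller support. -/
theorem exists_conformal_decomposition {ι : Type*} [Fintype ι] {A : Submodule ℝ (ι → ℝ)}
    {x z : ι → ℝ} (hx : x ∈ A) (hz : z ∈ A) (hz0 : {i | z i ≠ 0}.Nonempty)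
    (hsub : {i | z i ≠ 0} ⊂ {i | x i ≠ 0}) :
    ∃ a ∈ A, ∃ b ∈ A, x = a + b ∧ (∀ i, 0 ≤ a i * x i) ∧ (∀ i, 0 ≤ b i * x i) ∧
      {i | a i ≠ 0} ⊂ {i | x i ≠ 0} ∧ {i | b i ≠ 0} ⊂ {i | x i ≠ 0} := by
  have hzx : ∀ i, x i = 0 → z i = 0 := fun i h => by
    by_contra hne
    exact hsub.1 hne h
  wlog hpos : ∃ i, 0 < z i * x i generalizing z with H
  · refine H (z := -z) (A.neg_mem hz) (by simpa using hz0) (by simpa using hsub)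
      (by simpa using hzx) ?_
    obtain ⟨i, hi⟩ := hz0
    have : z i * x i ≠ 0 := mul_ne_zero hi (hsub.1 hi)
    push Not at hpos
    exact ⟨i, by simpa using lt_of_le_of_ne (hpos i) this⟩
  obtain ⟨t, ht, hta, hts⟩ := exists_conformal_sub hzx hpos
  by_cases hneg : ∃ i, 0 < (-z) i * x i
  · obtain ⟨s, hs, hsb, hss⟩ := exists_conformal_sub (z := -z) (by simpa using hzx) hneg
    have hst : 0 < s + t := add_pos hs ht
    refine ⟨(s / (s + t)) • (x - t • z), A.smul_mem _ (A.sub_mem hx (A.smul_mem _ hz)),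
      (t / (s + t)) • (x - s • (-z)),
      A.smul_mem _ (A.sub_mem hx (A.smul_mem _ (A.neg_mem hz))), ?_, fun i => ?_, fun i => ?_,
      ?_, ?_⟩
    · ext i
      simp
      field_simp
      ring
    · simpa [mul_assoc] using mul_nonneg (div_pos hs hst).le (hta i)
    · simpa [mul_assoc] using mul_nonneg (div_pos ht hst).le (hsb i)
    · simpa [hs.ne', hst.ne'] using hts
    · simpa [ht.ne', hst.ne'] using hss
  · push Not at hneg
    refine ⟨x - t • z, A.sub_mem hx (A.smul_mem _ hz), t • z, A.smul_mem _ hz, by simp,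
      fun i => by simpa using hta i, fun i => ?_, by simpa using hts, by simpa [ht.ne'] using hsub⟩
    have := hneg i
    simp only [Pi.neg_apply, neg_mul, neg_nonpos] at this
    simpa [mul_assoc] using mul_nonneg ht.le this

/-- To compare sign vectors of subspaces it suffices to consider vectors of minimal support. -/
theorem signLE_of_elementary {ι : Type*} [Fintype ι] {A B : Submodule ℝ (ι → ℝ)}
    (h : ∀ x ∈ A, {i | x i ≠ 0}.Nonempty →
      (∀ z ∈ A, {i | z i ≠ 0}.Nonempty → ¬ {i | z i ≠ 0} ⊂ {i | x i ≠ 0}) →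
      ∃ y ∈ B, ∀ i, SignType.sign (y i) = SignType.sign (x i)) :
    SignLE A B := by
  intro x
  induction hn : {i | x i ≠ 0}.ncard using Nat.strong_induction_on generalizing x with
  | _ n ih =>
    intro hx
    by_cases hx0 : {i | x i ≠ 0}.Nonempty
    · by_cases hmin : ∀ z ∈ A, {i | z i ≠ 0}.Nonempty → ¬ {i | z i ≠ 0} ⊂ {i | x i ≠ 0}
      · exact h x hx hx0 hmin
      · push Not at hmin
        obtain ⟨z, hz, hz0, hsub⟩ := hmin
        obtain ⟨a, ha, b, hb, rfl, hax, hbx, has, hbs⟩ :=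
          exists_conformal_decomposition hx hz hz0 hsub
        obtain ⟨a', ha', haa⟩ := ih _ (hn ▸ Set.ncard_lt_ncard has) a rfl ha
        obtain ⟨b', hb', hbb⟩ := ih _ (hn ▸ Set.ncard_lt_ncard hbs) b rfl hb
        exact ⟨a' + b', B.add_mem ha' hb', fun i =>
          sign_add_eq_of_conformal (hax i) (hbx i)
            (fun h0 => ⟨by_contra fun hne => has.1 hne h0, by_contra fun hne => hbs.1 hne h0⟩)
            (haa i) (hbb i)⟩
    · refine ⟨0, B.zero_mem, fun i => ?_⟩
      have : x i = 0 := by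
        by_contra hi
        exact hx0 ⟨i, hi⟩
      simp [this]

theorem SignLE.finrank_le {ι : Type*} [Fintype ι] {A B : Submodule ℝ (ι → ℝ)}
    (h : SignLE A B) : Module.finrank ℝ A ≤ Module.finrank ℝ B := by
  induction hn : Module.finrank ℝ B using Nat.strong_induction_on generalizing A B with
  | _ n ih =>
    by_cases hA : A = ⊥
    · rw [hA, finrank_bot]
      exact Nat.zero_le _
    · obtain ⟨x, hx, hx0⟩ := A.ne_bot_iff.1 hA
      obtain ⟨i, hi⟩ := Function.ne_iff.1 hx0
      obtain ⟨y, hy, hyx⟩ := h x hx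
      have hyi : y i ≠ 0 := fun h0 => hi ((eq_zero_iff_of_sign_eq (hyx i)).1 h0)
      let p : (ι → ℝ) →ₗ[ℝ] ℝ := LinearMap.proj i
      have hle : SignLE (A ⊓ LinearMap.ker p) (B ⊓ LinearMap.ker p) := by
        rintro u ⟨hu, hu0⟩
        obtain ⟨w, hw, hwu⟩ := h u hu
        exact ⟨w, ⟨hw, (eq_zero_iff_of_sign_eq (hwu i)).2 hu0⟩, hwu⟩
      have hlt : Module.finrank ℝ ↥(B ⊓ LinearMap.ker p) < Module.finrank ℝ B :=
        Submodule.finrank_lt_finrank_of_lt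
          (lt_of_le_of_ne inf_le_left fun he => hyi (he.ge hy).2)
      have hker := ih _ (hn ▸ hlt) hle rfl
      have hrank := (p.domRestrict A).finrank_range_add_finrank_ker
      have hrange : Module.finrank ℝ (LinearMap.range (p.domRestrict A)) ≤ 1 := by
        exact (Submodule.finrank_le _).trans (Module.finrank_self ℝ).le
      have hkereq : Module.finrank ℝ (LinearMap.ker (p.domRestrict A))
          = Module.finrank ℝ ↥(A ⊓ LinearMap.ker p) := by
        rw [LinearMap.ker_domRestrict]
        exact (Submodule.equivSubtypeMap _ _).finrank_eq.trans (by rw [Submodule.map_comap_subtype])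
      omega

theorem SignLE.map_restrict {ι : Type*} {A B : Submodule ℝ (ι → ℝ)} (h : SignLE A B)
    (s : Set ι) :
    SignLE (A.map (LinearMap.funLeft ℝ ℝ ((↑) : s → ι)))
      (B.map (LinearMap.funLeft ℝ ℝ ((↑) : s → ι))) := by
  rintro _ ⟨x, hx, rfl⟩
  obtain ⟨y, hy, hyx⟩ := h x hx
  exact ⟨_, ⟨y, hy, rfl⟩, fun i => hyx i⟩

/-- A strong map between realizable oriented matroids of the same rank is an isomorphism. -/
theorem SignLE.symm_of_finrank_le {ι : Type*} [Fintype ι] {A B : Submodule ℝ (ι → ℝ)}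
    (h : SignLE A B) (hr : Module.finrank ℝ B ≤ Module.finrank ℝ A) : SignLE B A := by
  refine signLE_of_elementary fun x hx hx0 hmin => ?_
  let ρ : (ι → ℝ) →ₗ[ℝ] ({i | x i = 0} → ℝ) := LinearMap.funLeft ℝ ℝ (↑)
  have hρ := (h.map_restrict {i | x i = 0}).finrank_le
  have hA := (ρ.domRestrict A).finrank_range_add_finrank_ker
  have hB := (ρ.domRestrict B).finrank_range_add_finrank_ker
  rw [LinearMap.range_domRestrict] at hA hB
  have hBpos : 0 < Module.finrank ℝ (LinearMap.ker (ρ.domRestrict B)) := by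
    refine (Module.finrank_pos_iff_exists_ne_zero (R := ℝ)
      (M := LinearMap.ker (ρ.domRestrict B))).2 ⟨⟨⟨x, hx⟩, ?_⟩, fun h0 => ?_⟩
    · ext i
      exact i.2
    · obtain ⟨i, hi⟩ := hx0
      exact hi (congrFun (congrArg Subtype.val (congrArg Subtype.val h0)) i)
  have hApos : 0 < Module.finrank ℝ (LinearMap.ker (ρ.domRestrict A)) := by
    have : Module.finrank ℝ (A.map ρ) ≤ Module.finrank ℝ (B.map ρ) := hρ
    omega
  obtain ⟨⟨⟨y, hy⟩, hyker⟩, hy0⟩ :=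
    (Module.finrank_pos_iff_exists_ne_zero (R := ℝ)
      (M := LinearMap.ker (ρ.domRestrict A))).1 hApos
  have hyZ : ∀ i, x i = 0 → y i = 0 := fun i hi => congrFun (LinearMap.mem_ker.1 hyker) ⟨i, hi⟩
  have hyne : ∃ j, y j ≠ 0 := by
    by_contra hall
    push Not at hall
    exact hy0 (Subtype.ext (Subtype.ext (funext hall)))
  obtain ⟨j, hj⟩ := hyne
  have hxj : x j ≠ 0 := fun h0 => hj (hyZ j h0)
  obtain ⟨w, hw, hwy⟩ := h y hy
  have hwj : w j ≠ 0 := fun h0 => hj ((eq_zero_iff_of_sign_eq (hwy j)).1 h0)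
  have hwZ : ∀ i, x i = 0 → w i = 0 := fun i hi => (eq_zero_iff_of_sign_eq (hwy i)).2 (hyZ i hi)
  -- `w` is proportional to `x`, by minimality of the support of `x`
  have hprop : ∀ i, x i = (x j / w j) * w i := by
    by_contra hne
    push Not at hne
    obtain ⟨k, hk⟩ := hne
    refine hmin (x - (x j / w j) • w) (B.sub_mem hx (B.smul_mem _ hw))
      ⟨k, by simpa [sub_eq_zero] using hk⟩ ⟨fun i hi hxi => hi ?_, fun hsub => ?_⟩
    · simp [hxi, hwZ i hxi]
    · exact hsub (show j ∈ {i | x i ≠ 0} from hxj) (by simp [hwj])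
  have hc : x j / w j ≠ 0 := div_ne_zero hxj hwj
  refine ⟨(x j / w j) • y, A.smul_mem _ hy, fun i => ?_⟩
  rw [hprop i, Pi.smul_apply, smul_eq_mul, sign_mul, sign_mul, hwy i]

section Configuration

variable {E : Type*} [Fintype E] {V : Type*} [AddCommGroup V] [Module ℝ V]

/-- The space of linear dependences of `v`. -/
noncomputable def dependences (v : E → V) : Submodule ℝ (E → ℝ) :=
  LinearMap.ker (Fintype.linearCombination ℝ v)

/-- The space of value vectors of linear functionals on `v`. -/
noncomputable def valueSpace {E V : Type*} [AddCommGroup V] [Module ℝ V] (v : E → V) :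
    Submodule ℝ (E → ℝ) :=
  LinearMap.range (LinearMap.pi fun e => Module.Dual.eval ℝ V (v e))

theorem mem_dependences {v : E → V} {c : E → ℝ} : c ∈ dependences v ↔ ∑ e, c e • v e = 0 := by
  simp [dependences, Fintype.linearCombination_apply]

theorem mem_valueSpace {E V : Type*} [AddCommGroup V] [Module ℝ V] {v : E → V} {x : E → ℝ} :
    x ∈ valueSpace v ↔ ∃ ψ : V →ₗ[ℝ] ℝ, ∀ e, ψ (v e) = x e := by
  simp only [valueSpace, LinearMap.mem_range, funext_iff]
  rfl

variable {V' : Type*} [AddCommGroup V'] [Module ℝ V']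

theorem signLE_dependences {v : E → V} {v' : E → V'}
    (h : ∀ x : E → SignType, IsSignedCircuit v x → IsSignedCircuit v' x) :
    SignLE (dependences v) (dependences v') := by
  refine signLE_of_elementary fun x hx hx0 hmin => ?_
  obtain ⟨c, hc, hcx, -⟩ := h (fun e => SignType.sign (x e))
    ⟨x, mem_dependences.1 hx, fun _ => rfl, hx0, fun c' hc' => hmin c' (mem_dependences.2 hc')⟩
  exact ⟨c, mem_dependences.2 hc, hcx⟩

/-- Sign vectors of dependences determine the sign vectors of linear functionals. -/
theorem signLE_valueSpace {v : E → V} {v' : E → V'}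
    (h : SignLE (dependences v') (dependences v)) : SignLE (valueSpace v) (valueSpace v') := by
  classical
  intro x hx
  obtain ⟨ψ, hψ⟩ := mem_valueSpace.1 hx
  by_contra hcon
  let O : Set (E → ℝ) := {z | ∀ e, x e ≠ 0 → 0 < z e * x e}
  let T : Submodule ℝ (E → ℝ) :=
    valueSpace v' ⊓ ⨅ e : {e // x e = 0}, LinearMap.ker (LinearMap.proj (R := ℝ) (e : E))
  have hT : ∀ z, z ∈ T ↔ z ∈ valueSpace v' ∧ ∀ e, x e = 0 → z e = 0 := by
    intro z
    simp [T, Submodule.mem_iInf]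
  have hOopen : IsOpen O := by
    have : O = ⋂ e, {z : E → ℝ | x e ≠ 0 → 0 < z e * x e} := by
      ext
      simp [O]
    rw [this]
    refine isOpen_iInter_of_finite fun e => ?_
    by_cases hxe : x e = 0
    · simp [hxe]
    · simp only [ne_eq, hxe, not_false_eq_true, forall_const]
      exact isOpen_lt (by fun_prop) (by fun_prop)
  have hOconv : Convex ℝ O := by
    intro z hz w hw a b ha hb hab e hxe
    have h1 := hz e hxe
    have h2 := hw e hxe
    have h3 : (a • z + b • w) e * x e = a * (z e * x e) + b * (w e * x e) := by
      simp
      ring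
    rw [h3]
    rcases ha.eq_or_lt with rfl | ha
    · have : b = 1 := by linarith
      simpa [this] using h2
    · exact add_pos_of_pos_of_nonneg (mul_pos ha h1) (mul_nonneg hb h2.le)
  have hdisj : Disjoint O (T : Set (E → ℝ)) := by
    rw [Set.disjoint_left]
    intro z hzO hzT
    obtain ⟨hzv, hz0⟩ := (hT z).1 hzT
    refine hcon ⟨z, hzv, fun e => ?_⟩
    by_cases hxe : x e = 0
    · rw [hxe, hz0 e hxe]
    · rcases pos_and_pos_or_neg_and_neg_of_mul_pos (hzO e hxe) with ⟨h1, h2⟩ | ⟨h1, h2⟩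
      · rw [sign_pos h1, sign_pos h2]
      · rw [sign_neg h1, sign_neg h2]
  obtain ⟨f, u, hfO, hfT⟩ := geometric_hahn_banach_open hOconv hOopen T.convex hdisj
  have hu : u ≤ 0 := by simpa using hfT 0 T.zero_mem
  have hfT0 : ∀ z ∈ T, f z = 0 := by
    intro z hz
    by_contra hne
    have := hfT (((u - 1) / f z) • z) (T.smul_mem _ hz)
    rw [map_smul, smul_eq_mul, div_mul_cancel₀ _ hne] at this
    linarith
  have hfneg : ∀ z ∈ O, f z < 0 := fun z hz => (hfO z hz).trans_le hu
  have hxO : x ∈ O := fun e he => mul_self_pos.2 he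
  let y : E → ℝ := fun e => f (Pi.single e 1)
  have hfy : ∀ z, f z = ∑ e, y e * z e := by
    intro z
    conv_lhs => rw [pi_eq_sum_univ' z]
    simp [y, map_sum, mul_comm]
  -- moving along a coordinate direction stays in `O` as long as it is conformal to `x`
  have hadd : ∀ e s, (x e ≠ 0 → 0 ≤ s * x e) → f x + s * y e < 0 := by
    intro e s hs
    have hmem : x + s • (Pi.single e 1 : E → ℝ) ∈ O := by
      intro i hi
      by_cases hie : i = e
      · subst hie
        have h1 : 0 < x i * x i := mul_self_pos.2 hi
        have h2 := hs hi
        have : (x + s • (Pi.single i 1 : E → ℝ)) i * x i = x i * x i + s * x i := by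
          simp
          ring
        rw [this]
        linarith
      · simpa [hie] using mul_self_pos.2 hi
    simpa [y] using hfneg _ hmem
  have hy0 : ∀ e, x e = 0 → y e = 0 := by
    intro e he
    by_contra hne
    have := hadd e (-f x / y e) (fun h => absurd he h)
    rw [div_mul_cancel₀ _ hne] at this
    linarith
  have hyx : ∀ e, y e * x e ≤ 0 := by
    intro e
    by_contra! hpos
    have hxe : x e ≠ 0 := fun h => by simp [h] at hpos
    have hfx := hfneg x hxO
    have := hadd e (-f x / (y e * x e) * x e) fun _ => by
      rw [mul_assoc]
      exact mul_nonneg (div_nonneg (by linarith) hpos.le) (mul_self_nonneg _)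
    rw [mul_assoc, mul_comm (x e) (y e), div_mul_cancel₀ _ hpos.ne'] at this
    linarith
  have hspan : ∑ e, y e • v' e ∈ Submodule.span ℝ (v' '' {e | x e = 0}) := by
    rw [← Subspace.forall_mem_dualAnnihilator_apply_eq_zero_iff]
    intro φ hφ
    rw [Submodule.mem_dualAnnihilator] at hφ
    have := hfT0 (fun e => φ (v' e)) ((hT _).2 ⟨mem_valueSpace.2 ⟨φ, fun _ => rfl⟩, fun e he =>
      hφ _ (Submodule.subset_span ⟨e, he, rfl⟩)⟩)
    rw [hfy] at this
    simpa using this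
  obtain ⟨g, hg0, hg⟩ : ∃ g : E → ℝ, (∀ e, x e ≠ 0 → g e = 0) ∧
      ∑ e, g e • v' e = ∑ e, y e • v' e := by
    obtain ⟨t, ht, c, hc⟩ := Submodule.mem_span_image_iff_exists_fun ℝ |>.1 hspan
    refine ⟨fun e => if h : e ∈ t then c ⟨e, h⟩ else 0, fun e he => dif_neg fun h => he (ht h), ?_⟩
    rw [← hc, ← Finset.sum_subset t.subset_univ fun e _ he => by simp [he], ← Finset.sum_coe_sort]
    exact Finset.sum_congr rfl fun e _ => by simp
  obtain ⟨w, hw, hwy⟩ := h (y - g) (mem_dependences.2 (by simp [sub_smul, hg]))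
  have hwx : ∑ e, w e * x e = 0 := by
    have := congrArg ψ (mem_dependences.1 hw)
    simpa [hψ] using this
  have hyw : ∀ e, x e ≠ 0 → SignType.sign (w e) = SignType.sign (y e) := fun e he => by
    rw [hwy e, Pi.sub_apply, hg0 e he, sub_zero]
  have hterm : ∀ e, w e * x e ≤ 0 ∧ (w e * x e = 0 → y e * x e = 0) := by
    intro e
    by_cases he : x e = 0
    · simp [he]
    · constructor
      · by_contra! hpos
        have hs : SignType.sign (y e * x e) = SignType.sign (w e * x e) := by
          rw [sign_mul, sign_mul, hyw e he]
        exact (hyx e).not_gt ((pos_iff_of_sign_eq hs).2 hpos)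
      · intro h0
        rw [(eq_zero_iff_of_sign_eq (hyw e he)).1 ((mul_eq_zero.1 h0).resolve_right he), zero_mul]
  have hall := (Finset.sum_eq_zero_iff_of_nonpos fun e _ => (hterm e).1).1 hwx
  have hfx := hfneg x hxO
  rw [hfy, Finset.sum_eq_zero fun e he => (hterm e).2 (hall e he)] at hfx
  exact lt_irrefl _ hfx

/-- The differences of the ratios `x e / p e`. -/
noncomputable def ratioDiff {E : Type*} (p : E → ℝ) : (E → ℝ) →ₗ[ℝ] (E × E → ℝ) :=
  LinearMap.pi fun a => (p a.1)⁻¹ • LinearMap.proj a.1 - (p a.2)⁻¹ • LinearMap.proj a.2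

theorem ratioDiff_apply {E : Type*} (p x : E → ℝ) (a : E × E) :
    ratioDiff p x a = x a.1 / p a.1 - x a.2 / p a.2 := by
  simp [ratioDiff, div_eq_inv_mul]

theorem mem_map_ratioDiff {E V : Type*} [AddCommGroup V] [Module ℝ V] {v : E → V} {p : E → ℝ}
    {y : E × E → ℝ} : y ∈ (valueSpace v).map (ratioDiff p) ↔
      ∃ ψ : V →ₗ[ℝ] ℝ, ∀ a : E × E, y a = ψ (v a.1) / p a.1 - ψ (v a.2) / p a.2 := by
  constructor
  · rintro ⟨x, hx, rfl⟩
    obtain ⟨ψ, hψ⟩ := mem_valueSpace.1 hx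
    exact ⟨ψ, fun a => by rw [ratioDiff_apply, hψ, hψ]⟩
  · rintro ⟨ψ, hψ⟩
    exact ⟨fun e => ψ (v e), mem_valueSpace.2 ⟨ψ, fun _ => rfl⟩,
      funext fun a => by rw [ratioDiff_apply, hψ]⟩

theorem finrank_map_ratioDiff [Nonempty E] {v : E → V} {π : V →ₗ[ℝ] ℝ} (hπ : ∀ e, 0 < π (v e)) :
    Module.finrank ℝ ((valueSpace v).map (ratioDiff fun e => π (v e))) + 1 =
      Module.finrank ℝ (valueSpace v) := by
  set D := ratioDiff fun e => π (v e)
  rw [← (D.domRestrict (valueSpace v)).finrank_range_add_finrank_ker,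
    LinearMap.range_domRestrict, Nat.add_left_cancel_iff, eq_comm]
  obtain ⟨e₀⟩ := ‹Nonempty E›
  have hmem : (fun e => π (v e)) ∈ valueSpace v := mem_valueSpace.2 ⟨π, fun _ => rfl⟩
  refine finrank_eq_one (R := ℝ) (M := LinearMap.ker (D.domRestrict (valueSpace v)))
    ⟨⟨fun e => π (v e), hmem⟩, ?_⟩ (fun h0 => ?_) ?_
  · ext a
    simp [D, ratioDiff_apply, (hπ _).ne']
  · exact (hπ e₀).ne' (congrFun (congrArg Subtype.val (congrArg Subtype.val h0)) e₀)
  · rintro ⟨⟨x, hx⟩, hker⟩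
    refine ⟨x e₀ / π (v e₀), Subtype.ext (Subtype.ext (funext fun e => ?_))⟩
    have h0 : D x (e₀, e) = 0 := congrFun (LinearMap.mem_ker.1 hker) (e₀, e)
    rw [ratioDiff_apply, sub_eq_zero] at h0
    have := (hπ e).ne'
    change x e₀ / π (v e₀) * π (v e) = x e
    rw [h0]
    field_simp

theorem IsCellularString.of_signLE {E V V' : Type*} [AddCommGroup V] [Module ℝ V]
    [AddCommGroup V'] [Module ℝ V'] {v : E → V} {v' : E → V'} {l : ℕ} {b : E → Fin l}
    (h : SignLE (valueSpace v) (valueSpace v')) (hb : IsCellularString v l b) :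
    IsCellularString v' l b := by
  refine ⟨hb.1, fun i => ?_⟩
  obtain ⟨φ, hφ⟩ := hb.2 i
  obtain ⟨y, hy, hyφ⟩ := h (fun e => φ (v e)) (mem_valueSpace.2 ⟨φ, fun _ => rfl⟩)
  obtain ⟨φ', hφ'⟩ := mem_valueSpace.1 hy
  refine ⟨φ', fun e => ?_⟩
  have hs := hyφ e
  rw [← hφ' e] at hs
  exact ⟨fun h => (eq_zero_iff_of_sign_eq hs).2 ((hφ e).1 h),
    fun h => (neg_iff_of_sign_eq hs).2 ((hφ e).2.1 h),
    fun h => (pos_iff_of_sign_eq hs).2 ((hφ e).2.2 h)⟩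

/-- The level sets of the ratios `ψ (v e) / π (v e)`, in increasing order, form a cellular
string. -/
theorem exists_isCellularString {v : E → V} {π : V →ₗ[ℝ] ℝ} (hπ : ∀ e, 0 < π (v e))
    (ψ : V →ₗ[ℝ] ℝ) :
    ∃ (l : ℕ) (b : E → Fin l), IsCellularString v l b ∧
      ∀ e e', b e < b e' ↔ ψ (v e) / π (v e) < ψ (v e') / π (v e') := by
  classical
  let r : E → ℝ := fun e => ψ (v e) / π (v e)
  let s : Finset ℝ := Finset.univ.image r
  let o := s.orderIsoOfFin rfl
  let b : E → Fin s.card := fun e => o.symm ⟨r e, Finset.mem_image_of_mem r (Finset.mem_univ e)⟩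
  have hlt : ∀ e e', b e < b e' ↔ r e < r e' := fun e e' => by
    simp only [b, OrderIso.lt_iff_lt, Subtype.mk_lt_mk]
  have hsurj : Function.Surjective b := fun i => by
    obtain ⟨e, -, he⟩ := Finset.mem_image.1 (o i).2
    exact ⟨e, by simp only [b, he, Subtype.coe_eta, OrderIso.symm_apply_apply]⟩
  refine ⟨s.card, b, ⟨hsurj, fun i => ?_⟩, hlt⟩
  obtain ⟨e₀, rfl⟩ := hsurj i
  have hval : ∀ e, (ψ - r e₀ • π) (v e) = (r e - r e₀) * π (v e) := fun e => by
    have := (hπ e).ne'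
    simp only [r, LinearMap.sub_apply, LinearMap.smul_apply, smul_eq_mul]
    field_simp
  refine ⟨ψ - r e₀ • π, fun e => ?_⟩
  rw [hval]
  refine ⟨fun h => ?_, fun h => ?_, fun h => ?_⟩
  · have h1 : ¬ r e < r e₀ := fun hr => ((hlt _ _).2 hr).ne h
    have h2 : ¬ r e₀ < r e := fun hr => ((hlt _ _).2 hr).ne' h
    rw [le_antisymm (not_lt.1 h2) (not_lt.1 h1), sub_self, zero_mul]
  · exact mul_neg_of_neg_of_pos (sub_neg.2 ((hlt _ _).1 h)) (hπ e)
  · exact mul_pos (sub_pos.2 ((hlt _ _).1 h)) (hπ e)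

theorem signLE_map_ratioDiff {v : E → V} {π : V →ₗ[ℝ] ℝ} {v' : E → V'} {π' : V' →ₗ[ℝ] ℝ}
    (hπ' : ∀ e, 0 < π' (v' e)) (h : SignLE (valueSpace v') (valueSpace v))
    (hall : AllCoherent v π) :
    SignLE ((valueSpace v').map (ratioDiff fun e => π' (v' e)))
      ((valueSpace v).map (ratioDiff fun e => π (v e))) := by
  intro y hy
  obtain ⟨ψ', hψ'⟩ := mem_map_ratioDiff.1 hy
  obtain ⟨l, b, hb, hlt⟩ := exists_isCellularString hπ' ψ'
  obtain ⟨ψ, hψ⟩ := hall l b (hb.of_signLE h)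
  refine ⟨_, mem_map_ratioDiff.2 ⟨ψ, fun _ => rfl⟩, fun a => ?_⟩
  rw [hψ' a]
  rcases lt_trichotomy (b a.1) (b a.2) with hab | hab | hab
  · rw [sign_neg (sub_neg.2 ((hψ _ _).2 hab)), sign_neg (sub_neg.2 ((hlt _ _).1 hab))]
  · have h1 := mt (hlt a.1 a.2).2 hab.not_lt
    have h2 := mt (hlt a.2 a.1).2 hab.not_gt
    rw [sub_eq_zero.2 ((hψ _ _).1 hab),
      sub_eq_zero.2 (le_antisymm (not_lt.1 h2) (not_lt.1 h1))]
  · rw [sign_pos (sub_pos.2 ((hψ _ _).2 hab)), sign_pos (sub_pos.2 ((hlt _ _).1 hab))]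

theorem AllCoherent.of_signLE {v : E → V} {π : V →ₗ[ℝ] ℝ} {v' : E → V'}
    {π' : V' →ₗ[ℝ] ℝ} (hπ : ∀ e, 0 < π (v e)) (hπ' : ∀ e, 0 < π' (v' e))
    (h : SignLE (valueSpace v) (valueSpace v')) (h' : SignLE (valueSpace v') (valueSpace v))
    (hall : AllCoherent v π) : AllCoherent v' π' := by
  intro l b hb
  rcases isEmpty_or_nonempty E with hE | hE
  · exact ⟨0, fun e => isEmptyElim e⟩
  have hrank := finrank_map_ratioDiff hπ
  have hrank' := finrank_map_ratioDiff hπ'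
  have hle := h.finrank_le
  obtain ⟨ψ, hψ⟩ := hall l b (hb.of_signLE h')
  obtain ⟨y, hy, hyψ⟩ := (signLE_map_ratioDiff hπ' h' hall).symm_of_finrank_le (by omega) _
    (mem_map_ratioDiff.2 ⟨ψ, fun _ => rfl⟩)
  obtain ⟨ψ', hψ'⟩ := mem_map_ratioDiff.1 hy
  refine ⟨ψ', fun e e' => ?_⟩
  have hs := hyψ (e, e')
  rw [hψ'] at hs
  exact ⟨fun hb => sub_eq_zero.1 ((eq_zero_iff_of_sign_eq hs).2 (sub_eq_zero.2 ((hψ e e').1 hb))),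
    fun hb => sub_neg.1 ((neg_iff_of_sign_eq hs).2 (sub_neg.2 ((hψ e e').2 hb)))⟩

end Configuration

/-- Two configurations on the same index set, with no zero vectors and no
parallel pairs, having the same signed circuits, are both all-coherent or both not. -/
theorem statement1 {E : Type*} [Fintype E] {d d' : ℕ}
    (v : E → Fin d → ℝ) (π : (Fin d → ℝ) →ₗ[ℝ] ℝ)
    (v' : E → Fin d' → ℝ) (π' : (Fin d' → ℝ) →ₗ[ℝ] ℝ)
    (hπ : ∀ e, 0 < π (v e)) (hπ' : ∀ e, 0 < π' (v' e))
    (hv : ∀ e, v e ≠ 0) (hv' : ∀ e, v' e ≠ 0)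
    (hpar : ∀ e e', e ≠ e' → ∀ c : ℝ, v e' ≠ c • v e)
    (hpar' : ∀ e e', e ≠ e' → ∀ c : ℝ, v' e' ≠ c • v' e)
    (hcirc : ∀ x : E → SignType, IsSignedCircuit v x ↔ IsSignedCircuit v' x) :
    AllCoherent v π ↔ AllCoherent v' π' := by
  have h := signLE_valueSpace (signLE_dependences fun x => (hcirc x).2)
  have h' := signLE_valueSpace (signLE_dependences fun x => (hcirc x).1)
  exact ⟨AllCoherent.of_signLE hπ hπ' h h', AllCoherent.of_signLE hπ' hπ h' h⟩
end

section
/- Let (v, π) and (v', π') be configurations on the same finite index set E, with v : E → ℝ^d and v' : E → ℝ^{d'}, each having no zero vectors and no two parallel vectors, and with dim span{v e : e ∈ E} = dim span{v' e : e ∈ E}. Suppose v' is a weak map image of v, i.e., for every signed circuit x of v there exists a signed circuit y of v' such that y(e) = x(e) for every e with y(e) ≠ 0. If (v, π) is all-coherent, then (v', π') is all-coherent. -/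
open Finset

section SmallPerturbation

/-- A sufficiently small perturbation only affects the signs of the vanishing entries. -/
theorem exists_pos_forall_sign_add_mul {ι : Type*} [Finite ι] (a b : ι → ℝ) :
    ∃ t : ℝ, 0 < t ∧ ∀ i, SignType.sign (a i + t * b i) =
      if a i ≠ 0 then SignType.sign (a i) else SignType.sign (b i) := by
  have key : ∀ i, ∀ᶠ t in nhdsWithin (0 : ℝ) (Set.Ioi 0), SignType.sign (a i + t * b i) =
      if a i ≠ 0 then SignType.sign (a i) else SignType.sign (b i) := by
    intro i
    have hlim : Filter.Tendsto (fun t : ℝ => a i + t * b i) (nhdsWithin 0 (Set.Ioi 0))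
        (nhds (a i)) := by
      have : Continuous fun t : ℝ => a i + t * b i := by fun_prop
      simpa using (this.tendsto 0).mono_left nhdsWithin_le_nhds
    rcases lt_trichotomy (a i) 0 with h | h | h
    · filter_upwards [hlim.eventually_lt_const h] with t ht
      simp [h.ne, sign_neg h, sign_neg ht]
    · filter_upwards [self_mem_nhdsWithin] with t ht
      have ht' : SignType.sign t = 1 := sign_pos ht
      simp [h, sign_mul, ht']
    · filter_upwards [hlim.eventually_const_lt h] with t ht
      simp [h.ne', sign_pos h, sign_pos ht]
  obtain ⟨t, ht, hpos⟩ := ((Filter.eventually_all.2 key).and self_mem_nhdsWithin).exists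
  exact ⟨t, hpos, ht⟩

end SmallPerturbation

section LinearRelations

variable {ι V : Type*} [Fintype ι] [AddCommGroup V] [Module ℝ V]

/-- A multiple of `g` can be subtracted from `a` so that a nonzero entry of `a` is cancelled
while no sign is reversed. -/
theorem exists_cancel_entry (a g : ι → ℝ) (hsupp : ∀ i, g i ≠ 0 → a i ≠ 0) (hg : ∃ i, g i ≠ 0) :
    ∃ t : ℝ, (∀ i, a i - t * g i ≠ 0 → SignType.sign (a i - t * g i) = SignType.sign (a i)) ∧
      ∃ i, a i ≠ 0 ∧ a i - t * g i = 0 := by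
  classical
  obtain ⟨i₀, hi₀⟩ := hg
  obtain ⟨m, hm, hmin⟩ := (univ.filter fun i => g i ≠ 0).exists_min_image
    (fun i => |a i / g i|) ⟨i₀, by simpa using hi₀⟩
  have hgm : g m ≠ 0 := by simpa using hm
  refine ⟨a m / g m, fun i hi => ?_, m, hsupp m hgm, by field_simp; simp⟩
  by_cases hgi : g i = 0
  · simp [hgi]
  have hle : |a m / g m * g i| ≤ |a i| := by
    have h := hmin i (by simpa using hgi)
    rw [abs_div (a i), le_div_iff₀ (abs_pos.2 hgi)] at h
    rwa [abs_mul]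
  generalize a m / g m * g i = z at hi hle
  rcases lt_trichotomy (a i) 0 with h | h | h
  · rw [abs_of_neg h] at hle
    have h1 := (abs_le.1 hle).1
    rw [sign_neg h, sign_neg (lt_of_le_of_ne (by linarith) hi)]
  · exact absurd h (hsupp i hgi)
  · rw [abs_of_pos h] at hle
    have h1 := (abs_le.1 hle).2
    rw [sign_pos h, sign_pos (lt_of_le_of_ne (by linarith) hi.symm)]

/-- The conformal form of Carathéodory's theorem for cones. -/
theorem exists_conformal_linearIndepOn (u : ι → V) (c : ι → ℝ) :
    ∃ c' : ι → ℝ, ∑ i, c' i • u i = ∑ i, c i • u i ∧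
      (∀ i, c' i ≠ 0 → SignType.sign (c' i) = SignType.sign (c i)) ∧
      LinearIndepOn ℝ u {i | c' i ≠ 0} := by
  classical
  let S : Set (ι → ℝ) := {c' | ∑ i, c' i • u i = ∑ i, c i • u i ∧
      ∀ i, c' i ≠ 0 → SignType.sign (c' i) = SignType.sign (c i)}
  obtain ⟨a, ⟨hsum, hsign⟩, hmin⟩ := (measure fun a : ι → ℝ => #{i | a i ≠ 0}).wf.has_min S
    ⟨c, rfl, fun _ _ => rfl⟩
  refine ⟨a, hsum, hsign, ?_⟩
  have hset : {i | a i ≠ 0} = ((univ.filter fun i => a i ≠ 0 : Finset ι) : Set ι) := by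
    ext; simp
  rw [hset]
  by_contra hdep
  obtain ⟨f, hf, j, hj, hfj⟩ := not_linearIndepOn_finset_iff.1 hdep
  obtain ⟨t, ht, m, ham, htm⟩ := exists_cancel_entry a (fun i => if a i ≠ 0 then f i else 0)
    (fun i hi h => hi (by simp [h])) ⟨j, by simpa [hfj] using hj⟩
  refine hmin (fun i => a i - t * if a i ≠ 0 then f i else 0) ⟨?_, fun i hi => ?_⟩ ?_
  · rw [Finset.sum_filter] at hf
    simp only [sub_smul, Finset.sum_sub_distrib, mul_smul, ← Finset.smul_sum, ite_smul, zero_smul,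
      hf, smul_zero, sub_zero, hsum]
  · rw [ht i hi]
    exact hsign i fun h => hi (by simp [h])
  · refine Finset.card_lt_card ((Finset.ssubset_iff_of_subset fun i hi => ?_).2 ⟨m, ?_, ?_⟩)
    · simp only [mem_filter, mem_univ, true_and] at hi ⊢
      exact fun h => hi (by simp [h])
    · simpa using ham
    · simpa using htm

/-- Every nontrivial linear relation is conformally above a signed circuit. -/
theorem exists_conformal_isSignedCircuit (v : ι → V) (a : ι → ℝ) (ha : ∑ i, a i • v i = 0)
    (hne : ∃ i, a i ≠ 0) :
    ∃ x : ι → SignType, IsSignedCircuit v x ∧ ∀ i, x i ≠ 0 → x i = SignType.sign (a i) := by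
  classical
  let S : Set (ι → ℝ) := {c | ∑ i, c i • v i = 0 ∧ (∃ i, c i ≠ 0) ∧
      ∀ i, c i ≠ 0 → SignType.sign (c i) = SignType.sign (a i)}
  obtain ⟨c, ⟨hsum, hc, hsign⟩, hmin⟩ := (measure fun c : ι → ℝ => #{i | c i ≠ 0}).wf.has_min S
    ⟨a, ha, hne, fun _ _ => rfl⟩
  refine ⟨fun i => SignType.sign (c i), ⟨c, hsum, fun _ => rfl, hc, ?_⟩,
    fun i hi => hsign i (by simpa using hi)⟩
  intro g hg hgne hss
  obtain ⟨t, ht, m, hcm, htm⟩ := exists_cancel_entry c g (fun i hi => hss.1 hi) hgne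
  refine hmin (fun i => c i - t * g i) ⟨?_, ?_, fun i hi => ?_⟩ ?_
  · simp only [sub_smul, Finset.sum_sub_distrib, mul_smul, ← Finset.smul_sum, hg, hsum,
      smul_zero, sub_zero]
  · obtain ⟨k, hk, hk'⟩ := Set.exists_of_ssubset hss
    have : g k = 0 := by simpa using hk'
    exact ⟨k, by simpa [this] using hk⟩
  · rw [ht i hi]
    refine hsign i fun h => hi ?_
    have : g i = 0 := by_contra fun hgi => hss.1 hgi h
    simp [h, this]
  · refine Finset.card_lt_card ((Finset.ssubset_iff_of_subset fun i hi => ?_).2 ⟨m, ?_, ?_⟩)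
    · simp only [mem_filter, mem_univ, true_and] at hi ⊢
      intro h
      have : g i = 0 := by_contra fun hgi => hss.1 hgi h
      exact hi (by simp [h, this])
    · simpa using hcm
    · simpa using htm

/-- A linearly independent family admits functionals with arbitrary prescribed values. -/
theorem LinearIndepOn.exists_dual_eq {κ : Type*} {u : κ → V} {s : Set κ}
    (hs : LinearIndepOn ℝ u s) (g : κ → ℝ) : ∃ ψ : V →ₗ[ℝ] ℝ, ∀ i ∈ s, ψ (u i) = g i := by
  let B := Module.Basis.span hs
  obtain ⟨ψ, hψ⟩ := (B.constr ℝ fun i : s => g i).exists_extend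
  refine ⟨ψ, fun i hi => ?_⟩
  have h := congrArg (fun f => f (B ⟨i, hi⟩)) hψ
  rw [LinearMap.comp_apply, Module.Basis.constr_basis, Submodule.subtype_apply] at h
  rwa [Module.Basis.coe_span_apply hs ⟨i, hi⟩] at h

/-- A family on which functionals realize all strict sign patterns is linearly independent. -/
theorem linearIndependent_of_forall_sign (u : ι → V)
    (h : ∀ s : ι → ℝ, (∀ i, s i ≠ 0) →
      ∃ ψ : V →ₗ[ℝ] ℝ, ∀ i, SignType.sign (ψ (u i)) = SignType.sign (s i)) :
    LinearIndependent ℝ u := by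
  classical
  rw [Fintype.linearIndependent_iff]
  intro a ha
  obtain ⟨ψ, hψ⟩ := h (fun i => if a i = 0 then 1 else a i) fun i => by
    by_cases hi : a i = 0 <;> simp [hi]
  have hpos : ∀ i, a i ≠ 0 → 0 < a i * ψ (u i) := fun i hi => by
    have := hψ i
    rw [if_neg hi] at this
    rw [← sign_eq_one_iff, sign_mul, this, ← sign_mul, sign_eq_one_iff]
    exact mul_self_pos.2 hi
  have hzero : ∑ i, a i * ψ (u i) = 0 := by
    simpa using congrArg ψ ha
  by_contra! hne
  obtain ⟨i, hi⟩ := hne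
  refine (Finset.sum_pos' (fun j _ => ?_) ⟨i, mem_univ i, hpos i hi⟩).ne' hzero
  by_cases hj : a j = 0
  · simp [hj]
  · exact (hpos j hj).le

end LinearRelations

section Separation

variable {ι V : Type*} [Fintype ι] [NormedAddCommGroup V] [NormedSpace ℝ V]

/-- **Gordan's theorem**. -/
theorem exists_forall_pos_or_exists_nonneg_relation (u : ι → V) :
    (∃ ψ : V →ₗ[ℝ] ℝ, ∀ i, 0 < ψ (u i)) ∨
      ∃ c : ι → ℝ, (∀ i, 0 ≤ c i) ∧ (∃ i, 0 < c i) ∧ ∑ i, c i • u i = 0 := by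
  classical
  by_cases h : (0 : V) ∈ convexHull ℝ (Set.range u)
  · right
    rw [convexHull_range_eq_exists_affineCombination] at h
    obtain ⟨s, w, hw, hw1, h⟩ := h
    rw [Finset.affineCombination_eq_linear_combination s u w hw1] at h
    refine ⟨fun i => if i ∈ s then w i else 0, fun i => ?_, ?_, ?_⟩
    · by_cases hi : i ∈ s
      · simpa [hi] using hw i hi
      · simp [hi]
    · by_contra! hle
      have : ∑ i ∈ s, w i ≤ 0 := Finset.sum_nonpos fun i hi => by simpa [hi] using hle i
      linarith
    · simpa [ite_smul] using h
  · left
    obtain ⟨f, r, h0, hf⟩ := geometric_hahn_banach_point_closed (convex_convexHull ℝ _)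
      ((Set.finite_range u).isClosed_convexHull ℝ) h
    refine ⟨f.toLinearMap, fun i => ?_⟩
    have h1 := hf (u i) (subset_convexHull ℝ _ ⟨i, rfl⟩)
    rw [map_zero] at h0
    exact h0.trans h1

/-- Gordan's theorem relative to a subspace. -/
theorem exists_forall_pos_or_exists_nonneg_mem (D : Submodule ℝ V) (u : ι → V) :
    (∃ ψ : V →ₗ[ℝ] ℝ, (∀ x ∈ D, ψ x = 0) ∧ ∀ i, 0 < ψ (u i)) ∨
      ∃ c : ι → ℝ, (∀ i, 0 ≤ c i) ∧ (∃ i, 0 < c i) ∧ ∑ i, c i • u i ∈ D := by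
  obtain ⟨g, hg⟩ := D.mkQ.exists_rightInverse_of_surjective D.range_mkQ
  have hinj : ∀ x, g x = 0 → x = 0 := fun x hx => by
    have := congrArg (fun f => f x) hg
    simpa [hx] using this.symm
  rcases exists_forall_pos_or_exists_nonneg_relation fun i => (g ∘ₗ D.mkQ) (u i) with
    ⟨ψ, hψ⟩ | ⟨c, hc, hc', hsum⟩
  · refine Or.inl ⟨ψ ∘ₗ g ∘ₗ D.mkQ, fun x hx => ?_, hψ⟩
    have : D.mkQ x = 0 := by simpa using hx
    simp only [LinearMap.comp_apply, this, map_zero]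
  · refine Or.inr ⟨c, hc, hc', ?_⟩
    simp only [← map_smul, ← map_sum, LinearMap.comp_apply] at hsum
    have := hinj _ hsum
    rwa [Submodule.mkQ_apply, Submodule.Quotient.mk_eq_zero] at this

end Separation

section StringHeight

variable {E V : Type*} [AddCommGroup V] [Module ℝ V]

/-- A height function on `E` whose level sets, in increasing order, form a cellular string. -/
def IsStringHeight (v : E → V) (f : E → ℝ) : Prop :=
  ∀ e, ∃ φ : V →ₗ[ℝ] ℝ, ∀ e', SignType.sign (φ (v e')) = SignType.sign (f e' - f e)

/-- The vector `v e` rescaled into the affine hyperplane `π = 1`. -/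
noncomputable def ratioPoint (v : E → V) (π : V →ₗ[ℝ] ℝ) (e : E) : V := (π (v e))⁻¹ • v e

theorem map_ratioPoint (v : E → V) (π ψ : V →ₗ[ℝ] ℝ) (e : E) :
    ψ (ratioPoint v π e) = ψ (v e) / π (v e) := by
  simp [ratioPoint, div_eq_inv_mul]

theorem IsCellularString.isStringHeight {v : E → V} {l : ℕ} {b : E → Fin l}
    (hb : IsCellularString v l b) : IsStringHeight v fun e => ((b e : ℕ) : ℝ) := by
  intro e
  obtain ⟨φ, hφ⟩ := hb.2 (b e)
  refine ⟨φ, fun e' => ?_⟩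
  rcases lt_trichotomy (b e') (b e) with h | h | h
  · have h' : ((b e' : ℕ) : ℝ) < (b e : ℕ) := by exact_mod_cast h
    rw [sign_neg ((hφ e').2.1 h), sign_neg (by linarith)]
  · simp [(hφ e').1 h, h]
  · have h' : ((b e : ℕ) : ℝ) < (b e' : ℕ) := by exact_mod_cast h
    rw [sign_pos ((hφ e').2.2 h), sign_pos (by linarith)]

/-- The order induced by a height function is encoded by its block map. -/
theorem exists_blockMap [Fintype E] (f : E → ℝ) : ∃ (l : ℕ) (b : E → Fin l), Function.Surjective b ∧
    ∀ e e', b e < b e' ↔ f e < f e' := by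
  classical
  let o := (univ.image f).orderIsoOfFin rfl
  refine ⟨_, fun e => o.symm ⟨f e, mem_image_of_mem f (mem_univ e)⟩, fun i => ?_, fun e e' => ?_⟩
  · obtain ⟨e, -, he⟩ := mem_image.1 (o i).2
    exact ⟨e, by rw [OrderIso.symm_apply_eq]; exact Subtype.ext he⟩
  · rw [OrderIso.lt_iff_lt, Subtype.mk_lt_mk]

/-- In an all-coherent configuration every height function of a cellular string is induced by
a single linear functional. -/
theorem AllCoherent.exists_sign_eq [Fintype E] {v : E → V} {π : V →ₗ[ℝ] ℝ} (h : AllCoherent v π)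
    {f : E → ℝ} (hf : IsStringHeight v f) :
    ∃ ψ : V →ₗ[ℝ] ℝ, ∀ e e', SignType.sign (ψ (ratioPoint v π e') - ψ (ratioPoint v π e)) =
      SignType.sign (f e' - f e) := by
  obtain ⟨l, b, hsurj, hb⟩ := exists_blockMap f
  have heq : ∀ e e', b e = b e' ↔ f e = f e' := fun e e' => by
    simp only [le_antisymm_iff, ← not_lt, hb]
  obtain ⟨ψ, hψ⟩ := h l b ⟨hsurj, fun i => by
    obtain ⟨e, rfl⟩ := hsurj i
    obtain ⟨φ, hφ⟩ := hf e
    refine ⟨φ, fun e' => ⟨fun h => ?_, fun h => ?_, fun h => ?_⟩⟩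
    · rw [← sign_eq_zero_iff, hφ, (heq _ _).1 h, sub_self, sign_zero]
    · rw [← sign_eq_neg_one_iff, hφ, sign_eq_neg_one_iff, sub_neg]
      exact (hb _ _).1 h
    · rw [← sign_eq_one_iff, hφ, sign_eq_one_iff, sub_pos]
      exact (hb _ _).1 h⟩
  refine ⟨ψ, fun e e' => ?_⟩
  rw [map_ratioPoint, map_ratioPoint]
  rcases lt_trichotomy (f e) (f e') with h | h | h
  · rw [sign_pos (sub_pos.2 h), sign_pos (sub_pos.2 ((hψ e e').2 ((hb _ _).2 h)))]
  · rw [(hψ e e').1 ((heq _ _).2 h), h, sub_self, sub_self]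
  · rw [sign_neg (sub_neg.2 h), sign_neg (sub_neg.2 ((hψ e' e).2 ((hb _ _).2 h)))]

theorem IsStringHeight.mul_left {v : E → V} {f : E → ℝ} (hf : IsStringHeight v f) (c : ℝ) :
    IsStringHeight v fun e => c * f e := by
  intro e
  obtain ⟨φ, hφ⟩ := hf e
  refine ⟨c • φ, fun e' => ?_⟩
  rw [LinearMap.smul_apply, smul_eq_mul, sign_mul, hφ, ← sign_mul, mul_sub]

/-- Two heights can be combined lexicographically. -/
theorem IsStringHeight.exists_lex [Finite E] {v : E → V} {f g : E → ℝ}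
    (hf : IsStringHeight v f) (hg : IsStringHeight v g) :
    ∃ h, IsStringHeight v h ∧ ∀ e e', SignType.sign (h e' - h e) =
      if f e' - f e ≠ 0 then SignType.sign (f e' - f e) else SignType.sign (g e' - g e) := by
  choose φ hφ using hf
  choose ψ hψ using hg
  obtain ⟨t, -, ht⟩ := exists_pos_forall_sign_add_mul
    (Sum.elim (fun k : E × E => f k.2 - f k.1) fun k : E × E => φ k.1 (v k.2))
    (Sum.elim (fun k : E × E => g k.2 - g k.1) fun k : E × E => ψ k.1 (v k.2))
  have hlex : ∀ e e', SignType.sign ((f e' + t * g e') - (f e + t * g e)) =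
      if f e' - f e ≠ 0 then SignType.sign (f e' - f e) else SignType.sign (g e' - g e) := by
    intro e e'
    have h : SignType.sign (f e' - f e + t * (g e' - g e)) = if f e' - f e ≠ 0 then
        SignType.sign (f e' - f e) else SignType.sign (g e' - g e) := ht (Sum.inl (e, e'))
    rw [← h]
    congr 1
    ring
  refine ⟨fun e => f e + t * g e, fun e => ⟨φ e + t • ψ e, fun e' => ?_⟩, hlex⟩
  have h : SignType.sign (φ e (v e') + t * ψ e (v e')) = if φ e (v e') ≠ 0 then
      SignType.sign (φ e (v e')) else SignType.sign (ψ e (v e')) := ht (Sum.inr (e, e'))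
  have hne : φ e (v e') ≠ 0 ↔ f e' - f e ≠ 0 := by
    rw [← sign_ne_zero, hφ, sign_ne_zero]
  rw [hlex, LinearMap.add_apply, LinearMap.smul_apply, smul_eq_mul, h, hφ, hψ]
  simp only [hne]

/-- Linear functionals induce heights of (coherent) cellular strings. -/
theorem isStringHeight_dual {v : E → V} {π : V →ₗ[ℝ] ℝ} (hπ : ∀ e, 0 < π (v e))
    (ψ : V →ₗ[ℝ] ℝ) : IsStringHeight v fun e => ψ (ratioPoint v π e) := by
  intro e
  refine ⟨ψ - ψ (ratioPoint v π e) • π, fun e' => ?_⟩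
  have h : (ψ - ψ (ratioPoint v π e) • π) (v e') =
      π (v e') * (ψ (ratioPoint v π e') - ψ (ratioPoint v π e)) := by
    rw [map_ratioPoint v π ψ e', LinearMap.sub_apply, LinearMap.smul_apply, smul_eq_mul]
    have := (hπ e').ne'
    field_simp
  rw [h, sign_mul, sign_pos (hπ e'), one_mul]

/-- Without parallel vectors, some linear functional separates all the ratio points. -/
theorem exists_dual_injective [Finite E] {v : E → V} {π : V →ₗ[ℝ] ℝ} (hπ : ∀ e, 0 < π (v e))
    (hpar : ∀ e e', e ≠ e' → ∀ c : ℝ, v e' ≠ c • v e) :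
    ∃ ψ : V →ₗ[ℝ] ℝ, Function.Injective fun e => ψ (ratioPoint v π e) := by
  obtain ⟨ψ, hψ⟩ := Module.exists_dual_forall_apply_ne_zero (K := ℝ)
    (fun k : {k : E × E // k.1 ≠ k.2} => ratioPoint v π k.1.2 - ratioPoint v π k.1.1) fun k hk => by
      refine hpar k.1.1 k.1.2 k.2 (π (v k.1.2) * (π (v k.1.1))⁻¹) ?_
      have h := congrArg (fun x => π (v k.1.2) • x) (sub_eq_zero.1 hk)
      simpa only [ratioPoint, smul_smul, mul_inv_cancel₀ (hπ _).ne', one_smul] using h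
  refine ⟨ψ, fun e e' h => by_contra fun hne => hψ ⟨(e, e'), hne⟩ ?_⟩
  rw [map_sub, sub_eq_zero]
  exact h.symm

end StringHeight

section WeakMap

variable {E V V' : Type*} [Fintype E] [NormedAddCommGroup V] [NormedSpace ℝ V]
  [AddCommGroup V'] [Module ℝ V']

/-- Topes of a weak map image are topes of the original configuration. -/
theorem exists_dual_sign_eq_of_weakMap {v : E → V} {v' : E → V'} [Nonempty E]
    (hweak : ∀ x : E → SignType, IsSignedCircuit v x →
      ∃ y : E → SignType, IsSignedCircuit v' y ∧ ∀ e, y e ≠ 0 → y e = x e)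
    (φ' : V' →ₗ[ℝ] ℝ) (hφ' : ∀ e, φ' (v' e) ≠ 0) :
    ∃ φ : V →ₗ[ℝ] ℝ, ∀ e, SignType.sign (φ (v e)) = SignType.sign (φ' (v' e)) := by
  rcases exists_forall_pos_or_exists_nonneg_relation fun e => φ' (v' e) • v e with
    ⟨ψ, hψ⟩ | ⟨c, hc, ⟨k, hk⟩, hsum⟩
  · refine ⟨ψ, fun e => ?_⟩
    have h := hψ e
    rw [map_smul, smul_eq_mul] at h
    rcases lt_or_gt_of_ne (hφ' e) with h' | h'
    · rw [sign_neg h', sign_neg (neg_of_mul_pos_right h h'.le)]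
    · rw [sign_pos h', sign_pos (pos_of_mul_pos_right h h'.le)]
  · exfalso
    simp only [smul_smul] at hsum
    obtain ⟨x, hx, hxa⟩ := exists_conformal_isSignedCircuit v _ hsum
      ⟨k, mul_ne_zero hk.ne' (hφ' k)⟩
    obtain ⟨y, ⟨a, ha, hay, ⟨m, hm⟩, -⟩, hyx⟩ := hweak x hx
    have hpos : ∀ e, a e ≠ 0 → 0 < a e * φ' (v' e) := fun e he => by
      have hy : y e ≠ 0 := by rwa [← hay, sign_ne_zero]
      have hxe : x e = SignType.sign (c e * φ' (v' e)) := hxa e (hyx e hy ▸ hy)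
      have hce : 0 < c e := (hc e).lt_of_ne' fun h => hy (by rw [hyx e hy, hxe, h]; simp)
      rw [← sign_eq_one_iff, sign_mul, hay, hyx e hy, hxe, sign_mul, sign_pos hce, one_mul,
        ← sign_mul, sign_eq_one_iff]
      exact mul_self_pos.2 (hφ' e)
    have hzero : ∑ e, a e * φ' (v' e) = 0 := by simpa using congrArg φ' ha
    refine (Finset.sum_pos' (fun e _ => ?_) ⟨m, mem_univ m, hpos m hm⟩).ne' hzero
    by_cases he : a e = 0
    · simp [he]
    · exact (hpos e he).le

/-- Height functions of cellular strings with singleton blocks lift along weak maps. -/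
theorem IsStringHeight.of_weakMap {v : E → V} {v' : E → V'} {π' : V' →ₗ[ℝ] ℝ}
    (hπ' : ∀ e, 0 < π' (v' e))
    (hweak : ∀ x : E → SignType, IsSignedCircuit v x →
      ∃ y : E → SignType, IsSignedCircuit v' y ∧ ∀ e, y e ≠ 0 → y e = x e)
    {f : E → ℝ} (hinj : Function.Injective f) (hf : IsStringHeight v' f) :
    IsStringHeight v f := by
  intro e
  have : Nonempty E := ⟨e⟩
  obtain ⟨φ', hφ'⟩ := hf e
  have hzero : ∀ e', φ' (v' e') = 0 ↔ e' = e := fun e' => by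
    rw [← sign_eq_zero_iff, hφ', sign_eq_zero_iff, sub_eq_zero, hinj.eq_iff]
  have key : ∀ s : ℝ, s ≠ 0 → ∃ φ : V →ₗ[ℝ] ℝ, SignType.sign (φ (v e)) = SignType.sign s ∧
      ∀ e' ≠ e, SignType.sign (φ (v e')) = SignType.sign (f e' - f e) := by
    intro s hs
    obtain ⟨t, ht, hsign⟩ := exists_pos_forall_sign_add_mul (fun e' => φ' (v' e'))
      fun e' => s * π' (v' e')
    have happ : ∀ e', (φ' + (t * s) • π') (v' e') = φ' (v' e') + t * (s * π' (v' e')) :=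
      fun e' => by
        rw [LinearMap.add_apply, LinearMap.smul_apply, smul_eq_mul, mul_assoc]
    have hat : SignType.sign ((φ' + (t * s) • π') (v' e)) = SignType.sign s := by
      rw [happ, hsign, if_neg (by simp [hzero]), sign_mul, sign_pos (hπ' e), mul_one]
    have hoff : ∀ e' ≠ e, SignType.sign ((φ' + (t * s) • π') (v' e')) =
        SignType.sign (f e' - f e) := fun e' he' => by
      rw [happ, hsign, if_pos (by simp [hzero, he']), hφ']
    obtain ⟨φ, hφ⟩ := exists_dual_sign_eq_of_weakMap hweak (φ' + (t * s) • π') fun e' => by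
      rw [← sign_ne_zero]
      by_cases he' : e' = e
      · rw [he', hat, sign_ne_zero]
        exact hs
      · rw [hoff e' he', sign_ne_zero, sub_ne_zero, hinj.ne_iff]
        exact he'
    exact ⟨φ, (hφ e).trans hat, fun e' he' => (hφ e').trans (hoff e' he')⟩
  obtain ⟨φ, hφe, hφ⟩ := key 1 one_ne_zero
  obtain ⟨ψ, hψe, hψ⟩ := key (-1) (by norm_num)
  have hφpos : 0 < φ (v e) := by
    rw [← sign_eq_one_iff, hφe, sign_one]
  have hψneg : ψ (v e) < 0 := by
    rw [← sign_eq_neg_one_iff, hψe, Left.sign_neg, sign_one]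
  refine ⟨(-ψ (v e)) • φ + φ (v e) • ψ, fun e' => ?_⟩
  rw [LinearMap.add_apply, LinearMap.smul_apply, LinearMap.smul_apply, smul_eq_mul, smul_eq_mul]
  by_cases he' : e' = e
  · rw [he', sub_self]
    congr 1
    ring
  have h1 := hφ e' he'
  have h2 := hψ e' he'
  rcases lt_trichotomy (f e' - f e) 0 with h | h | h
  · rw [sign_neg h] at h1 h2 ⊢
    rw [sign_eq_neg_one_iff] at h1 h2 ⊢
    nlinarith
  · exact absurd (hinj (sub_eq_zero.1 h)) he'
  · rw [sign_pos h] at h1 h2 ⊢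
    rw [sign_eq_one_iff] at h1 h2 ⊢
    nlinarith

end WeakMap

section Differences

variable {E V : Type*}

/-- The difference of the points of `p` indexed by an ordered pair. -/
def pairDiff [AddCommGroup V] (p : E → V) (k : E × E) : V := p k.2 - p k.1

/-- The span of the differences within the level sets of `f` equals their conical hull. -/
theorem exists_nonneg_sum_pairDiff_eq [Fintype E] [AddCommGroup V] [Module ℝ V] (p : E → V)
    (f : E → ℝ) {x : V} (hx : x ∈ Submodule.span ℝ (pairDiff p '' {k | f k.1 = f k.2})) :
    ∃ c : E × E → ℝ, (∀ k, 0 ≤ c k) ∧ (∀ k, c k ≠ 0 → f k.1 = f k.2) ∧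
      ∑ k, c k • pairDiff p k = x := by
  classical
  induction hx using Submodule.span_induction with
  | mem x hx =>
    obtain ⟨k, hk, rfl⟩ := hx
    refine ⟨Pi.single k 1, fun m => ?_, fun m hm => ?_, ?_⟩
    · by_cases h : m = k <;> simp [h]
    · by_cases h : m = k
      · exact h ▸ hk
      · simp [h] at hm
    · simp [Pi.single_apply]
  | zero => exact ⟨0, by simp, by simp, by simp⟩
  | add x y _ _ hx hy =>
    obtain ⟨c, hc, hcf, rfl⟩ := hx
    obtain ⟨d, hd, hdf, rfl⟩ := hy
    refine ⟨c + d, fun k => add_nonneg (hc k) (hd k), fun k hk => ?_, ?_⟩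
    · by_cases h : c k = 0
      · exact hdf k fun h' => hk (by simp [h, h'])
      · exact hcf k h
    · simp [add_smul, Finset.sum_add_distrib]
  | smul r x _ hx =>
    obtain ⟨c, hc, hcf, rfl⟩ := hx
    rcases le_total 0 r with hr | hr
    · exact ⟨fun k => r * c k, fun k => mul_nonneg hr (hc k),
        fun k hk => hcf k (right_ne_zero_of_mul hk), by simp only [mul_smul, Finset.smul_sum]⟩
    · refine ⟨fun k => -r * c k.swap, fun k => mul_nonneg (neg_nonneg.2 hr) (hc _),
        fun k hk => (hcf k.swap (right_ne_zero_of_mul hk)).symm, ?_⟩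
      rw [Finset.smul_sum, ← (Equiv.prodComm E E).sum_comp]
      refine Finset.sum_congr rfl fun k _ => ?_
      simp only [Equiv.prodComm_apply, Prod.swap_swap, pairDiff, Prod.fst_swap, Prod.snd_swap,
        mul_smul, neg_smul, ← smul_neg, neg_sub]

variable [Fintype E]

/-- A weak order on points either is induced by a linear functional, or is obstructed by a
positive relation between differences that are independent apart from one strict one. -/
theorem exists_dual_sign_or_exists_relation [NormedAddCommGroup V] [NormedSpace ℝ V]
    (p : E → V) (f : E → ℝ) :
    (∃ ψ : V →ₗ[ℝ] ℝ, ∀ e e', SignType.sign (ψ (p e') - ψ (p e)) = SignType.sign (f e' - f e)) ∨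
      ∃ (j : E × E) (c : E × E → ℝ) (a : ℝ), f j.1 < f j.2 ∧ 0 < a ∧ (∀ k, 0 ≤ c k) ∧
        (∀ k, c k ≠ 0 → f k.1 ≤ f k.2) ∧ LinearIndepOn ℝ (pairDiff p) {k | c k ≠ 0} ∧
        ∑ k, c k • pairDiff p k = -(a • pairDiff p j) := by
  classical
  rcases exists_forall_pos_or_exists_nonneg_mem
    (Submodule.span ℝ (pairDiff p '' {k | f k.1 = f k.2}))
    (fun k : {k : E × E // f k.1 < f k.2} => pairDiff p k) with
    ⟨ψ, hψ, hpos⟩ | ⟨w, hw, ⟨j, hj⟩, hmem⟩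
  · refine Or.inl ⟨ψ, fun e e' => ?_⟩
    rw [← map_sub]
    rcases lt_trichotomy (f e) (f e') with h | h | h
    · rw [sign_pos (sub_pos.2 h)]
      exact sign_pos (hpos ⟨(e, e'), h⟩)
    · rw [h, sub_self, sign_zero, sign_eq_zero_iff]
      exact hψ _ (Submodule.subset_span ⟨(e, e'), h, rfl⟩)
    · have h' : 0 < ψ (p e - p e') := hpos ⟨(e', e), h⟩
      rw [sign_neg (sub_neg.2 h), ← neg_sub (p e), map_neg, sign_neg (neg_neg_of_pos h')]
  · right
    obtain ⟨d, hd, hdf, hsum⟩ := exists_nonneg_sum_pairDiff_eq p f (neg_mem hmem)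
    let g : E × E → ℝ := fun k => (if h : f k.1 < f k.2 then w ⟨k, h⟩ else 0) + d k
    have hg : ∀ k, 0 ≤ g k := fun k => by
      refine add_nonneg ?_ (hd k)
      split_ifs with h
      · exact hw _
      · exact le_rfl
    have hgf : ∀ k, g k ≠ 0 → f k.1 ≤ f k.2 := fun k hk => by
      by_contra hlt
      refine hk ?_
      have hdk : d k = 0 := by_contra fun h => hlt (hdf k h).le
      simp only [g, dif_neg (mt le_of_lt hlt), hdk, add_zero]
    have hgsum : ∑ k, g k • pairDiff p k = 0 := by
      simp only [g, add_smul, Finset.sum_add_distrib, hsum]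
      rw [add_neg_eq_zero, ← Finset.sum_filter_of_ne (p := fun k => f k.1 < f k.2),
        Finset.sum_subtype _ (p := fun k => f k.1 < f k.2) (by simp)]
      · exact Finset.sum_congr rfl fun k _ => by rw [dif_pos k.2]
      · exact fun k _ hk => by_contra fun h => hk (by rw [dif_neg h, zero_smul])
    have hgj : 0 < g j := by
      simp only [g, dif_pos j.2]
      exact add_pos_of_pos_of_nonneg hj (hd _)
    obtain ⟨c, hc, hcsign, hind⟩ := exists_conformal_linearIndepOn (pairDiff p)
      fun k => if k = (j : E × E) then 0 else g k
    have hcg : ∀ k, c k ≠ 0 → 0 < c k ∧ g k ≠ 0 := fun k hk => by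
      have h := hcsign k hk
      by_cases hkj : k = (j : E × E)
      · rw [if_pos hkj, sign_zero, sign_eq_zero_iff] at h
        exact absurd h hk
      · rw [if_neg hkj] at h
        have hgk : g k ≠ 0 := by rwa [← sign_ne_zero, ← h, sign_ne_zero]
        rw [sign_pos ((hg k).lt_of_ne' hgk), sign_eq_one_iff] at h
        exact ⟨h, hgk⟩
    refine ⟨j, c, g j, j.2, hgj, fun k => ?_, fun k hk => hgf k (hcg k hk).2, hind, ?_⟩
    · by_cases hk : c k = 0
      · exact hk.ge
      · exact (hcg k hk).1.le
    · rw [hc, eq_neg_iff_add_eq_zero, ← hgsum,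
        ← Finset.sum_erase_add _ (fun k => g k • pairDiff p k) (mem_univ (j : E × E))]
      congr 1
      rw [← Finset.sum_erase_add _ _ (mem_univ (j : E × E))]
      simp only [if_true, zero_smul, add_zero]
      exact Finset.sum_congr rfl fun k hk => by rw [if_neg (Finset.ne_of_mem_erase hk)]

/-- Around an obstructed cellular string, all orientations of an independent family of
differences, together with the obstructing one, are realized by generic strings. -/
theorem IsStringHeight.exists_injective_sign_eq [AddCommGroup V] [Module ℝ V] {v : E → V}
    {π : V →ₗ[ℝ] ℝ} (hπ : ∀ e, 0 < π (v e))
    (hpar : ∀ e e', e ≠ e' → ∀ c : ℝ, v e' ≠ c • v e) {f : E → ℝ} (hf : IsStringHeight v f)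
    {j : E × E} {c : E × E → ℝ} {a : ℝ} (hj : f j.1 < f j.2) (ha : 0 < a) (hc : ∀ k, 0 ≤ c k)
    (hcf : ∀ k, c k ≠ 0 → f k.1 ≤ f k.2)
    (hsum : ∑ k, c k • pairDiff (ratioPoint v π) k = -(a • pairDiff (ratioPoint v π) j))
    {B : Set (E × E)} (hB : LinearIndepOn ℝ (pairDiff (ratioPoint v π)) B)
    (hcB : ∀ k, c k ≠ 0 → k ∈ B) (s₀ : ℝ) (hs₀ : s₀ ≠ 0) (s : E × E → ℝ) (hs : ∀ k, s k ≠ 0) :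
    ∃ h, IsStringHeight v h ∧ Function.Injective h ∧
      SignType.sign (h j.2 - h j.1) = SignType.sign s₀ ∧
      ∀ k ∈ B, SignType.sign (h k.2 - h k.1) = SignType.sign (s k) := by
  classical
  have hdiff : ∀ (ψ : V →ₗ[ℝ] ℝ) (k : E × E), ψ (ratioPoint v π k.2) - ψ (ratioPoint v π k.1) =
      ψ (pairDiff (ratioPoint v π) k) := fun ψ k => (map_sub ψ _ _).symm
  have hval : ∀ ψ : V →ₗ[ℝ] ℝ, ∑ k, c k * ψ (pairDiff (ratioPoint v π) k) =
      -(a * ψ (pairDiff (ratioPoint v π) j)) := fun ψ => by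
    simpa using congrArg ψ hsum
  suffices hmain : ∃ h, IsStringHeight v h ∧
      SignType.sign (h j.2 - h j.1) = SignType.sign s₀ ∧
      ∀ k ∈ B, SignType.sign (h k.2 - h k.1) = SignType.sign (s k) by
    obtain ⟨h, hh, hhj, hhB⟩ := hmain
    obtain ⟨ψ, hψ⟩ := exists_dual_injective hπ hpar
    obtain ⟨g, hg, hlex⟩ := hh.exists_lex (isStringHeight_dual hπ ψ)
    refine ⟨g, hg, fun e e' hee' => ?_, ?_, fun k hk => ?_⟩
    · have h1 := hlex e e'
      rw [hee', sub_self, sign_zero] at h1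
      split_ifs at h1 with h2
      · exact absurd h1.symm (sign_ne_zero.2 h2)
      · exact (hψ (sub_eq_zero.1 (sign_eq_zero_iff.1 h1.symm))).symm
    · rw [hlex, if_pos, hhj]
      rwa [← sign_ne_zero, hhj, sign_ne_zero]
    · rw [hlex, if_pos, hhB k hk]
      rw [← sign_ne_zero, hhB k hk, sign_ne_zero]
      exact hs k
  obtain ⟨ψ, hψ⟩ := hB.exists_dual_eq s
  by_cases hcase : ∃ m, c m ≠ 0 ∧ SignType.sign (s m) ≠ SignType.sign s₀
  · obtain ⟨m, hcm, hm⟩ := hcase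
    obtain ⟨φ, hφ⟩ := hB.exists_dual_eq (Pi.single m (s m))
    obtain ⟨g, hg, hlex⟩ := (isStringHeight_dual hπ φ).exists_lex (isStringHeight_dual hπ ψ)
    have hφj : SignType.sign (φ (pairDiff (ratioPoint v π) j)) = SignType.sign s₀ := by
      have h1 := hval φ
      rw [Finset.sum_eq_single m, hφ m (hcB m hcm), Pi.single_eq_same] at h1
      · have h2 := congrArg SignType.sign h1
        rw [Left.sign_neg, sign_mul, sign_mul, sign_pos ((hc m).lt_of_ne' hcm), sign_pos ha,
          one_mul, one_mul] at h2
        have h3 := sign_ne_zero.2 (hs m)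
        have h4 := sign_ne_zero.2 hs₀
        revert h2 h3 h4 hm
        generalize SignType.sign (s m) = x
        generalize SignType.sign s₀ = y
        generalize SignType.sign (φ (pairDiff (ratioPoint v π) j)) = z
        revert x y z
        decide
      · intro k _ hkm
        by_cases hck : c k = 0
        · rw [hck, zero_mul]
        · rw [hφ k (hcB k hck), Pi.single_eq_of_ne hkm, mul_zero]
      · exact fun h => absurd (mem_univ m) h
    refine ⟨g, hg, ?_, fun k hk => ?_⟩
    · rw [hlex, hdiff, hφj, if_pos]
      rwa [← sign_ne_zero, hφj, sign_ne_zero]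
    · rw [hlex, hdiff, hdiff, hφ k hk, hψ k hk]
      by_cases hkm : k = m
      · rw [hkm, Pi.single_eq_same, if_pos (hs m)]
      · rw [Pi.single_eq_of_ne hkm, if_neg (not_not.2 rfl)]
  · push Not at hcase
    obtain ⟨φ, hφ⟩ := hB.exists_dual_eq fun k => if c k = 0 then s k else 0
    obtain ⟨g, hg, hlex⟩ := (hf.mul_left s₀).exists_lex (isStringHeight_dual hπ ψ)
    obtain ⟨h, hh, hlex'⟩ := (isStringHeight_dual hπ φ).exists_lex hg
    have hφj : φ (pairDiff (ratioPoint v π) j) = 0 := by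
      have h1 := hval φ
      rw [Finset.sum_eq_zero, eq_comm, neg_eq_zero] at h1
      · exact (mul_eq_zero.1 h1).resolve_left ha.ne'
      · intro k _
        by_cases hck : c k = 0
        · rw [hck, zero_mul]
        · rw [hφ k (hcB k hck), if_neg hck, mul_zero]
    refine ⟨h, hh, ?_, fun k hk => ?_⟩
    · rw [hlex', hdiff, hφj, if_neg (not_not.2 rfl), hlex, ← mul_sub,
        if_pos (mul_ne_zero hs₀ (sub_pos.2 hj).ne'), sign_mul, sign_pos (sub_pos.2 hj), mul_one]
    · rw [hlex', hdiff, hφ k hk]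
      by_cases hck : c k = 0
      · rw [if_pos hck, if_pos (hs k)]
      · rw [if_neg hck, if_neg (not_not.2 rfl), hlex, ← mul_sub, hdiff, hψ k hk]
        split_ifs with h0
        · have h1 : 0 < f k.2 - f k.1 :=
            (sub_nonneg.2 (hcf k hck)).lt_of_ne' (right_ne_zero_of_mul h0)
          rw [sign_mul, sign_pos h1, mul_one, hcase k hck]
        · rfl

end Differences

section Main

variable {E V V' : Type*} [Fintype E]

/-- Differences of ratio points with all orientations realized by functionals are fewer than
the rank of the configuration. -/
theorem card_lt_finrank_of_forall_sign [AddCommGroup V] [Module ℝ V] {K : Type*}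
    [Fintype K] [Nonempty E] {v : E → V} {π : V →ₗ[ℝ] ℝ} (hπ : ∀ e, 0 < π (v e)) (q : K → E × E)
    (h : ∀ s : K → ℝ, (∀ k, s k ≠ 0) → ∃ ψ : V →ₗ[ℝ] ℝ, ∀ k,
      SignType.sign (ψ (pairDiff (ratioPoint v π) (q k))) = SignType.sign (s k)) :
    Fintype.card K < Module.finrank ℝ (Submodule.span ℝ (Set.range v)) := by
  have hpt : ∀ e, ratioPoint v π e ∈ Submodule.span ℝ (Set.range v) := fun e =>
    Submodule.smul_mem _ _ (Submodule.subset_span ⟨e, rfl⟩)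
  have hone : ∀ e, π (ratioPoint v π e) = 1 := fun e => by
    rw [map_ratioPoint, div_self (hπ e).ne']
  have : FiniteDimensional ℝ (Submodule.span ℝ (Set.range v)) :=
    FiniteDimensional.span_of_finite ℝ (Set.finite_range v)
  rw [← finrank_span_eq_card (linearIndependent_of_forall_sign _ h)]
  refine Submodule.finrank_lt_finrank_of_lt (SetLike.lt_iff_le_and_exists.2
    ⟨Submodule.span_le.2 ?_, ratioPoint v π (Classical.arbitrary E), hpt _, fun hmem => ?_⟩)
  · rintro _ ⟨k, rfl⟩
    exact sub_mem (hpt _) (hpt _)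
  · have hle : Submodule.span ℝ (Set.range fun k => pairDiff (ratioPoint v π) (q k)) ≤
        LinearMap.ker π := by
      refine Submodule.span_le.2 ?_
      rintro _ ⟨k, rfl⟩
      simp [pairDiff, hone]
    have h0 : π _ = 0 := hle hmem
    rw [hone] at h0
    exact one_ne_zero h0

/-- The rank of a configuration is at most one more than the size of a spanning set of
differences of ratio points. -/
theorem finrank_le_card_add_one [AddCommGroup V] [Module ℝ V] [Nonempty E] {v : E → V}
    {π : V →ₗ[ℝ] ℝ} (hπ : ∀ e, 0 < π (v e)) (B : Set (E × E)) [Fintype B]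
    (hB : pairDiff (ratioPoint v π) '' Set.univ ⊆
      Submodule.span ℝ (pairDiff (ratioPoint v π) '' B)) :
    Module.finrank ℝ (Submodule.span ℝ (Set.range v)) ≤ Fintype.card B + 1 := by
  let e₀ : E := Classical.arbitrary E
  let u : Option B → V := fun k =>
    k.elim (ratioPoint v π e₀) fun k => pairDiff (ratioPoint v π) k
  have : FiniteDimensional ℝ (Submodule.span ℝ (Set.range u)) :=
    FiniteDimensional.span_of_finite ℝ (Set.finite_range u)
  rw [← Fintype.card_option]
  refine le_trans (Submodule.finrank_mono (Submodule.span_le.2 ?_)) (finrank_range_le_card u)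
  rintro _ ⟨e, rfl⟩
  have hle : Submodule.span ℝ (pairDiff (ratioPoint v π) '' B) ≤
      Submodule.span ℝ (Set.range u) := by
    refine Submodule.span_mono ?_
    rintro _ ⟨k, hk, rfl⟩
    exact ⟨some ⟨k, hk⟩, rfl⟩
  have h1 : pairDiff (ratioPoint v π) (e₀, e) ∈ Submodule.span ℝ (Set.range u) :=
    hle (hB ⟨(e₀, e), Set.mem_univ _, rfl⟩)
  have h2 : ratioPoint v π e₀ ∈ Submodule.span ℝ (Set.range u) :=
    Submodule.subset_span ⟨none, rfl⟩
  have h3 : π (v e) • ratioPoint v π e = v e := by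
    rw [ratioPoint, smul_smul, mul_inv_cancel₀ (hπ e).ne', one_smul]
  have h4 : ratioPoint v π e ∈ Submodule.span ℝ (Set.range u) := by
    simpa [pairDiff] using add_mem h1 h2
  rw [← h3]
  exact Submodule.smul_mem _ _ h4

/-- All-coherence passes to weak map images of the same rank. -/
theorem AllCoherent.of_weakMap [NormedAddCommGroup V] [NormedSpace ℝ V]
    [NormedAddCommGroup V'] [NormedSpace ℝ V'] {v : E → V} {π : V →ₗ[ℝ] ℝ} {v' : E → V'}
    {π' : V' →ₗ[ℝ] ℝ} (hπ : ∀ e, 0 < π (v e)) (hπ' : ∀ e, 0 < π' (v' e))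
    (hpar' : ∀ e e', e ≠ e' → ∀ c : ℝ, v' e' ≠ c • v' e)
    (hrank : Module.finrank ℝ (Submodule.span ℝ (Set.range v))
      = Module.finrank ℝ (Submodule.span ℝ (Set.range v')))
    (hweak : ∀ x : E → SignType, IsSignedCircuit v x →
      ∃ y : E → SignType, IsSignedCircuit v' y ∧ ∀ e, y e ≠ 0 → y e = x e)
    (hcoh : AllCoherent v π) : AllCoherent v' π' := by
  classical
  intro l b hb
  rcases exists_dual_sign_or_exists_relation (ratioPoint v' π') fun e => ((b e : ℕ) : ℝ) with
    ⟨ψ, hψ⟩ | ⟨j, c, a, hj, ha, hc, hcf, hind, hsum⟩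
  · refine ⟨ψ, fun e e' => ?_⟩
    rw [← map_ratioPoint, ← map_ratioPoint]
    refine ⟨fun h => ?_, fun h => ?_⟩
    · have h1 := hψ e e'
      rw [h, sub_self, sign_zero, sign_eq_zero_iff] at h1
      exact (sub_eq_zero.1 h1).symm
    · rw [← sub_pos, ← sign_eq_one_iff, hψ, sign_eq_one_iff, sub_pos]
      exact_mod_cast h
  exfalso
  have : Nonempty E := ⟨j.1⟩
  obtain ⟨B, -, hcB, hspan, hB⟩ := exists_linearIndepOn_extension hind (Set.subset_univ _)
  have h1 := finrank_le_card_add_one hπ' B hspan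
  have h2 := card_lt_finrank_of_forall_sign hπ
    (fun k : Option B => k.elim j fun k => (k : E × E)) fun s hs => by
      obtain ⟨h, hh, hinj, hhj, hhB⟩ := hb.isStringHeight.exists_injective_sign_eq hπ' hpar' hj ha
        hc hcf hsum hB (fun k hk => hcB hk) (s none) (hs none)
        (fun k => if hk : k ∈ B then s (some ⟨k, hk⟩) else 1) fun k => by
          split_ifs
          · exact hs _
          · exact one_ne_zero
      obtain ⟨ψ, hψ⟩ := hcoh.exists_sign_eq (hh.of_weakMap hπ' hweak hinj)
      refine ⟨ψ, fun k => ?_⟩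
      rw [pairDiff, map_sub, hψ]
      cases k with
      | none => exact hhj
      | some k => exact (hhB k k.2).trans (by rw [dif_pos k.2])
  rw [Fintype.card_option, hrank] at h2
  omega

end Main

/-- If `v'` is a rank-preserving weak map image of `v` (both with no zero
vectors and no parallel pairs), and `(v, π)` is all-coherent, then `(v', π')` is all-coherent. -/
theorem statement8 {E : Type*} [Fintype E] {d d' : ℕ}
    (v : E → Fin d → ℝ) (π : (Fin d → ℝ) →ₗ[ℝ] ℝ)
    (v' : E → Fin d' → ℝ) (π' : (Fin d' → ℝ) →ₗ[ℝ] ℝ)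
    (hπ : ∀ e, 0 < π (v e)) (hπ' : ∀ e, 0 < π' (v' e))
    (hv : ∀ e, v e ≠ 0) (hv' : ∀ e, v' e ≠ 0)
    (hpar : ∀ e e', e ≠ e' → ∀ c : ℝ, v e' ≠ c • v e)
    (hpar' : ∀ e e', e ≠ e' → ∀ c : ℝ, v' e' ≠ c • v' e)
    (hrank : Module.finrank ℝ (Submodule.span ℝ (Set.range v))
      = Module.finrank ℝ (Submodule.span ℝ (Set.range v')))
    (hweak : ∀ x : E → SignType, IsSignedCircuit v x →
      ∃ y : E → SignType, IsSignedCircuit v' y ∧ ∀ e, y e ≠ 0 → y e = x e)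
    (hcoh : AllCoherent v π) :
    AllCoherent v' π' := by
  exact hcoh.of_weakMap hπ hπ' hpar' hrank hweak
end
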